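/- Every planar graph containing at most three triangles is 3-colorable. -/

import Mathlib

universe u
variable {V : Type u}



/-- A topological embedding (drawing) of a simple graph in a topological space `X`:
vertices map to distinct points, edges map to arcs meeting only at common endpoints. -/
structure GraphEmbeddingIn (X : Type*) [TopologicalSpace X] (G : SimpleGraph V) where
  vertexPos : V → X
  vertexInj : Function.Injective vertexPos
  edgeArc : ∀ u v : V, G.Adj u v → ℝ → X
  arc_cont : ∀ u v h, ContinuousOn (edgeArc u v h) (Set.Icc 0 1)
  arc_injOn : ∀ u v h, Set.InjOn (edgeArc u v h) (Set.Icc 0 1)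
  arc_start : ∀ u v h, edgeArc u v h 0 = vertexPos u
  arc_end : ∀ u v h, edgeArc u v h 1 = vertexPos v
  arc_avoid : ∀ u v h (w : V), vertexPos w ∉ edgeArc u v h '' Set.Ioo 0 1
  arc_disjoint : ∀ u v h u' v' h', s(u, v) ≠ s(u', v') →
    edgeArc u v h '' Set.Ioo 0 1 ∩ edgeArc u' v' h' '' Set.Icc 0 1 = ∅

/-- A graph is planar if it has a drawing in the plane. -/
def SimpleGraph.IsPlanar (G : SimpleGraph V) : Prop :=
  Nonempty (GraphEmbeddingIn (ℝ × ℝ) G)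

namespace ThreeTriangles
open Finset
open scoped Classical

section Counting

/-- `G` has a proper 3-colouring on the vertex set `S`. -/
def ColOn (G : SimpleGraph V) (S : Finset V) : Prop :=
  ∃ φ : V → Fin 3, ∀ u ∈ S, ∀ v ∈ S, G.Adj u v → φ u ≠ φ v

/-- The number of ordered pairs in `S × T` that are adjacent. -/
noncomputable def darts (G : SimpleGraph V) (S T : Finset V) : ℤ :=
  ∑ u ∈ S, ∑ v ∈ T, if G.Adj u v then 1 else 0

/-- Twice the Kostochka–Yancey potential of a vertex set. -/
noncomputable def pot (G : SimpleGraph V) (S : Finset V) : ℤ :=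
  10 * (#S : ℤ) - 3 * darts G S S

lemma darts_nonneg (G : SimpleGraph V) (S T : Finset V) : 0 ≤ darts G S T := by
  unfold darts
  refine sum_nonneg fun u _ => sum_nonneg fun v _ => ?_
  split_ifs <;> norm_num

lemma darts_comm (G : SimpleGraph V) (S T : Finset V) : darts G S T = darts G T S := by
  unfold darts
  rw [sum_comm]
  simp only [G.adj_comm]

lemma darts_union_left (G : SimpleGraph V) {S S' : Finset V} (T : Finset V)
    (h : Disjoint S S') : darts G (S ∪ S') T = darts G S T + darts G S' T := by
  unfold darts; rw [sum_union h]

lemma darts_union_right (G : SimpleGraph V) (S : Finset V) {T T' : Finset V}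
    (h : Disjoint T T') : darts G S (T ∪ T') = darts G S T + darts G S T' := by
  rw [darts_comm, darts_union_left G S h, darts_comm G T, darts_comm G T']

lemma darts_union_self (G : SimpleGraph V) {S T : Finset V} (h : Disjoint S T) :
    darts G (S ∪ T) (S ∪ T) = darts G S S + 2 * darts G S T + darts G T T := by
  rw [darts_union_left G _ h, darts_union_right G _ h, darts_union_right G _ h, darts_comm G T S]
  ring

lemma darts_mono {G : SimpleGraph V} {S S' T T' : Finset V} (hS : S ⊆ S') (hT : T ⊆ T') :
    darts G S T ≤ darts G S' T' := by
  have key : ∀ {A A' B : Finset V}, A ⊆ A' → darts G A B ≤ darts G A' B := by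
    intro A A' B h
    have := darts_union_left G B (disjoint_sdiff (s := A) (t := A'))
    rw [union_sdiff_of_subset h] at this
    have := darts_nonneg G (A' \ A) B
    linarith
  calc darts G S T ≤ darts G S' T := key hS
    _ = darts G T S' := darts_comm ..
    _ ≤ darts G T' S' := key hT
    _ = _ := darts_comm ..

lemma darts_self_le (G : SimpleGraph V) (S : Finset V) :
    darts G S S ≤ (#S : ℤ) * (#S - 1) := by
  unfold darts
  calc ∑ u ∈ S, ∑ v ∈ S, (if G.Adj u v then (1 : ℤ) else 0)
      ≤ ∑ u ∈ S, ((#S : ℤ) - 1) := by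
        refine sum_le_sum fun u hu => ?_
        rw [← sum_erase_add _ _ hu]
        have : ∑ x ∈ S.erase u, (if G.Adj u x then (1 : ℤ) else 0) ≤ ∑ x ∈ S.erase u, 1 :=
          sum_le_sum fun v _ => by split_ifs <;> norm_num
        simp only [sum_const, card_erase_of_mem hu, SimpleGraph.irrefl, if_false] at this ⊢
        have h1 : 1 ≤ #S := card_pos.2 ⟨u, hu⟩
        simpa [Nat.cast_sub h1] using this
    _ = _ := by simp; ring

lemma one_le_darts {G : SimpleGraph V} {S T : Finset V} {u v : V} (hu : u ∈ S) (hv : v ∈ T)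
    (h : G.Adj u v) : 1 ≤ darts G S T := by
  have := darts_mono (G := G) (singleton_subset_iff.2 hu) (singleton_subset_iff.2 hv)
  simpa only [darts, sum_singleton, h, if_true] using this

lemma colOn_of_card_le_three (G : SimpleGraph V) {S : Finset V} (h : #S ≤ 3) : ColOn G S := by
  obtain ⟨e⟩ : Nonempty (S ↪ Fin 3) := by
    apply Function.Embedding.nonempty_of_card_le
    simpa using h
  refine ⟨fun v => if hv : v ∈ S then e ⟨v, hv⟩ else 0, fun u hu v hv huv => ?_⟩
  simp only [hu, hv, dif_pos]
  intro h
  have := e.injective h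
  simp at this
  exact huv.ne this

/-- Replace the coloured set `R` by a triangle of colour representatives. -/
def collapse (G : SimpleGraph V) (R : Finset V) (φ : V → Fin 3) : SimpleGraph (V ⊕ Fin 3) where
  Adj
    | .inl u, .inl v => G.Adj u v
    | .inl u, .inr i => ∃ r ∈ R, φ r = i ∧ G.Adj u r
    | .inr i, .inl u => ∃ r ∈ R, φ r = i ∧ G.Adj u r
    | .inr i, .inr j => i ≠ j
  symm := ⟨by
    rintro (u | i) (v | j) h
    · exact SimpleGraph.Adj.symm h
    · exact h
    · exact h
    · exact Ne.symm h⟩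
  loopless := ⟨by
    rintro (u | i) h
    · exact G.irrefl h
    · exact h rfl⟩

lemma colOn_of_collapse {G : SimpleGraph V} {R S : Finset V} {φ : V → Fin 3}
    (hφ : ∀ u ∈ R, ∀ v ∈ R, G.Adj u v → φ u ≠ φ v)
    (h : ColOn (collapse G R φ) ((S \ R).disjSum univ)) : ColOn G S := by
  obtain ⟨ψ, hψ⟩ := h
  have hX : ∀ i j, ψ (.inr i) = ψ (.inr j) → i = j := by
    intro i j hij
    by_contra hne
    exact hψ (.inr i) (by simp) (.inr j) (by simp) hne hij
  have hmix : ∀ u ∈ S, u ∉ R → ∀ r ∈ R, G.Adj u r → ψ (.inl u) ≠ ψ (.inr (φ r)) := by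
    intro u hu huR r hr hur
    exact hψ (.inl u) (by simp [hu, huR]) (.inr (φ r)) (by simp) ⟨r, hr, rfl, hur⟩
  refine ⟨fun v => if v ∈ R then ψ (.inr (φ v)) else ψ (.inl v), fun u hu v hv huv => ?_⟩
  by_cases h1 : u ∈ R <;> by_cases h2 : v ∈ R <;> simp only [h1, h2, if_true, if_false]
  · exact fun h => hφ u h1 v h2 huv (hX _ _ h)
  · exact fun h => hmix v hv h2 u h1 huv.symm h.symm
  · exact hmix u hu h1 v h2 huv
  · exact hψ (.inl u) (by simp [hu, h1]) (.inl v) (by simp [hv, h2]) huv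

lemma pot_collapse_le (G : SimpleGraph V) {R W : Finset V} (I : Finset (Fin 3)) {φ : V → Fin 3}
    (hWR : Disjoint W R) :
    pot G (W ∪ R) + (10 * (#I : ℤ) - 3 * (#I * (#I - 1)))
        + 6 * darts G W (R.filter fun r => φ r ∉ I)
      ≤ pot (collapse G R φ) (W.disjSum I) + pot G R := by
  have h1 : darts (collapse G R φ) (W.disjSum I) (W.disjSum I)
      ≤ darts G W W + 2 * darts G W (R.filter fun r => φ r ∈ I) + #I * (#I - 1) := by
    have e1 : ∑ u ∈ W, ∑ i ∈ I, (if (collapse G R φ).Adj (.inl u) (.inr i) then (1 : ℤ) else 0)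
        ≤ darts G W (R.filter fun r => φ r ∈ I) := by
      unfold darts
      refine sum_le_sum fun u _ => ?_
      rw [← sum_fiberwise_of_maps_to (s := R.filter fun r => φ r ∈ I) (t := I) (g := φ)
        (by intro r hr; exact (mem_filter.1 hr).2)]
      refine sum_le_sum fun i hi => ?_
      split_ifs with h
      · obtain ⟨r, hr, hri, hur⟩ := h
        have : ∀ x ∈ (R.filter fun r => φ r ∈ I).filter (fun r => φ r = i),
            (0 : ℤ) ≤ if G.Adj u x then 1 else 0 := by intros; split_ifs <;> norm_num
        have := single_le_sum this (a := r) (by simp [hr, hri, hi])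
        simpa [hur] using this
      · exact sum_nonneg fun _ _ => by split_ifs <;> norm_num
    have e2 : ∑ i ∈ I, ∑ u ∈ W, (if (collapse G R φ).Adj (.inr i) (.inl u) then (1 : ℤ) else 0)
        = ∑ u ∈ W, ∑ i ∈ I, (if (collapse G R φ).Adj (.inl u) (.inr i) then (1 : ℤ) else 0) := by
      rw [sum_comm]; simp only [SimpleGraph.adj_comm]
    have e3 : ∑ i ∈ I, ∑ j ∈ I, (if (collapse G R φ).Adj (.inr i) (.inr j) then (1 : ℤ) else 0)
        ≤ #I * (#I - 1) := darts_self_le (⊤ : SimpleGraph (Fin 3)) I |>.trans' (by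
          unfold darts
          refine le_of_eq (sum_congr rfl fun i _ => sum_congr rfl fun j _ => ?_)
          congr 1)
    have e4 : ∑ u ∈ W, ∑ v ∈ W, (if (collapse G R φ).Adj (.inl u) (.inl v) then (1 : ℤ) else 0)
        = darts G W W := rfl
    unfold darts at e1 e4 ⊢
    simp only [sum_disjSum, sum_add_distrib]
    linarith
  have h2 : darts G W R = darts G W (R.filter fun r => φ r ∈ I)
      + darts G W (R.filter fun r => φ r ∉ I) := by
    rw [← darts_union_right G W (disjoint_filter_filter_not R R _), filter_union_filter_not_eq]
  unfold pot
  rw [darts_union_self G hWR, card_union_of_disjoint hWR, card_disjSum]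
  push_cast
  linarith

end Counting

section Criticality

/-- The neighbours of `v` inside `S`. -/
noncomputable def nbr (G : SimpleGraph V) (S : Finset V) (v : V) : Finset V := S.filter (G.Adj v)

lemma mem_nbr {G : SimpleGraph V} {S : Finset V} {v w : V} :
    w ∈ nbr G S v ↔ w ∈ S ∧ G.Adj v w := mem_filter

lemma darts_eq_sum (G : SimpleGraph V) (S T : Finset V) :
    darts G S T = ∑ v ∈ S, (#(nbr G T v) : ℤ) := by
  unfold darts nbr
  exact sum_congr rfl fun v _ => by rw [sum_boole]

lemma darts_sup_edge_le (G : SimpleGraph V) (u v : V) (U : Finset V) :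
    darts (G ⊔ SimpleGraph.edge u v) U U ≤ darts G U U + 2 := by
  have aux : ∀ a b : V, ∑ x ∈ U, ∑ y ∈ U, (if x = a ∧ y = b then (1 : ℤ) else 0) ≤ 1 := by
    intro a b
    simp only [ite_and, sum_ite_irrel, sum_const_zero, sum_ite_eq']
    split_ifs <;> norm_num
  have h1 := aux u v
  have h2 := aux v u
  have : darts (G ⊔ SimpleGraph.edge u v) U U ≤ ∑ x ∈ U, ∑ y ∈ U, ((if G.Adj x y then (1 : ℤ) else 0) +
        (if x = u ∧ y = v then (1 : ℤ) else 0) + (if x = v ∧ y = u then (1 : ℤ) else 0)) := by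
    unfold darts
    refine sum_le_sum fun x _ => sum_le_sum fun y _ => ?_
    simp only [SimpleGraph.sup_adj, SimpleGraph.edge_adj]
    split_ifs <;> first | omega | tauto
  simp only [sum_add_distrib] at this
  unfold darts at *
  linarith

/-- A minimal counterexample to the Kostochka–Yancey bound. -/
structure KYMin (G : SimpleGraph V) (S : Finset V) : Prop where
  ih : ∀ (V' : Type u) (G' : SimpleGraph V') (S' : Finset V'), #S' < #S → ¬ ColOn G' S' →
    ∃ W ⊆ S', ¬ ColOn G' W ∧ pot G' W ≤ 4
  not_col : ¬ ColOn G S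
  crit : ∀ W ⊆ S, W ≠ S → ColOn G W
  four_lt : 4 < pot G S

namespace KYMin
variable {G : SimpleGraph V} {S : Finset V}

lemma reduce (h : KYMin G S) {R : Finset V} (hRS : R ⊆ S) (h4 : 4 ≤ #R)
    {φ : V → Fin 3} (hφ : ∀ u ∈ R, ∀ v ∈ R, G.Adj u v → φ u ≠ φ v) :
    ∃ (W : Finset V) (I : Finset (Fin 3)), W ⊆ S \ R ∧ I.Nonempty ∧
      pot G (W ∪ R) + (10 * (#I : ℤ) - 3 * (#I * (#I - 1)))
        + 6 * darts G W (R.filter fun r => φ r ∉ I) ≤ 4 + pot G R := by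
  have hnc : ¬ ColOn (collapse G R φ) ((S \ R).disjSum univ) :=
    fun hc => h.not_col (colOn_of_collapse hφ hc)
  obtain ⟨U, hU, hUc, hUp⟩ := h.ih _ _ _ (by
    rw [card_disjSum, card_sdiff_of_subset hRS, card_univ, Fintype.card_fin]
    have := card_le_card hRS
    omega) hnc
  have hU' : U.toLeft.disjSum U.toRight = U := toLeft_disjSum_toRight
  have hW : U.toLeft ⊆ S \ R := fun x hx => by
    have := hU (mem_toLeft.1 hx)
    simpa using this
  refine ⟨U.toLeft, U.toRight, hW, ?_, ?_⟩
  · by_contra hI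
    rw [not_nonempty_iff_eq_empty] at hI
    obtain ⟨ψ, hψ⟩ := h.crit U.toLeft (hW.trans sdiff_subset) (by
      intro he
      obtain ⟨r, hr⟩ := card_pos.1 (show 0 < #R by omega)
      have : r ∈ U.toLeft := he ▸ hRS hr
      exact (mem_sdiff.1 (hW this)).2 hr)
    refine hUc ⟨Sum.elim ψ id, ?_⟩
    rintro (u | i) hu (v | j) hv huv
    · exact hψ u (mem_toLeft.2 hu) v (mem_toLeft.2 hv) huv
    · have := mem_toRight.2 hv
      simp [hI] at this
    · have := mem_toRight.2 hu
      simp [hI] at this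
    · exact huv
  · have hd : Disjoint U.toLeft R := disjoint_of_subset_left hW sdiff_disjoint
    have := pot_collapse_le G (I := U.toRight) (φ := φ) hd
    rw [hU'] at this
    linarith

lemma value_ge {I : Finset (Fin 3)} (hI : I.Nonempty) :
    10 ≤ 10 * (#I : ℤ) - 3 * (#I * (#I - 1)) ∧
      (#I ≠ 1 → 12 ≤ 10 * (#I : ℤ) - 3 * (#I * (#I - 1))) := by
  have h1 := hI.card_pos
  have h2 : #I ≤ 3 := card_finset_fin_le I
  interval_cases #I <;> norm_num

lemma pot_gt_ten (h : KYMin G S) {R : Finset V} (hRS : R ⊆ S) (hne : R ≠ S) (h2 : 2 ≤ #R) :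
    10 < pot G R := by
  by_contra! hR
  obtain ⟨R₀, hR₀, hmin⟩ := exists_min_image
    (S.powerset.filter fun R => R ≠ S ∧ 2 ≤ #R ∧ pot G R ≤ 10) (pot G)
    ⟨R, by simp [hRS, hne, h2, hR]⟩
  simp only [mem_filter, mem_powerset] at hR₀ hmin
  obtain ⟨hs, hn, hc, hp⟩ := hR₀
  have h4 : 4 ≤ #R₀ := by
    by_contra! hlt
    have := darts_self_le G R₀
    unfold pot at hp
    interval_cases #R₀ <;> norm_num at * <;> omega
  obtain ⟨φ, hφ⟩ := h.crit R₀ hs hn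
  obtain ⟨W, I, hW, hI, hle⟩ := h.reduce hs h4 hφ
  have hv := (value_ge hI).1
  have hd := darts_nonneg G W (R₀.filter fun r => φ r ∉ I)
  by_cases hWS : W ∪ R₀ = S
  · have := h.four_lt
    rw [hWS] at hle
    linarith
  · have := hmin (W ∪ R₀) ⟨union_subset (hW.trans sdiff_subset) hs, hWS,
      hc.trans (card_le_card subset_union_right), by linarith⟩
    linarith

lemma no_cut (h : KYMin G S) {R : Finset V} (hRS : R ⊆ S) (hne : R ≠ S) (h2 : 2 ≤ #R) :
    ∃ u ∈ R, ∃ v ∈ R, u ≠ v ∧ (∃ w ∈ S \ R, G.Adj u w) ∧ ∃ w ∈ S \ R, G.Adj v w := by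
  by_contra hcon
  have : ∃ u₀ ∈ R, ∀ r ∈ R, ∀ w ∈ S \ R, G.Adj r w → r = u₀ := by
    by_cases hex : ∃ u₀ ∈ R, ∃ w ∈ S \ R, G.Adj u₀ w
    · obtain ⟨u₀, hu₀, hw₀⟩ := hex
      refine ⟨u₀, hu₀, fun r hr w hw hrw => ?_⟩
      by_contra hru
      exact hcon ⟨r, hr, u₀, hu₀, hru, ⟨w, hw, hrw⟩, hw₀⟩
    · obtain ⟨u₀, hu₀⟩ := card_pos.1 (show 0 < #R by omega)
      exact ⟨u₀, hu₀, fun r hr w hw hrw => (hex ⟨r, hr, w, hw, hrw⟩).elim⟩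
  obtain ⟨u₀, hu₀, huniq⟩ := this
  obtain ⟨φ, hφ⟩ := h.crit R hRS hne
  obtain ⟨ψ, hψ⟩ := h.crit (insert u₀ (S \ R)) (insert_subset (hRS hu₀) sdiff_subset) (by
    intro he
    obtain ⟨a, ha, b, hb, hab⟩ := one_lt_card.1 h2
    have ha' := he.symm ▸ hRS ha
    have hb' := he.symm ▸ hRS hb
    simp only [mem_insert, mem_sdiff, ha, hb, not_true, and_false, or_false] at ha' hb'
    exact hab (ha'.trans hb'.symm))
  refine h.not_col ⟨fun v => if v ∈ R then φ v else Equiv.swap (ψ u₀) (φ u₀) (ψ v),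
    fun u hu v hv huv => ?_⟩
  by_cases h1 : u ∈ R <;> by_cases h3 : v ∈ R <;> simp only [h1, h3, if_true, if_false]
  · exact hφ u h1 v h3 huv
  · have := huniq u h1 v (mem_sdiff.2 ⟨hv, h3⟩) huv
    subst this
    have := hψ u (mem_insert_self ..) v (mem_insert_of_mem (mem_sdiff.2 ⟨hv, h3⟩)) huv
    intro he
    apply this
    apply (Equiv.swap (ψ u) (φ u)).injective
    rw [← he, Equiv.swap_apply_left]
  · have := huniq v h3 u (mem_sdiff.2 ⟨hu, h1⟩) huv.symm
    subst this
    have := hψ v (mem_insert_self ..) u (mem_insert_of_mem (mem_sdiff.2 ⟨hu, h1⟩)) huv.symm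
    intro he
    apply this
    apply (Equiv.swap (ψ v) (φ v)).injective
    rw [he, Equiv.swap_apply_left]
  · intro he
    exact hψ u (mem_insert_of_mem (mem_sdiff.2 ⟨hu, h1⟩)) v
      (mem_insert_of_mem (mem_sdiff.2 ⟨hv, h3⟩)) huv ((Equiv.swap _ _).injective he)

lemma pot_gt_twelve (h : KYMin G S) {R : Finset V} (hRS : R ⊆ S) (hne : R ≠ S) (h4 : 4 ≤ #R) :
    12 < pot G R := by
  by_contra! hR
  obtain ⟨u, hu, v, hv, huv, hwu, hwv⟩ := h.no_cut hRS hne (by omega)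
  have hcol : ColOn (G ⊔ SimpleGraph.edge u v) R := by
    by_contra hc
    obtain ⟨U, hU, hUc, hUp⟩ := h.ih _ _ R
      (card_lt_card (hRS.ssubset_of_ne hne)) hc
    have h4 : 4 ≤ #U := by
      by_contra! hlt
      exact hUc (colOn_of_card_le_three _ (by omega))
    have := h.pot_gt_ten (hU.trans hRS) (fun he => hne (hRS.antisymm (he ▸ hU))) (by omega)
    have := darts_sup_edge_le G u v U
    unfold pot at *
    linarith
  obtain ⟨φ, hφ⟩ := hcol
  have hφuv : φ u ≠ φ v := hφ u hu v hv (by simp [SimpleGraph.edge_adj, huv])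
  obtain ⟨W, I, hW, hI, hle⟩ := h.reduce hRS h4
    (φ := φ) (fun a ha b hb hab => hφ a ha b hb (Or.inl hab))
  obtain ⟨hv1, hv2⟩ := value_ge hI
  have hd := darts_nonneg G W (R.filter fun r => φ r ∉ I)
  have hWS : W ∪ R = S := by
    by_contra hn
    have := h.pot_gt_ten (union_subset (hW.trans sdiff_subset) hRS) hn
      (le_trans (by omega) (card_le_card subset_union_right))
    linarith
  have h5 := h.four_lt
  rw [hWS] at hle
  have hI1 : #I = 1 := by
    by_contra hn
    have := hv2 hn
    linarith
  have hWeq : ∀ w ∈ S \ R, w ∈ W := fun w hw => by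
    rw [mem_sdiff, ← hWS, mem_union] at hw
    tauto
  have : ∃ r ∈ R, φ r ∉ I ∧ ∃ w ∈ S \ R, G.Adj r w := by
    by_contra hn
    obtain ⟨i, hi⟩ := card_eq_one.1 hI1
    have hui : φ u ∈ I := by by_contra hui; exact hn ⟨u, hu, hui, hwu⟩
    have hvi : φ v ∈ I := by by_contra hvi; exact hn ⟨v, hv, hvi, hwv⟩
    rw [hi, mem_singleton] at hui hvi
    exact hφuv (hui.trans hvi.symm)
  obtain ⟨r, hr, hrI, w, hw, hrw⟩ := this
  have := one_le_darts (hWeq w hw) (T := R.filter fun r => φ r ∉ I)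
    (mem_filter.2 ⟨hr, hrI⟩) hrw.symm
  linarith

lemma exists_avoid (A : Finset (Fin 3)) (h : #A ≤ 2) : ∃ c, c ∉ A := by
  by_contra! hc
  have : A = univ := eq_univ_of_forall hc
  simp [this] at h

lemma three_le_nbr (h : KYMin G S) {v : V} (hv : v ∈ S) : 3 ≤ #(nbr G S v) := by
  by_contra! hlt
  obtain ⟨φ, hφ⟩ := h.crit (S.erase v) (erase_subset _ _)
    (fun he => notMem_erase v S (he.symm ▸ hv))
  obtain ⟨c, hc⟩ := exists_avoid ((nbr G S v).image φ) (card_image_le.trans (by omega))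
  have hc' : ∀ w ∈ S, G.Adj v w → c ≠ φ w := fun w hw hvw he =>
    hc (mem_image.2 ⟨w, mem_nbr.2 ⟨hw, hvw⟩, he.symm⟩)
  refine h.not_col ⟨Function.update φ v c, fun a ha b hb hab => ?_⟩
  by_cases h1 : a = v
  · subst h1
    rw [Function.update_self, Function.update_of_ne hab.ne']
    exact hc' b hb hab
  · by_cases h2 : b = v
    · subst h2
      rw [Function.update_self, Function.update_of_ne hab.ne]
      exact (hc' a ha hab.symm).symm
    · rw [Function.update_of_ne h1, Function.update_of_ne h2]
      exact hφ a (mem_erase.2 ⟨h1, ha⟩) b (mem_erase.2 ⟨h2, hb⟩) hab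

/-- Redirect the edges at `b` to `a`. -/
def redirect (G : SimpleGraph V) (a b : V) : SimpleGraph V where
  Adj u v := u ≠ v ∧ (G.Adj u v ∨ (u = a ∧ G.Adj b v) ∨ (v = a ∧ G.Adj b u))
  symm := ⟨by
    rintro u v ⟨h, h'⟩
    refine ⟨h.symm, ?_⟩
    rw [G.adj_comm]
    tauto⟩
  loopless := ⟨fun u h => h.1 rfl⟩

lemma darts_redirect_le (G : SimpleGraph V) (a b : V) (W : Finset V) :
    darts (redirect G a b) W W ≤ darts G W W + 2 * darts G {b} W := by
  have e : ∀ u v, (if (redirect G a b).Adj u v then (1 : ℤ) else 0) ≤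
      (if G.Adj u v then 1 else 0) + (if u = a then if G.Adj b v then 1 else 0 else 0)
        + (if v = a then if G.Adj b u then 1 else 0 else 0) := by
    intro u v
    unfold redirect
    dsimp only
    split_ifs <;> first | omega | tauto
  have h1 : ∑ u ∈ W, ∑ v ∈ W, (if u = a then if G.Adj b v then (1 : ℤ) else 0 else 0)
      ≤ darts G {b} W := by
    have := darts_nonneg G {b} W
    simp only [sum_ite_irrel, sum_const_zero, sum_ite_eq', darts, sum_singleton] at this ⊢
    split_ifs <;> simp at * 
  have h2 : ∑ u ∈ W, ∑ v ∈ W, (if v = a then if G.Adj b u then (1 : ℤ) else 0 else 0)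
      ≤ darts G {b} W := by rw [sum_comm]; exact h1
  have h3 := sum_le_sum fun u (_ : u ∈ W) => sum_le_sum fun v (_ : v ∈ W) => e u v
  simp only [sum_add_distrib] at h3
  unfold darts at *
  linarith

lemma adj_of_nbr_eq (h : KYMin G S) {x y a b : V} (hx : x ∈ S) (hy : y ∈ S)
    (hN : nbr G S x = {y, a, b}) (hya : y ≠ a) (hyb : y ≠ b) (hab : a ≠ b)
    (hNy : #(nbr G S y) = 3) : G.Adj a b := by
  by_contra hnab
  have hxy : G.Adj x y := (mem_nbr.1 (hN ▸ by simp : y ∈ nbr G S x)).2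
  obtain ⟨haS, hxa⟩ := mem_nbr.1 (hN ▸ by simp : a ∈ nbr G S x)
  obtain ⟨hbS, hxb⟩ := mem_nbr.1 (hN ▸ by simp : b ∈ nbr G S x)
  set S' := S \ {x, y, b} with hS'
  have hmem : ∀ v, v ∈ S' ↔ v ∈ S ∧ v ≠ x ∧ v ≠ y ∧ v ≠ b := by
    intro v; simp [hS']
  have hnc : ¬ ColOn (redirect G a b) S' := by
    rintro ⟨φ, hφ⟩
    set φ₁ : V → Fin 3 := Function.update φ b (φ a) with hφ₁
    have hp : ∀ u ∈ S, ∀ v ∈ S, u ≠ x → u ≠ y → v ≠ x → v ≠ y → G.Adj u v → φ₁ u ≠ φ₁ v := by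
      have hb : ∀ v ∈ S, v ≠ x → v ≠ y → G.Adj b v → φ₁ b ≠ φ₁ v := by
        intro v hv h1 h2 hbv
        have h3 : v ≠ b := hbv.ne'
        have hva : v ≠ a := fun he => hnab (he ▸ hbv.symm)
        rw [hφ₁, Function.update_self, Function.update_of_ne h3]
        exact hφ a ((hmem a).2 ⟨haS, hxa.ne', hya.symm, hab⟩) v ((hmem v).2 ⟨hv, h1, h2, h3⟩)
          ⟨hva.symm, Or.inr (Or.inl ⟨rfl, hbv⟩)⟩
      intro u hu v hv h1 h2 h3 h4 huv
      by_cases hub : u = b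
      · subst hub; exact hb v hv h3 h4 huv
      · by_cases hvb : v = b
        · subst hvb; exact (hb u hu h1 h2 huv.symm).symm
        · rw [hφ₁, Function.update_of_ne hub, Function.update_of_ne hvb]
          exact hφ u ((hmem u).2 ⟨hu, h1, h2, hub⟩) v ((hmem v).2 ⟨hv, h3, h4, hvb⟩)
            ⟨huv.ne, Or.inl huv⟩
    obtain ⟨cy, hcy⟩ := exists_avoid (((nbr G S y).erase x).image φ₁) (card_image_le.trans (by
      rw [card_erase_of_mem (mem_nbr.2 ⟨hx, hxy.symm⟩), hNy]))
    obtain ⟨cx, hcx⟩ := exists_avoid {cy, φ a} card_le_two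
    simp only [mem_insert, mem_singleton, not_or] at hcx
    have hyv : ∀ v ∈ S, v ≠ x → G.Adj y v → cy ≠ φ₁ v := fun v hv hvx hyv he =>
      hcy (mem_image.2 ⟨v, mem_erase.2 ⟨hvx, mem_nbr.2 ⟨hv, hyv⟩⟩, he.symm⟩)
    have hxv : ∀ v ∈ S, v ≠ y → G.Adj x v → cx ≠ φ₁ v := by
      intro v hv hvy hxv
      have : v ∈ nbr G S x := mem_nbr.2 ⟨hv, hxv⟩
      rw [hN] at this
      simp only [mem_insert, mem_singleton, hvy, false_or] at this
      rcases this with rfl | rfl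
      · rw [hφ₁, Function.update_of_ne hab]; exact hcx.2
      · rw [hφ₁, Function.update_self]; exact hcx.2
    refine h.not_col ⟨fun v => if v = x then cx else if v = y then cy else φ₁ v,
      fun u hu v hv huv => ?_⟩
    dsimp only
    by_cases h1 : u = x
    · by_cases h3 : v = x
      · exact (huv.ne (h1.trans h3.symm)).elim
      · rw [if_pos h1, if_neg h3]
        subst h1
        by_cases h4 : v = y
        · rw [if_pos h4]; exact hcx.1
        · rw [if_neg h4]; exact hxv v hv h4 huv
    · by_cases h3 : v = x
      · rw [if_neg h1, if_pos h3]
        subst h3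
        by_cases h4 : u = y
        · rw [if_pos h4]; exact Ne.symm hcx.1
        · rw [if_neg h4]; exact (hxv u hu h4 huv.symm).symm
      · rw [if_neg h1, if_neg h3]
        by_cases h2 : u = y
        · by_cases h4 : v = y
          · exact (huv.ne (h2.trans h4.symm)).elim
          · rw [if_pos h2, if_neg h4]; subst h2; exact hyv v hv h3 huv
        · by_cases h4 : v = y
          · rw [if_neg h2, if_pos h4]; subst h4; exact (hyv u hu h1 huv.symm).symm
          · rw [if_neg h2, if_neg h4]; exact hp u hu v hv h1 h2 h3 h4 huv
  obtain ⟨W, hW, hWc, hWp⟩ := h.ih _ _ S' (card_lt_card (by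
    refine ssubset_of_subset_of_ne sdiff_subset fun he => ?_
    exact ((hmem x).1 (he ▸ hx)).2.1 rfl)) hnc
  have hWm : ∀ v ∈ W, v ∈ S ∧ v ≠ x ∧ v ≠ y ∧ v ≠ b := fun v hv => (hmem v).1 (hW hv)
  have haW : a ∈ W := by
    by_contra haW
    obtain ⟨φ, hφ⟩ := h.crit W (hW.trans sdiff_subset) (fun he => (hWm x (he ▸ hx)).2.1 rfl)
    refine hWc ⟨φ, fun u hu v hv huv => hφ u hu v hv ?_⟩
    obtain ⟨-, h1 | ⟨rfl, -⟩ | ⟨rfl, -⟩⟩ := huv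
    · exact h1
    · exact (haW hu).elim
    · exact (haW hv).elim
  have h4 : 4 ≤ #W := by
    by_contra! hlt
    exact hWc (colOn_of_card_le_three _ (by omega))
  have hbW : Disjoint W {b} := disjoint_singleton_right.2 fun hb => (hWm b hb).2.2.2 rfl
  have hxW : Disjoint (W ∪ {b}) {x} := disjoint_singleton_right.2 fun hx => by
    rcases mem_union.1 hx with h1 | h1
    · exact (hWm x h1).2.1 rfl
    · exact hxb.ne (mem_singleton.1 h1)
  have hbig := h.pot_gt_twelve (R := (W ∪ {b}) ∪ {x})
    (by
      intro v hv
      simp only [mem_union, mem_singleton] at hv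
      rcases hv with (hv | rfl) | rfl
      · exact (hWm v hv).1
      · exact hbS
      · exact hx)
    (by
      intro he
      have hyR := he.symm ▸ hy
      simp only [mem_union, mem_singleton] at hyR
      rcases hyR with (hv | hv) | hv
      · exact (hWm y hv).2.2.1 rfl
      · exact hyb hv
      · exact hxy.ne' hv)
    (h4.trans (card_le_card (subset_union_left.trans subset_union_left)))
  have hd := darts_redirect_le G a b W
  have h1 : 1 ≤ darts G W {x} := one_le_darts haW (mem_singleton_self x) hxa.symm
  have h2 : 1 ≤ darts G {b} {x} := one_le_darts (mem_singleton_self b) (mem_singleton_self x) hxb.symm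
  have h3 := darts_nonneg G {b} {b}
  have h5 := darts_nonneg G {x} {x}
  have h6 := darts_comm G {b} W
  unfold pot at hWp hbig
  rw [darts_union_self G hxW, darts_union_self G hbW, card_union_of_disjoint hxW,
    card_union_of_disjoint hbW, darts_union_left G _ hbW] at hbig
  push_cast [card_singleton] at hbig
  linarith

lemma small_nbr_le_one (h : KYMin G S) {x : V} (hx : x ∈ S) (hd : #(nbr G S x) = 3) :
    #((nbr G S x).filter fun v => #(nbr G S v) = 3) ≤ 1 := by
  by_contra! hlt
  obtain ⟨y, hy, y', hy', hyy⟩ := one_lt_card.1 hlt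
  rw [mem_filter] at hy hy'
  have : ∃ b, nbr G S x = {y, y', b} ∧ b ≠ y ∧ b ≠ y' := by
    have h1 : #(((nbr G S x).erase y).erase y') = 1 := by
      rw [card_erase_of_mem (mem_erase.2 ⟨hyy.symm, hy'.1⟩), card_erase_of_mem hy.1, hd]
    obtain ⟨b, hb⟩ := card_eq_one.1 h1
    have hb' : b ∈ ((nbr G S x).erase y).erase y' := hb ▸ mem_singleton_self b
    simp only [mem_erase] at hb'
    refine ⟨b, ?_, hb'.2.1, hb'.1⟩
    rw [← hb, insert_erase (mem_erase.2 ⟨hyy.symm, hy'.1⟩), insert_erase hy.1]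
  obtain ⟨b, hN, hby, hby'⟩ := this
  obtain ⟨hyS, hxy⟩ := mem_nbr.1 hy.1
  obtain ⟨hyS', hxy'⟩ := mem_nbr.1 hy'.1
  obtain ⟨hbS, hxb⟩ := mem_nbr.1 (hN ▸ by simp : b ∈ nbr G S x)
  have e1 : G.Adj y' b := h.adj_of_nbr_eq hx hyS hN hyy hby.symm hby'.symm hy.2
  have e2 : G.Adj y b := h.adj_of_nbr_eq hx hyS' (by rw [hN, insert_comm]) hyy.symm hby'.symm
    hby.symm hy'.2
  have hcard : #({x, y, y', b} : Finset V) = 4 := by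
    rw [card_insert_of_notMem, card_insert_of_notMem, card_insert_of_notMem, card_singleton] <;>
      simp [hxy.ne, hxy'.ne, hxb.ne, hyy, hby.symm, hby'.symm]
  have hdarts : darts G {x, y, y', b} {x, y, y', b} = 10 + if G.Adj y y' then 2 else 0 := by
    have hyb := e2.symm
    have hyb' := e1.symm
    unfold darts
    simp only [sum_insert, sum_singleton, mem_insert, mem_singleton, hxy.ne, hxy'.ne, hxb.ne, hyy,
      hby.symm, hby'.symm, or_self, not_false_iff, SimpleGraph.irrefl, if_true, if_false,
      hxy, hxy', hxb, hxy.symm, hxy'.symm, hxb.symm, e1, e2, hyb, hyb']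
    rw [G.adj_comm y' y]
    split_ifs <;> norm_num
  have hsub : ({x, y, y', b} : Finset V) ⊆ S := by
    simp [insert_subset_iff, hx, hyS, hyS', hbS]
  by_cases hR : ({x, y, y', b} : Finset V) = S
  · have hadj : G.Adj y y' := by
      by_contra hna
      have : nbr G S y ⊆ {x, b} := by
        intro v hv
        obtain ⟨hvS, hyv⟩ := mem_nbr.1 hv
        rw [← hR] at hvS
        simp only [mem_insert, mem_singleton] at hvS ⊢
        rcases hvS with rfl | rfl | rfl | rfl
        · simp
        · exact (hyv.ne rfl).elim
        · exact (hna hyv).elim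
        · simp
      have := (card_le_card this).trans card_le_two
      omega
    have h4 := h.four_lt
    rw [← hR, pot, hcard, hdarts, if_pos hadj] at h4
    norm_num at h4
  · have := h.pot_gt_ten hsub hR (by omega)
    rw [pot, hcard, hdarts] at this
    split_ifs at this <;> norm_num at this

theorem false (h : KYMin G S) : False := by
  set L := S.filter fun v => #(nbr G S v) = 3 with hL
  set B := S.filter fun v => ¬ #(nbr G S v) = 3 with hB
  have hLB : L ∪ B = S := filter_union_filter_not_eq _ _
  have hdis : Disjoint L B := disjoint_filter_filter_not _ _ _
  have h1 : (2 : ℤ) * #L ≤ darts G L B := by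
    rw [darts_eq_sum]
    calc (2 : ℤ) * #L = ∑ v ∈ L, 2 := by simp [mul_comm]
      _ ≤ _ := by
        refine sum_le_sum fun v hv => ?_
        obtain ⟨hvS, hv3⟩ := mem_filter.1 hv
        have e1 := h.small_nbr_le_one hvS hv3
        have e2 : nbr G S v = (nbr G S v).filter (fun w => #(nbr G S w) = 3) ∪ nbr G B v := by
          ext w
          simp only [mem_union, mem_filter, mem_nbr, hB]
          tauto
        have e3 := card_union_le ((nbr G S v).filter (fun w => #(nbr G S w) = 3)) (nbr G B v)
        rw [← e2, hv3] at e3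
        have : 2 ≤ #(nbr G B v) := by omega
        exact_mod_cast this
  have h2 : darts G L B ≤ darts G B S := by
    rw [darts_comm]
    exact darts_mono Subset.rfl (filter_subset _ _)
  have h3 : (4 : ℤ) * #B ≤ darts G B S := by
    rw [darts_eq_sum]
    calc (4 : ℤ) * #B = ∑ v ∈ B, 4 := by simp [mul_comm]
      _ ≤ _ := by
        refine sum_le_sum fun v hv => ?_
        obtain ⟨hvS, hv3⟩ := mem_filter.1 hv
        have := h.three_le_nbr hvS
        have : 4 ≤ #(nbr G S v) := by omega
        exact_mod_cast this
  have h4 : darts G L S = 3 * #L := by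
    rw [darts_eq_sum, sum_congr rfl (fun v hv => by rw [(mem_filter.1 hv).2])]
    simp [mul_comm]
  have h5 : darts G S S = darts G L S + darts G B S := by
    rw [← darts_union_left G S hdis, hLB]
  have h6 : (#S : ℤ) = #L + #B := by
    rw [← hLB, card_union_of_disjoint hdis]; push_cast; ring
  have h7 := h.four_lt
  unfold pot at h7
  linarith

end KYMin

/-- The Kostochka–Yancey bound for 4-critical graphs. -/
theorem exists_pot_le_four (n : ℕ) : ∀ (V : Type u) (G : SimpleGraph V) (S : Finset V), #S = n →
    ¬ ColOn G S → ∃ W ⊆ S, ¬ ColOn G W ∧ pot G W ≤ 4 := by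
  induction n using Nat.strong_induction_on with
  | _ n ih =>
    intro V G S hn hS
    by_cases hcrit : ∀ W ⊆ S, W ≠ S → ColOn G W
    · by_cases hp : pot G S ≤ 4
      · exact ⟨S, Subset.rfl, hS, hp⟩
      · exact (KYMin.false ⟨fun V' G' S' hlt hc => ih _ (hn ▸ hlt) V' G' S' rfl hc, hS, hcrit,
          by omega⟩).elim
    · push Not at hcrit
      obtain ⟨W, hW, hne, hc⟩ := hcrit
      obtain ⟨U, hU, h⟩ := ih _ (hn ▸ card_lt_card (hW.ssubset_of_ne hne)) V G W rfl hc
      exact ⟨U, hU.trans hW, h⟩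

end Criticality

section Duals

lemma z2_cases (a : ZMod 2) : a = 0 ∨ a = 1 := by decide +revert

lemma z2_add_self (a : ZMod 2) : a + a = 0 := CharTwo.add_self_eq_zero a

lemma z2_eq_of_add {a b : ZMod 2} (h : a + b = 0) : a = b := by grind

lemma sum_symm_eq_zero {W : Type*} (B : Finset W) (h : W → W → ZMod 2)
    (hs : ∀ x y, h x y = h y x) (h0 : ∀ x, h x x = 0) : ∑ x ∈ B, ∑ y ∈ B, h x y = 0 := by
  induction B using Finset.induction_on with
  | empty => simp
  | insert a B ha ih =>
    simp only [sum_insert ha, sum_add_distrib, ih, h0]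
    rw [sum_congr rfl fun x _ => hs x a]
    grind

/-- A dual structure on a locally finite graph given by neighbour lists: `f u v` is the face to
the left of the dart from `u` to `v`. -/
structure HostDual {W F : Type*} (nb : W → Finset W) (f : W → W → F) : Prop where
  symm : ∀ u v, v ∈ nb u → u ∈ nb v
  irrefl : ∀ u, u ∉ nb u
  even : ∀ (s : F → ZMod 2) u, ∑ v ∈ nb u, (s (f u v) + s (f v u)) = 0
  exact : ∀ z : W → W → ZMod 2, (∀ u v, z u v = z v u) → (∀ u v, v ∉ nb u → z u v = 0) →
    {u | ∃ v, z u v ≠ 0}.Finite → (∀ u, ∑ v ∈ nb u, z u v = 0) →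
    ∃ s : F → ZMod 2, ∀ u v, v ∈ nb u → z u v = s (f u v) + s (f v u)

/-- The coboundary of a set of faces, as an indicator function of darts. -/
noncomputable def cob {F : Type*} (G : SimpleGraph V) (f : V → V → F) (s : F → ZMod 2)
    (u v : V) : ZMod 2 :=
  if G.Adj u v then s (f u v) + s (f v u) else 0

/-- The indicator functions of even subgraphs. -/
structure IsEven [Fintype V] (G : SimpleGraph V) (z : V → V → ZMod 2) : Prop where
  symm : ∀ u v, z u v = z v u
  supp : ∀ u v, ¬ G.Adj u v → z u v = 0
  sum : ∀ u, ∑ v, z u v = 0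

/-- A system of faces whose boundaries generate the even subgraphs. -/
structure IsDual [Fintype V] {F : Type*} (G : SimpleGraph V) (f : V → V → F) : Prop where
  even : ∀ (s : F → ZMod 2) u, ∑ v, cob G f s u v = 0
  exact : ∀ z, IsEven G z → ∃ s : F → ZMod 2, z = cob G f s

/-- The graph has a dual structure with finitely many faces. -/
def HasDual [Fintype V] (G : SimpleGraph V) : Prop :=
  ∃ (k : ℕ) (f : V → V → Fin k), IsDual G f

lemma cob_symm {F : Type*} (G : SimpleGraph V) (f : V → V → F) (s : F → ZMod 2) (u v : V) :
    cob G f s u v = cob G f s v u := by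
  unfold cob; rw [G.adj_comm, add_comm]

lemma cob_comp {F F' : Type*} (G : SimpleGraph V) (f : V → V → F) (g : F → F')
    (s : F' → ZMod 2) : cob G (fun u v => g (f u v)) s = cob G f (s ∘ g) := rfl

lemma IsDual.map [Fintype V] {F F' : Type*} {G : SimpleGraph V} {f : V → V → F}
    (h : IsDual G f) (g : F → F') (g' : F' → F) (hg : ∀ u v, g' (g (f u v)) = f u v) :
    IsDual G (fun u v => g (f u v)) where
  even s u := h.even (s ∘ g) u
  exact z hz := by
    obtain ⟨s, hs⟩ := h.exact z hz
    refine ⟨s ∘ g', ?_⟩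
    rw [hs]
    funext u v
    simp only [cob, Function.comp, hg]

lemma IsDual.hasDual [Fintype V] {F : Type*} {G : SimpleGraph V} {f : V → V → F}
    (h : IsDual G f) : HasDual G := by
  set R := Set.range fun p : V × V => f p.1 p.2
  have : Finite R := Set.finite_range _
  obtain ⟨k, ⟨e⟩⟩ := Finite.exists_equiv_fin R
  by_cases hV : Nonempty V
  · obtain ⟨v₀⟩ := hV
    refine ⟨k, _, h.map (fun x => if hx : x ∈ R then e ⟨x, hx⟩ else e ⟨_, ⟨(v₀, v₀), rfl⟩⟩)
      (fun i => (e.symm i).1) fun u v => ?_⟩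
    have : f u v ∈ R := ⟨(u, v), rfl⟩
    simp [this]
  · rw [not_nonempty_iff] at hV
    exact ⟨0, fun u => hV.elim u, fun s u => hV.elim u, fun z hz => ⟨0, by
      funext u; exact hV.elim u⟩⟩

/-- Chains in a connected finite set. -/
lemma exists_chain {W : Type*} {nb : W → Finset W} (hirr : ∀ u, u ∉ nb u)
    (hsymm : ∀ u v, v ∈ nb u → u ∈ nb v) (B : Finset W) {a b : W}
    (hab : Relation.ReflTransGen (fun x y => x ∈ B ∧ y ∈ B ∧ y ∈ nb x) a b) :
    ∃ κ : W → W → ZMod 2, (∀ x y, κ x y = κ y x) ∧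
      (∀ x y, κ x y ≠ 0 → x ∈ B ∧ y ∈ B ∧ y ∈ nb x) ∧
      ∀ x, ∑ y ∈ nb x, κ x y = (if x = a then 1 else 0) + if x = b then 1 else 0 := by
  induction hab with
  | refl => exact ⟨0, fun _ _ => rfl, fun _ _ h => (h rfl).elim, fun x => by simp [z2_add_self]⟩
  | @tail c d _ hcd ih =>
    obtain ⟨κ, h1, h2, h3⟩ := ih
    obtain ⟨hc, hd, hn⟩ := hcd
    have hne : c ≠ d := fun he => hirr c (he ▸ hn)
    refine ⟨fun x y => κ x y + ((if x = c ∧ y = d then 1 else 0) + if x = d ∧ y = c then 1 else 0),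
      fun x y => ?_, fun x y hxy => ?_, fun x => ?_⟩
    · dsimp only
      rw [h1, add_comm (ite (x = c ∧ _) _ _)]
      simp only [and_comm]
    · by_cases hk : κ x y = 0
      · by_cases e1 : x = c ∧ y = d
        · rw [e1.1, e1.2]; exact ⟨hc, hd, hn⟩
        · by_cases e2 : x = d ∧ y = c
          · rw [e2.1, e2.2]; exact ⟨hd, hc, hsymm _ _ hn⟩
          · simp [hk, e1, e2] at hxy
      · exact h2 x y hk
    · rw [sum_add_distrib, h3, sum_add_distrib]
      simp only [ite_and, sum_ite_irrel, sum_const_zero, sum_ite_eq']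
      by_cases e1 : x = c
      · subst e1; simp [hne, hn]; grind
      · by_cases e2 : x = d
        · subst e2; simp [hne.symm, hsymm _ _ hn]
        · simp [e1, e2]

section Minor

variable [Fintype V] {W F : Type*} {nb : W → Finset W} {f : W → W → F}

/-- Connectedness of a finite set of host vertices. -/
def HostConn (nb : W → Finset W) (B : Finset W) : Prop :=
  ∀ a ∈ B, ∀ b ∈ B, Relation.ReflTransGen (fun x y => x ∈ B ∧ y ∈ B ∧ y ∈ nb x) a b

/-- A graph modelled by connected fibres in a host with dual structure has a dual structure. -/
theorem HostDual.minor (h : HostDual nb f) (G : SimpleGraph V) (B : V → Finset W)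
    (c : V → V → W) (hdisj : ∀ u v x, x ∈ B u → x ∈ B v → u = v) (hconn : ∀ u, HostConn nb (B u))
    (hc : ∀ u v, G.Adj u v → c u v ∈ B u) (hcn : ∀ u v, G.Adj u v → c v u ∈ nb (c u v)) :
    HasDual G := by
  let kept : W → W → Prop := fun x y => ∃ u v, G.Adj u v ∧ x = c u v ∧ y = c v u
  let inside : W → W → Prop := fun x y => ∃ u, x ∈ B u ∧ y ∈ B u
  let r : F → F → Prop := fun a b =>
    ∃ x y, y ∈ nb x ∧ ¬ kept x y ∧ ¬ inside x y ∧ a = f x y ∧ b = f y x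
  have hcu : ∀ {u v u' v'}, G.Adj u v → G.Adj u' v' → c u v = c u' v' → u = u' := by
    intro u v u' v' h1 h2 he
    exact hdisj u u' (c u v) (hc _ _ h1) (he ▸ hc _ _ h2)
  refine IsDual.hasDual (F := Quot r) (f := fun u v => Quot.mk r (f (c u v) (c v u)))
    ⟨fun s u => ?_, fun z hz => ?_⟩
  · let hz : W → W → ZMod 2 := fun x y =>
      if y ∈ nb x then s (Quot.mk r (f x y)) + s (Quot.mk r (f y x)) else 0
    have hzs : ∀ x y, hz x y = hz y x := by
      intro x y
      have : y ∈ nb x ↔ x ∈ nb y := ⟨h.symm x y, h.symm y x⟩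
      simp only [hz, this, add_comm]
    have hz0 : ∀ x y, ¬ kept x y → ¬ inside x y → hz x y = 0 := by
      intro x y h1 h2
      simp only [hz]
      split_ifs with h3
      · rw [Quot.sound (r := r) ⟨x, y, h3, h1, h2, rfl, rfl⟩, z2_add_self]
      · rfl
    have h1 : ∑ x ∈ B u, ∑ y ∈ nb x, hz x y = 0 := by
      refine sum_eq_zero fun x _ => ?_
      rw [← h.even (fun a => s (Quot.mk r a)) x]
      exact sum_congr rfl fun y hy => by simp [hz, hy]
    have h2 : ∀ x ∈ B u, ∑ y ∈ nb x, hz x y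
        = ∑ y ∈ B u, hz x y + ∑ v, if G.Adj u v ∧ x = c u v then hz x (c v u) else 0 := by
      intro x hx
      have e1 : ∑ y ∈ nb x, hz x y = ∑ y ∈ nb x ∪ B u, hz x y :=
        sum_subset subset_union_left fun y _ hy => by simp [hz, hy]
      have e2 : ∑ y ∈ (nb x ∪ B u) \ B u, hz x y
          = ∑ y ∈ (nb x ∪ B u) \ B u, ∑ v,
            if G.Adj u v ∧ x = c u v ∧ y = c v u then hz x y else 0 := by
        refine sum_congr rfl fun y hy => ?_
        by_cases hk : kept x y
        · obtain ⟨u', v, huv, hxe, hye⟩ := hk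
          obtain rfl : u = u' := hdisj _ _ x hx (hxe ▸ hc _ _ huv)
          rw [sum_eq_single v, if_pos ⟨huv, hxe, hye⟩]
          · intro w _ hw
            rw [if_neg]
            rintro ⟨e1, -, e3⟩
            exact hw (hcu e1.symm huv.symm (e3.symm.trans hye))
          · simp
        · rw [hz0 x y hk, sum_eq_zero]
          · intro v _; split_ifs <;> rfl
          · rintro ⟨w, hxw, hyw⟩
            obtain rfl := hdisj _ _ x hx hxw
            exact (mem_sdiff.1 hy).2 hyw
      rw [e1, ← sum_sdiff (subset_union_right : B u ⊆ nb x ∪ B u), add_comm, e2, sum_comm]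
      congr 1
      refine sum_congr rfl fun v _ => ?_
      by_cases hv : G.Adj u v ∧ x = c u v
      · have hmem : c v u ∈ (nb x ∪ B u) \ B u := by
          rw [mem_sdiff, mem_union]
          refine ⟨Or.inl (hv.2 ▸ hcn _ _ hv.1), fun hh => ?_⟩
          exact hv.1.ne (hdisj _ _ _ hh (hc _ _ hv.1.symm))
        simp only [hv, true_and, sum_ite_eq', if_true]
        rw [if_pos (by simpa [hv.2] using hmem)]
      · rw [if_neg hv]
        refine sum_eq_zero fun y _ => if_neg fun hh => hv ⟨hh.1, hh.2.1⟩
    rw [sum_congr rfl h2, sum_add_distrib, sum_symm_eq_zero _ _ hzs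
      (fun x => by simp [hz, h.irrefl]), zero_add, sum_comm] at h1
    rw [← h1]
    refine sum_congr rfl fun v _ => ?_
    unfold cob
    by_cases huv : G.Adj u v
    · simp only [huv, true_and, if_true]
      rw [sum_ite_eq', if_pos (hc _ _ huv)]
      simp [hz, hcn _ _ huv]
    · simp [huv]
  · have hr : ∀ u, ∃ a, ∀ x ∈ B u, a ∈ B u := by
      intro u
      by_cases hne : (B u).Nonempty
      · exact ⟨hne.choose, fun _ _ => hne.choose_spec⟩
      · exact ⟨c u u, fun x hx => (hne ⟨x, hx⟩).elim⟩
    choose root hroot using hr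
    have hκ : ∀ u v, ∃ κ : W → W → ZMod 2, (∀ x y, κ x y = κ y x) ∧
        (∀ x y, κ x y ≠ 0 → x ∈ B u ∧ y ∈ B u ∧ y ∈ nb x) ∧ (G.Adj u v →
        ∀ x, ∑ y ∈ nb x, κ x y = (if x = c u v then 1 else 0) + if x = root u then 1 else 0) := by
      intro u v
      by_cases huv : G.Adj u v
      · obtain ⟨κ, h1, h2, h3⟩ := exists_chain h.irrefl h.symm (B u)
          (hconn u _ (hc _ _ huv) _ (hroot u _ (hc _ _ huv)))
        exact ⟨κ, h1, h2, fun _ => h3⟩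
      · exact ⟨0, fun _ _ => rfl, fun _ _ hh => (hh rfl).elim, fun hh => (huv hh).elim⟩
    choose κ hκs hκ0 hκb using hκ
    let Z : W → W → ZMod 2 := fun x y => ∑ u, ∑ v,
      z u v * ((if x = c u v ∧ y = c v u then 1 else 0) + κ u v x y)
    have hZκ : ∀ x y, ¬ inside x y → ∀ u v, κ u v x y = 0 := by
      intro x y hxy u v
      by_contra hne
      obtain ⟨h1, h2, -⟩ := hκ0 u v x y hne
      exact hxy ⟨u, h1, h2⟩
    have hZs : ∀ x y, Z x y = Z y x := by
      intro x y
      simp only [Z, mul_add, sum_add_distrib, hκs _ _ x y]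
      congr 1
      rw [sum_comm]
      refine sum_congr rfl fun u _ => sum_congr rfl fun v _ => ?_
      rw [hz.symm]
      simp only [and_comm]
    have hZn : ∀ x y, y ∉ nb x → Z x y = 0 := by
      intro x y hxy
      refine sum_eq_zero fun u _ => sum_eq_zero fun v _ => ?_
      by_cases huv : G.Adj u v
      · rw [if_neg, zero_add]
        · by_cases hk : κ u v x y = 0
          · rw [hk, mul_zero]
          · exact (hxy (hκ0 _ _ _ _ hk).2.2).elim
        · rintro ⟨rfl, rfl⟩
          exact hxy (hcn _ _ huv)
      · rw [hz.supp _ _ huv, zero_mul]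
    have hZfin : {x | ∃ y, Z x y ≠ 0}.Finite := by
      refine (univ.biUnion B).finite_toSet.subset ?_
      rintro x ⟨y, hxy⟩
      obtain ⟨u, -, hu⟩ := exists_ne_zero_of_sum_ne_zero hxy
      obtain ⟨v, -, hv⟩ := exists_ne_zero_of_sum_ne_zero hu
      have huv : G.Adj u v := by
        by_contra hn
        rw [hz.supp _ _ hn, zero_mul] at hv
        exact hv rfl
      simp only [coe_biUnion, coe_univ, Set.mem_univ, Set.iUnion_true, Set.mem_iUnion, mem_coe]
      refine ⟨u, ?_⟩
      by_cases hk : κ u v x y = 0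
      · by_cases he : x = c u v
        · exact he ▸ hc _ _ huv
        · simp [hk, he] at hv
      · exact (hκ0 _ _ _ _ hk).1
    have hZe : ∀ x, ∑ y ∈ nb x, Z x y = 0 := by
      intro x
      have e1 : ∀ u v, ∑ y ∈ nb x, z u v * ((if x = c u v ∧ y = c v u then 1 else 0) + κ u v x y)
          = if x = root u then z u v else 0 := by
        intro u v
        by_cases huv : G.Adj u v
        · rw [← mul_sum, sum_add_distrib, hκb _ _ huv]
          have : ∑ y ∈ nb x, (if x = c u v ∧ y = c v u then (1 : ZMod 2) else 0)
              = if x = c u v then 1 else 0 := by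
            by_cases he : x = c u v
            · subst he; simp [hcn _ _ huv]
            · simp [he]
          rw [this]
          split_ifs <;> grind
        · rw [hz.supp _ _ huv]; simp
      calc ∑ y ∈ nb x, Z x y = ∑ u, ∑ v, ∑ y ∈ nb x,
            z u v * ((if x = c u v ∧ y = c v u then 1 else 0) + κ u v x y) := by
            simp only [Z]
            rw [sum_comm]
            exact sum_congr rfl fun u _ => sum_comm
        _ = 0 := by
            simp only [e1]
            refine sum_eq_zero fun u _ => ?_
            split_ifs
            · exact hz.sum u
            · simp
    obtain ⟨s, hs⟩ := h.exact Z hZs hZn hZfin hZe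
    refine ⟨Quot.lift s ?_, ?_⟩
    · rintro a b ⟨x, y, hxy, hk, hi, rfl, rfl⟩
      refine z2_eq_of_add ?_
      rw [← hs x y hxy]
      refine sum_eq_zero fun u _ => sum_eq_zero fun v _ => ?_
      rw [hZκ x y hi, add_zero]
      by_cases huv : G.Adj u v
      · rw [if_neg, mul_zero]
        rintro ⟨h1, h2⟩
        exact hk ⟨u, v, huv, h1, h2⟩
      · rw [hz.supp _ _ huv, zero_mul]
    · funext u v
      unfold cob
      by_cases huv : G.Adj u v
      · rw [if_pos huv]
        dsimp only
        rw [← hs _ _ (hcn _ _ huv)]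
        have hi : ¬ inside (c u v) (c v u) := by
          rintro ⟨w, h1, h2⟩
          exact huv.ne ((hdisj _ _ _ (hc _ _ huv) h1).trans (hdisj _ _ _ h2 (hc _ _ huv.symm)))
        simp only [Z, hZκ _ _ hi, add_zero]
        rw [sum_eq_single u, sum_eq_single v]
        · simp
        · intro v' _ hv'
          by_cases huv' : G.Adj u v'
          · rw [if_neg, mul_zero]
            rintro ⟨-, h2⟩
            exact hv' (hcu huv'.symm huv.symm h2.symm)
          · rw [hz.supp _ _ huv', zero_mul]
        · simp
        · intro u' _ hu'
          refine sum_eq_zero fun v' _ => ?_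
          by_cases huv' : G.Adj u' v'
          · rw [if_neg, mul_zero]
            rintro ⟨h1, -⟩
            exact hu' (hcu huv' huv h1.symm)
          · rw [hz.supp _ _ huv', zero_mul]
        · simp
      · rw [if_neg huv, hz.supp _ _ huv]

end Minor

end Duals

section Cycles

/-- The indicator function of the edge `ab`. -/
noncomputable def edg (a b u v : V) : ZMod 2 := if (u = a ∧ v = b) ∨ (u = b ∧ v = a) then 1 else 0

lemma edg_symm (a b u v : V) : edg a b u v = edg a b v u := by
  unfold edg; congr 1; simp only [eq_iff_iff]; tauto

lemma edg_swap (a b : V) : edg a b = edg b a := by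
  funext u v; unfold edg; congr 1; simp only [eq_iff_iff]; tauto

lemma sum_edg [Fintype V] {a b : V} (h : a ≠ b) (u : V) (s : V → ZMod 2) :
    ∑ v, s v * edg a b u v = (if u = a then s b else 0) + if u = b then s a else 0 := by
  by_cases h1 : u = a
  · subst h1
    simp [edg, h]
  · by_cases h2 : u = b
    · subst h2
      simp [edg, h.symm]
    · simp [edg, h1, h2]

lemma sum_edg' [Fintype V] {a b : V} (h : a ≠ b) (u : V) :
    ∑ v, edg a b u v = (if u = a then 1 else 0) + if u = b then 1 else 0 := by
  simpa using sum_edg h u (fun _ => 1)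

lemma IsEven.add [Fintype V] {G : SimpleGraph V} {z w : V → V → ZMod 2} (hz : IsEven G z)
    (hw : IsEven G w) : IsEven G (z + w) where
  symm u v := by simp only [Pi.add_apply, hz.symm u v, hw.symm u v]
  supp u v h := by simp only [Pi.add_apply, hz.supp u v h, hw.supp u v h, add_zero]
  sum u := by simp only [Pi.add_apply, sum_add_distrib, hz.sum, hw.sum, add_zero]

lemma IsDual.isEven [Fintype V] {F : Type*} {G : SimpleGraph V} {f : V → V → F} (h : IsDual G f)
    (s : F → ZMod 2) : IsEven G (cob G f s) where
  symm := cob_symm G f s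
  supp u v huv := if_neg huv
  sum := h.even s

lemma cob_add {F : Type*} (G : SimpleGraph V) (f : V → V → F) (s t : F → ZMod 2) :
    cob G f (s + t) = cob G f s + cob G f t := by
  funext u v
  simp only [cob, Pi.add_apply]
  split_ifs <;> ring

lemma cob_one_add {F : Type*} (G : SimpleGraph V) (f : V → V → F) (s : F → ZMod 2) :
    cob G f (1 + s) = cob G f s := by
  funext u v
  simp only [cob, Pi.add_apply, Pi.one_apply]
  split_ifs <;> grind

/-- The indicator function of a 3-cycle. -/
noncomputable def cyc3 (a b c : V) : V → V → ZMod 2 := edg a b + edg b c + edg c a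
/-- The indicator function of a 4-cycle. -/
noncomputable def cyc4 (a b c d : V) : V → V → ZMod 2 := edg a b + edg b c + edg c d + edg d a
/-- The indicator function of a 5-cycle. -/
noncomputable def cyc5 (a b c d e : V) : V → V → ZMod 2 :=
  edg a b + edg b c + edg c d + edg d e + edg e a

lemma edg_supp {G : SimpleGraph V} {a b : V} (h : G.Adj a b) {u v : V} (huv : ¬ G.Adj u v) :
    edg a b u v = 0 := by
  unfold edg
  rw [if_neg]
  rintro (⟨rfl, rfl⟩ | ⟨rfl, rfl⟩)
  · exact huv h
  · exact huv h.symm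

variable [Fintype V]

lemma isEven_cyc3 {G : SimpleGraph V} {a b c : V} (h1 : G.Adj a b) (h2 : G.Adj b c)
    (h3 : G.Adj c a) : IsEven G (cyc3 a b c) where
  symm u v := by simp only [cyc3, Pi.add_apply, edg_symm _ _ u v]
  supp u v h := by simp [cyc3, edg_supp h1 h, edg_supp h2 h, edg_supp h3 h]
  sum u := by
    simp only [cyc3, Pi.add_apply, sum_add_distrib, sum_edg' h1.ne, sum_edg' h2.ne,
      sum_edg' h3.ne]
    grind

lemma isEven_cyc4 {G : SimpleGraph V} {a b c d : V} (h1 : G.Adj a b) (h2 : G.Adj b c)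
    (h3 : G.Adj c d) (h4 : G.Adj d a) : IsEven G (cyc4 a b c d) where
  symm u v := by simp only [cyc4, Pi.add_apply, edg_symm _ _ u v]
  supp u v h := by
    simp [cyc4, edg_supp h1 h, edg_supp h2 h, edg_supp h3 h, edg_supp h4 h]
  sum u := by
    simp only [cyc4, Pi.add_apply, sum_add_distrib, sum_edg' h1.ne, sum_edg' h2.ne,
      sum_edg' h3.ne, sum_edg' h4.ne]
    grind

lemma isEven_cyc5 {G : SimpleGraph V} {a b c d e : V} (h1 : G.Adj a b) (h2 : G.Adj b c)
    (h3 : G.Adj c d) (h4 : G.Adj d e) (h5 : G.Adj e a) : IsEven G (cyc5 a b c d e) where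
  symm u v := by simp only [cyc5, Pi.add_apply, edg_symm _ _ u v]
  supp u v h := by
    simp [cyc5, edg_supp h1 h, edg_supp h2 h, edg_supp h3 h, edg_supp h4 h, edg_supp h5 h]
  sum u := by
    simp only [cyc5, Pi.add_apply, sum_add_distrib, sum_edg' h1.ne, sum_edg' h2.ne,
      sum_edg' h3.ne, sum_edg' h4.ne, sum_edg' h5.ne]
    grind

/-- The indicator function of a face. -/
noncomputable def ind {F : Type*} (g : F) (x : F) : ZMod 2 := if x = g then 1 else 0

lemma IsDual.toHost {F : Type*} {G : SimpleGraph V} {f : V → V → F} (h : IsDual G f) :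
    HostDual (fun u => univ.filter (G.Adj u)) f where
  symm u v huv := by simpa using (by simpa using huv : G.Adj u v).symm
  irrefl u := by simp
  even s u := by simpa [cob, sum_filter] using h.even s u
  exact z h1 h2 _ h3 := by
    obtain ⟨s, hs⟩ := h.exact z ⟨h1, fun u v huv => h2 u v (by simpa using huv), fun u => by
      rw [← h3 u]
      refine (sum_subset (subset_univ _) fun v _ hv => h2 u v hv).symm⟩
    refine ⟨s, fun u v huv => ?_⟩
    rw [hs, cob, if_pos (by simpa using huv)]

lemma HasDual.minor {G : SimpleGraph V} (h : HasDual G) (G' : SimpleGraph V) (B : V → Finset V)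
    (c : V → V → V) (hdisj : ∀ u v x, x ∈ B u → x ∈ B v → u = v)
    (hconn : ∀ u, ∀ a ∈ B u, ∀ b ∈ B u, a ≠ b → G.Adj a b)
    (hc : ∀ u v, G'.Adj u v → c u v ∈ B u) (hcn : ∀ u v, G'.Adj u v → G.Adj (c u v) (c v u)) :
    HasDual G' := by
  obtain ⟨k, f, hf⟩ := h
  refine hf.toHost.minor G' B c hdisj (fun u a ha b hb => ?_) hc (by simpa using hcn)
  by_cases hab : a = b
  · subst hab; exact .refl
  · exact .single ⟨ha, hb, by simpa using hconn u a ha b hb hab⟩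

lemma HasDual.mono {G G' : SimpleGraph V} (h : HasDual G) (hle : G' ≤ G) : HasDual G' :=
  h.minor G' (fun u => {u}) (fun u _ => u) (by simp) (by simp)
    (by simp) (fun _ _ huv => hle huv)

/-- Identify `c` with `a`; the vertex `c` becomes isolated. -/
def ident (G : SimpleGraph V) (a c : V) : SimpleGraph V where
  Adj u v := u ≠ v ∧ u ≠ c ∧ v ≠ c ∧ (G.Adj u v ∨ (u = a ∧ G.Adj c v) ∨ (v = a ∧ G.Adj c u))
  symm := ⟨by
    rintro u v ⟨h, h1, h2, h'⟩
    refine ⟨h.symm, h2, h1, ?_⟩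
    rw [G.adj_comm]
    tauto⟩
  loopless := ⟨fun u h => h.1 rfl⟩

lemma HasDual.contract {G : SimpleGraph V} (h : HasDual G) {a c : V} (hac : G.Adj a c) :
    HasDual (ident G a c) := by
  refine h.minor _ (fun u => if u = a then {a, c} else if u = c then ∅ else {u})
    (fun u v => if u = a ∧ ¬ G.Adj a v then c else u) ?_ ?_ ?_ ?_
  · intro u v x hu hv
    have := hac.ne
    grind
  · intro u x hx y hy hxy
    have := hac.symm
    grind
  · rintro u v ⟨h1, h2, h3, h4⟩
    grind
  · rintro u v ⟨h1, h2, h3, h4⟩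
    have e1 := G.adj_comm u v
    have e2 := G.adj_comm a u
    have e3 := G.adj_comm c u
    have := hac.ne
    grind

lemma ident_sup_edge (G : SimpleGraph V) {a c : V} (hac : a ≠ c) :
    ident (G ⊔ SimpleGraph.edge a c) a c = ident G a c := by
  ext u v
  simp only [ident, SimpleGraph.sup_adj, SimpleGraph.edge_adj]
  grind

omit [Fintype V] in
lemma cyc3_eq_one {a b c u v : V} (hab : a ≠ b) (hbc : b ≠ c) (hac : a ≠ c)
    (h : (u = a ∧ v = b) ∨ (u = b ∧ v = a) ∨ (u = b ∧ v = c) ∨ (u = c ∧ v = b) ∨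
      (u = a ∧ v = c) ∨ (u = c ∧ v = a)) : cyc3 a b c u v = 1 := by
  rcases h with ⟨rfl, rfl⟩ | ⟨rfl, rfl⟩ | ⟨rfl, rfl⟩ | ⟨rfl, rfl⟩ | ⟨rfl, rfl⟩ | ⟨rfl, rfl⟩ <;>
    simp [cyc3, edg, hab, hbc, hac, hab.symm, hbc.symm, hac.symm]

omit [Fintype V] in
lemma cyc3_eq_zero {a b c u v : V}
    (h : ¬ ((u = a ∧ v = b) ∨ (u = b ∧ v = a) ∨ (u = b ∧ v = c) ∨ (u = c ∧ v = b) ∨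
      (u = a ∧ v = c) ∨ (u = c ∧ v = a))) : cyc3 a b c u v = 0 := by
  simp only [not_or] at h
  simp only [cyc3, Pi.add_apply, edg, h, or_self, if_false, add_zero]

/-- Adding a diagonal to a quadrilateral face. -/
lemma IsDual.addEdge {F : Type*} {G : SimpleGraph V} {f : V → V → F} (h : IsDual G f) {g : F}
    {a b c d : V} (hg : cob G f (ind g) = cyc4 a b c d) (h1 : G.Adj a b) (h2 : G.Adj b c)
    (hac : a ≠ c) (hnac : ¬ G.Adj a c) (hbd : b ≠ d) :
    HasDual (G ⊔ SimpleGraph.edge a c) := by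
  let p : V → V → Prop := fun u v =>
    (u = a ∧ v = b) ∨ (u = b ∧ v = a) ∨ (u = b ∧ v = c) ∨ (u = c ∧ v = b)
  let f' : V → V → Option F := fun u v =>
    if u = a ∧ v = c then none else if u = c ∧ v = a then some g else
      if p u v ∧ f u v = g then none else some (f u v)
  have hca : ¬ G.Adj c a := fun h => hnac h.symm
  have hab := h1.ne
  have hbc := h2.ne
  have key : ∀ s : Option F → ZMod 2, cob (G ⊔ SimpleGraph.edge a c) f' s
      = cob G f (s ∘ some) + fun u v => (s none + s (some g)) * cyc3 a b c u v := by
    intro s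
    funext u v
    have hguv := congrFun (congrFun hg u) v
    simp only [cob, Pi.add_apply, Function.comp] at hguv ⊢
    by_cases e1 : u = a ∧ v = c
    · obtain ⟨rfl, rfl⟩ := e1
      rw [if_pos (by simp [SimpleGraph.edge_adj, hac]), if_neg hnac,
        cyc3_eq_one hab hbc hac (by simp)]
      simp [f', hac, hac.symm]
    by_cases e2 : u = c ∧ v = a
    · obtain ⟨rfl, rfl⟩ := e2
      rw [if_pos (by simp [SimpleGraph.edge_adj, hac.symm]), if_neg hca,
        cyc3_eq_one hab hbc hac (by simp)]
      simp [f', hac, hac.symm, add_comm]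
    have f1 : f' u v = if p u v ∧ f u v = g then none else some (f u v) := by
      simp only [f', if_neg e1, if_neg e2]
    have hp : p v u ↔ p u v := by simp only [p]; clear * -; tauto
    have f2 : f' v u = if p u v ∧ f v u = g then none else some (f v u) := by
      simp only [f', if_neg fun h : v = a ∧ u = c => e2 h.symm,
        if_neg fun h : v = c ∧ u = a => e1 h.symm, hp]
    by_cases huv : G.Adj u v
    · rw [if_pos (show (G ⊔ SimpleGraph.edge a c).Adj u v from Or.inl huv), if_pos huv, f1, f2]
      rw [if_pos huv] at hguv
      by_cases hpuv : p u v
      · rw [cyc3_eq_one hab hbc hac (by simp only [p] at hpuv; clear * - hpuv; tauto)]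
        have hc4 : cyc4 a b c d u v = 1 := by
          rcases hpuv with ⟨rfl, rfl⟩ | ⟨rfl, rfl⟩ | ⟨rfl, rfl⟩ | ⟨rfl, rfl⟩ <;>
            simp [cyc4, edg, hab, hbc, hac, hbd, hab.symm, hbc.symm, hac.symm, hbd.symm]
        rw [hc4] at hguv
        unfold ind at hguv
        simp only [hpuv, true_and]
        clear * - hguv
        by_cases g1 : f u v = g <;> by_cases g2 : f v u = g <;>
          simp only [g1, g2, if_true, if_false] at hguv ⊢ <;> grind
      · rw [cyc3_eq_zero (by simp only [p] at hpuv; clear * - hpuv e1 e2; tauto)]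
        simp [hpuv]
    · have hn : ¬ (G ⊔ SimpleGraph.edge a c).Adj u v := by
        simp only [SimpleGraph.sup_adj, SimpleGraph.edge_adj]
        clear * - huv e1 e2; tauto
      rw [if_neg hn, if_neg huv, cyc3_eq_zero, mul_zero, add_zero]
      rintro (⟨rfl, rfl⟩ | ⟨rfl, rfl⟩ | ⟨rfl, rfl⟩ | ⟨rfl, rfl⟩ | h | h)
      · exact huv h1
      · exact huv h1.symm
      · exact huv h2
      · exact huv h2.symm
      · exact e1 h
      · exact e2 h
  have ac : (G ⊔ SimpleGraph.edge a c).Adj a c := by simp [SimpleGraph.edge_adj, hac]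
  have htri : IsEven (G ⊔ SimpleGraph.edge a c) (cyc3 a b c) :=
    isEven_cyc3 (by simp [h1]) (by simp [h2]) ac.symm
  refine IsDual.hasDual (f := f') ⟨fun s u => ?_, fun z hz => ?_⟩
  · rw [key]
    simp only [Pi.add_apply, sum_add_distrib, h.even, ← mul_sum, htri.sum, mul_zero, add_zero]
  · have hδ : IsEven (G ⊔ SimpleGraph.edge a c) (fun u v => z a c * cyc3 a b c u v) := by
      rcases z2_cases (z a c) with h0 | h0 <;> rw [h0]
      · exact ⟨by simp, by simp, by simp⟩
      · simpa using htri
    have hz1 := hz.add hδ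
    obtain ⟨s, hs⟩ := h.exact _ ⟨hz1.symm, fun u v huv => by
      by_cases e1 : (u = a ∧ v = c) ∨ (u = c ∧ v = a)
      · have : z u v = z a c := by
          rcases e1 with ⟨rfl, rfl⟩ | ⟨rfl, rfl⟩
          · rfl
          · exact hz.symm _ _
        simp only [Pi.add_apply, cyc3_eq_one hab hbc hac (Or.inr (Or.inr (Or.inr (Or.inr e1)))),
          this, mul_one, z2_add_self]
      · refine hz1.supp u v ?_
        simp only [SimpleGraph.sup_adj, SimpleGraph.edge_adj]
        clear * - e1 huv; tauto,
      hz1.sum⟩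
    refine ⟨fun o => o.elim (s g + z a c) s, ?_⟩
    rw [key]
    have : ((fun o => o.elim (s g + z a c) s : Option F → ZMod 2) ∘ some) = s := rfl
    rw [this, ← hs]
    funext u v
    simp only [Pi.add_apply, Option.elim]
    clear * -
    grind

end Cycles

section Grid

/-- The neighbours in the square grid. -/
def gridNb (p : ℤ × ℤ) : Finset (ℤ × ℤ) :=
  {(p.1 + 1, p.2), (p.1 - 1, p.2), (p.1, p.2 + 1), (p.1, p.2 - 1)}

/-- The unit square to the left of a dart of the square grid. -/
def gridFace (u v : ℤ × ℤ) : ℤ × ℤ :=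
  if v.1 = u.1 + 1 then u else if v.1 = u.1 - 1 then (u.1 - 1, u.2 - 1) else
    if v.2 = u.2 + 1 then (u.1 - 1, u.2) else (u.1, u.2 - 1)

lemma sum_gridNb (p : ℤ × ℤ) (h : ℤ × ℤ → ZMod 2) : ∑ v ∈ gridNb p, h v =
    h (p.1 + 1, p.2) + h (p.1 - 1, p.2) + h (p.1, p.2 + 1) + h (p.1, p.2 - 1) := by
  unfold gridNb
  rw [sum_insert, sum_insert, sum_insert, sum_singleton]
  · ring
  all_goals simp
  all_goals omega

lemma gridNb_cases {u v : ℤ × ℤ} (h : v ∈ gridNb u) :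
    (v = (u.1 + 1, u.2)) ∨ (v = (u.1 - 1, u.2)) ∨ (v = (u.1, u.2 + 1)) ∨ v = (u.1, u.2 - 1) := by
  simpa [gridNb] using h

lemma gridNb_symm (u v : ℤ × ℤ) (h : v ∈ gridNb u) : u ∈ gridNb v := by
  rcases gridNb_cases h with rfl | rfl | rfl | rfl <;> simp [gridNb]

lemma gridFace_right (x y : ℤ) : gridFace (x, y) (x + 1, y) = (x, y) := by simp [gridFace]
lemma gridFace_left (x y : ℤ) : gridFace (x, y) (x - 1, y) = (x - 1, y - 1) := by
  simp only [gridFace]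
  rw [if_neg (by omega)]; simp
lemma gridFace_up (x y : ℤ) : gridFace (x, y) (x, y + 1) = (x - 1, y) := by
  simp only [gridFace]
  rw [if_neg (by omega), if_neg (by omega)]; simp
lemma gridFace_down (x y : ℤ) : gridFace (x, y) (x, y - 1) = (x, y - 1) := by
  simp only [gridFace]
  rw [if_neg (by omega), if_neg (by omega), if_neg (by omega)]

lemma hostDual_grid : HostDual gridNb gridFace where
  symm := gridNb_symm
  irrefl u h := by
    rcases gridNb_cases h with h | h | h | h <;> simp [Prod.ext_iff] at h <;> omega
  even s := by
    rintro ⟨x, y⟩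
    have h1 := gridFace_left (x + 1) y
    have h2 := gridFace_right (x - 1) y
    have h3 := gridFace_down x (y + 1)
    have h4 := gridFace_up x (y - 1)
    simp only [add_sub_cancel_right, sub_add_cancel] at h1 h2 h3 h4
    rw [sum_gridNb]
    simp only [gridFace_right, gridFace_left, gridFace_up, gridFace_down, h1, h2, h3, h4]
    grind
  exact z hs hsupp hfin hsum := by
    obtain ⟨N, hN⟩ : ∃ N : ℤ, ∀ x, N ≤ x → ∀ y v, z (x, y) v = 0 := by
      obtain ⟨M, hM⟩ := (hfin.image Prod.fst).bddAbove
      refine ⟨M + 1, fun x hx y v => ?_⟩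
      by_contra hne
      have := hM ⟨(x, y), ⟨v, hne⟩, rfl⟩
      simp only at this
      omega
    let s : ℤ × ℤ → ZMod 2 := fun p => ∑ x ∈ Ioc p.1 N, z (x, p.2) (x, p.2 + 1)
    have hs0 : ∀ x y, N ≤ x → s (x, y) = 0 := fun x y hx => by simp [s, Ioc_eq_empty_of_le hx]
    have hstep : ∀ x y, s (x - 1, y) = z (x, y) (x, y + 1) + s (x, y) := by
      intro x y
      by_cases hx : x ≤ N
      · have : Ioc (x - 1) N = insert x (Ioc x N) := by
          ext t; simp only [mem_insert, mem_Ioc]; omega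
        simp only [s, this]
        rw [sum_insert (by simp)]
      · rw [hs0 _ _ (by omega), hs0 _ _ (by omega), hN x (by omega)]; simp
    have hH : ∀ n : ℕ, ∀ y, z (N - n, y) (N - n + 1, y) = s (N - n, y) + s (N - n, y - 1) := by
      intro n
      induction n with
      | zero =>
        intro y
        rw [hN _ (by simp), hs0 _ _ (by simp), hs0 _ _ (by simp), add_zero]
      | succ n ih =>
        intro y
        have e1 := hsum (N - n, y)
        rw [sum_gridNb] at e1
        dsimp only at e1
        rw [ih] at e1
        have e2 : N - ((n + 1 : ℕ) : ℤ) = N - n - 1 := by push_cast; ring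
        have e3 := hstep (N - n) (y - 1)
        rw [sub_add_cancel] at e3
        rw [e2, sub_add_cancel, hstep, e3, hs (N - n - 1, y), hs (N - n, y - 1)]
        grind
    have hH' : ∀ x y, z (x, y) (x + 1, y) = s (x, y) + s (x, y - 1) := by
      intro x y
      by_cases hx : N ≤ x
      · rw [hN x hx, hs0 _ _ hx, hs0 _ _ hx, add_zero]
      · have := hH (N - x).toNat y
        have e : N - ((N - x).toNat : ℤ) = x := by omega
        rwa [e] at this
    have hV : ∀ x y, z (x, y) (x, y + 1) = s (x - 1, y) + s (x, y) := by
      intro x y; rw [hstep]; grind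
    refine ⟨s, ?_⟩
    rintro ⟨x, y⟩ v hv
    rcases gridNb_cases hv with rfl | rfl | rfl | rfl <;> dsimp only
    · have h1 := gridFace_left (x + 1) y
      rw [add_sub_cancel_right] at h1
      rw [h1, gridFace_right, hH']
    · have h1 := gridFace_right (x - 1) y
      have h2 := hH' (x - 1) y
      rw [sub_add_cancel] at h1 h2
      rw [h1, gridFace_left, hs, h2, add_comm]
    · have h1 := gridFace_down x (y + 1)
      rw [add_sub_cancel_right] at h1
      rw [h1, gridFace_up, hV]
    · have h1 := gridFace_up x (y - 1)
      have h2 := hV x (y - 1)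
      rw [sub_add_cancel] at h1 h2
      rw [h1, gridFace_down, hs, h2, add_comm]

end Grid

section GridRegions

lemma HostConn.rtg {W : Type*} {nb : W → Finset W} {P B : Finset W} (h : HostConn nb P)
    (hPB : P ⊆ B) {a b : W} (ha : a ∈ P) (hb : b ∈ P) :
    Relation.ReflTransGen (fun x y => x ∈ B ∧ y ∈ B ∧ y ∈ nb x) a b :=
  Relation.ReflTransGen.mono (p := fun x y => x ∈ B ∧ y ∈ B ∧ y ∈ nb x)
    (fun _ _ ⟨h1, h2, h3⟩ => ⟨hPB h1, hPB h2, h3⟩) _ _ (h a ha b hb)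

lemma HostConn.of_center {W : Type*} {nb : W → Finset W} {B : Finset W} (z : W)
    (h : ∀ b ∈ B, ∃ P ⊆ B, HostConn nb P ∧ z ∈ P ∧ b ∈ P) : HostConn nb B := by
  intro a ha b hb
  obtain ⟨P, hP, hc, hz, haP⟩ := h a ha
  obtain ⟨Q, hQ, hc', hz', hbQ⟩ := h b hb
  exact (hc.rtg hP haP hz).trans (hc'.rtg hQ hz' hbQ)

lemma HostConn.insert_nbr {W : Type*} {nb : W → Finset W} {P : Finset W}
    (hsymm : ∀ u v, v ∈ nb u → u ∈ nb v) (h : HostConn nb P) {a c : W} (ha : a ∈ P)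
    (hc : c ∈ nb a) : HostConn nb (insert c P) := by
  have h1 : ∀ x ∈ P, ∀ y ∈ P, Relation.ReflTransGen (fun x y => x ∈ insert c P ∧
      y ∈ insert c P ∧ y ∈ nb x) x y := fun x hx y hy => h.rtg (subset_insert _ _) hx hy
  intro x hx y hy
  rcases mem_insert.1 hx with rfl | hx' <;> rcases mem_insert.1 hy with rfl | hy'
  · exact .refl
  · exact .head ⟨by simp, by simp [ha], hsymm _ _ hc⟩ (h1 a ha y hy')
  · exact .tail (h1 x hx' a ha) ⟨by simp [ha], by simp, hc⟩
  · exact h1 x hx' y hy'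

/-- A walk leaving a connected set contains an initial part leading to the next set. -/
lemma exists_arm {W : Type*} {nb : W → Finset W} (hsymm : ∀ u v, v ∈ nb u → u ∈ nb v)
    {Q R : Finset W} {a b : W}
    (hab : Relation.ReflTransGen (fun x y => x ∈ Q ∧ y ∈ Q ∧ y ∈ nb x) a b) (hb : b ∈ R) :
    ∀ P : Finset W, a ∈ P → HostConn nb P → Disjoint P R →
      ∃ U ⊆ Q, Disjoint U R ∧ HostConn nb (P ∪ U) ∧ ∃ x ∈ P ∪ U, ∃ y ∈ R, y ∈ nb x := by
  induction hab using Relation.ReflTransGen.head_induction_on with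
  | refl => intro P ha _ hd; exact (disjoint_left.1 hd ha hb).elim
  | @head a c hac _ ih =>
    intro P ha hP hd
    obtain ⟨haQ, hcQ, hn⟩ := hac
    by_cases hc : c ∈ R
    · exact ⟨∅, by simp, by simp, by simpa using hP, a, by simp [ha], c, hc, hn⟩
    · obtain ⟨U, hU, hUR, hcon, x, hx, y, hy, hxy⟩ := ih (insert c P) (by simp)
        (hP.insert_nbr hsymm ha hn) (by rw [disjoint_insert_left]; exact ⟨hc, hd⟩)
      refine ⟨insert c U, insert_subset hcQ hU, by rw [disjoint_insert_left]; exact ⟨hc, hUR⟩,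
        ?_, x, ?_, y, hy, hxy⟩
      · rwa [union_insert, ← insert_union]
      · rwa [union_insert, ← insert_union]

/-- A graph modelled by connected sets for vertices and edges in a host has a dual structure. -/
theorem HostDual.of_model [Fintype V] {W F : Type*} {nb : W → Finset W} {f : W → W → F}
    (h : HostDual nb f) (G : SimpleGraph V) {n : ℕ} (e : V ≃ Fin n) (K : V → Finset W)
    (A : V → V → Finset W) (hne : ∀ u, (K u).Nonempty) (hK : ∀ u, HostConn nb (K u))
    (hKK : ∀ u v, u ≠ v → Disjoint (K u) (K v))
    (hA : ∀ u v, G.Adj u v → e u < e v → HostConn nb (A u v) ∧ (∃ p ∈ K u, p ∈ A u v) ∧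
      ∃ p ∈ K v, p ∈ A u v)
    (hKA : ∀ u v w, G.Adj u v → e u < e v → w ≠ u → w ≠ v → Disjoint (K w) (A u v))
    (hAA : ∀ u v u' v', G.Adj u v → e u < e v → G.Adj u' v' → e u' < e v' → u ≠ u' →
      Disjoint (A u v) (A u' v')) : HasDual G := by
  have key : ∀ u v, ∃ (U : Finset W) (x y : W), G.Adj u v → e u < e v → U ⊆ A u v ∧
      Disjoint U (K v) ∧ HostConn nb (K u ∪ U) ∧ x ∈ K u ∪ U ∧ y ∈ K v ∧ y ∈ nb x := by
    intro u v
    by_cases hu : G.Adj u v ∧ e u < e v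
    · obtain ⟨h1, ⟨a, ha⟩, b, hb⟩ := hA u v hu.1 hu.2
      obtain ⟨U, hU, hd, hc, x, hx, y, hy, hxy⟩ := exists_arm h.symm (h1 a ha.2 b hb.2) hb.1 (K u)
        ha.1 (hK u) (hKK u v hu.1.ne)
      exact ⟨U, x, y, fun _ _ => ⟨hU, hd, hc, hx, hy, hxy⟩⟩
    · obtain ⟨x, _⟩ := hne u
      exact ⟨∅, x, x, fun h1 h2 => (hu ⟨h1, h2⟩).elim⟩
  choose U x y key using key
  have hmem : ∀ u p, p ∈ K u ∪ (univ.filter fun v => G.Adj u v ∧ e u < e v).biUnion (U u) ↔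
      p ∈ K u ∨ ∃ v, G.Adj u v ∧ e u < e v ∧ p ∈ U u v := by
    intro u p; simp [and_assoc]
  have hx : ∀ u v, G.Adj u v → ¬ e u < e v → G.Adj v u ∧ e v < e u := fun u v hu hlt =>
    ⟨hu.symm, lt_of_le_of_ne (not_lt.1 hlt) fun he => hu.ne (e.injective he.symm)⟩
  refine h.minor G (fun u => K u ∪ (univ.filter fun v => G.Adj u v ∧ e u < e v).biUnion (U u))
    (fun u v => if e u < e v then x u v else y v u) ?_ ?_ ?_ ?_
  · intro u u' p hp hp'
    by_contra hne'
    rw [hmem] at hp hp'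
    have hKU : ∀ u u' v, u ≠ u' → p ∈ K u → G.Adj u' v → e u' < e v → p ∉ U u' v := by
      intro u u' v hn hpu h1 h2 h3
      obtain ⟨k1, k2, -⟩ := key u' v h1 h2
      by_cases hv : u = v
      · subst hv; exact disjoint_left.1 k2 h3 hpu
      · exact disjoint_left.1 (hKA u' v u h1 h2 hn hv) hpu (k1 h3)
    rcases hp with hp | ⟨v, h1, h2, h3⟩ <;> rcases hp' with hp' | ⟨v', h1', h2', h3'⟩
    · exact disjoint_left.1 (hKK u u' hne') hp hp'
    · exact hKU u u' v' hne' hp h1' h2' h3'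
    · exact hKU u' u v (Ne.symm hne') hp' h1 h2 h3
    · exact disjoint_left.1 (hAA u v u' v' h1 h2 h1' h2' hne') ((key u v h1 h2).1 h3)
        ((key u' v' h1' h2').1 h3')
  · intro u
    obtain ⟨z, hz⟩ := hne u
    refine HostConn.of_center z fun b hb => ?_
    rcases (hmem _ _).1 hb with hb | ⟨v, h1, h2, h3⟩
    · exact ⟨K u, subset_union_left, hK u, hz, hb⟩
    · refine ⟨K u ∪ U u v, fun p hp => (hmem _ _).2 ?_, (key u v h1 h2).2.2.1, by simp [hz],
        by simp [h3]⟩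
      rcases mem_union.1 hp with hp | hp
      · exact .inl hp
      · exact .inr ⟨v, h1, h2, hp⟩
  · intro u v huv
    rw [hmem]
    split_ifs with hlt
    · rcases mem_union.1 (key u v huv hlt).2.2.2.1 with hp | hp
      · exact .inl hp
      · exact .inr ⟨v, huv, hlt, hp⟩
    · obtain ⟨h1, h2⟩ := hx u v huv hlt
      exact .inl (key v u h1 h2).2.2.2.2.1
  · intro u v huv
    by_cases hlt : e u < e v
    · rw [if_pos hlt, if_neg hlt.not_gt]
      exact (key u v huv hlt).2.2.2.2.2
    · obtain ⟨h1, h2⟩ := hx u v huv hlt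
      rw [if_neg hlt, if_pos h2]
      exact h.symm _ _ (key v u h1 h2).2.2.2.2.2

/-- The corners of the cell of a square mesh that contains a point of the plane. -/
noncomputable def corners (ε : ℝ) (p : ℝ × ℝ) : Finset (ℤ × ℤ) :=
  ({⌊p.1 / ε⌋, ⌊p.1 / ε⌋ + 1} : Finset ℤ) ×ˢ ({⌊p.2 / ε⌋, ⌊p.2 / ε⌋ + 1} : Finset ℤ)

lemma mem_corners {ε : ℝ} {p : ℝ × ℝ} {k : ℤ × ℤ} : k ∈ corners ε p ↔
    (k.1 = ⌊p.1 / ε⌋ ∨ k.1 = ⌊p.1 / ε⌋ + 1) ∧ (k.2 = ⌊p.2 / ε⌋ ∨ k.2 = ⌊p.2 / ε⌋ + 1) := by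
  simp [corners]

lemma abs_sub_le_of_floor {ε x : ℝ} (hε : 0 < ε) {k : ℤ} (h : k = ⌊x / ε⌋ ∨ k = ⌊x / ε⌋ + 1) :
    |x - ε * k| ≤ ε := by
  have h1 := Int.floor_le (x / ε)
  have h2 := Int.lt_floor_add_one (x / ε)
  rw [le_div_iff₀ hε] at h1
  rw [div_lt_iff₀ hε] at h2
  rw [abs_le]
  rcases h with rfl | rfl
  · constructor <;> nlinarith
  · push_cast; constructor <;> nlinarith

lemma dist_le_of_mem_corners {ε : ℝ} (hε : 0 < ε) {p q : ℝ × ℝ} {k : ℤ × ℤ}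
    (hp : k ∈ corners ε p) (hq : k ∈ corners ε q) : dist p q ≤ 2 * ε := by
  rw [mem_corners] at hp hq
  have a1 := abs_le.1 (abs_sub_le_of_floor hε hp.1)
  have a2 := abs_le.1 (abs_sub_le_of_floor hε hp.2)
  have b1 := abs_le.1 (abs_sub_le_of_floor hε hq.1)
  have b2 := abs_le.1 (abs_sub_le_of_floor hε hq.2)
  rw [Prod.dist_eq, Real.dist_eq, Real.dist_eq, max_le_iff, abs_le, abs_le]
  exact ⟨⟨by linarith, by linarith⟩, by linarith, by linarith⟩

lemma exists_common_floor {ε x y : ℝ} (hε : 0 < ε) (h : |x - y| < ε) :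
    ∃ k : ℤ, (k = ⌊x / ε⌋ ∨ k = ⌊x / ε⌋ + 1) ∧ (k = ⌊y / ε⌋ ∨ k = ⌊y / ε⌋ + 1) := by
  have h1 : |x / ε - y / ε| < 1 := by
    rwa [← sub_div, abs_div, abs_of_pos hε, div_lt_one hε]
  rw [abs_lt] at h1
  have u1 := Int.floor_le (x / ε)
  have u2 := Int.lt_floor_add_one (x / ε)
  have v1 := Int.floor_le (y / ε)
  have v2 := Int.lt_floor_add_one (y / ε)
  have c1 : ⌊x / ε⌋ < ⌊y / ε⌋ + 2 := by
    have : (⌊x / ε⌋ : ℝ) < ⌊y / ε⌋ + 2 := by linarith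
    exact_mod_cast this
  have c2 : ⌊y / ε⌋ < ⌊x / ε⌋ + 2 := by
    have : (⌊y / ε⌋ : ℝ) < ⌊x / ε⌋ + 2 := by linarith
    exact_mod_cast this
  rcases le_total ⌊x / ε⌋ ⌊y / ε⌋ with h | h
  · exact ⟨⌊y / ε⌋, by omega, by omega⟩
  · exact ⟨⌊x / ε⌋, by omega, by omega⟩

lemma hostConn_corners (ε : ℝ) (p : ℝ × ℝ) : HostConn gridNb (corners ε p) := by
  rintro ⟨a, b⟩ h ⟨a', b'⟩ h'
  have hm : (a', b) ∈ corners ε p := by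
    rw [mem_corners] at *; exact ⟨h'.1, h.2⟩
  refine Relation.ReflTransGen.trans (b := (a', b)) ?_ ?_
  · by_cases he : a = a'
    · rw [he]
    · refine .single ⟨h, hm, ?_⟩
      rw [mem_corners] at h h'
      simp only [gridNb, mem_insert, mem_singleton, Prod.mk.injEq]
      have h1 := h.1
      have h2 := h'.1
      dsimp only at h1 h2
      clear * - h1 h2 he
      simp only [and_true, true_and]
      omega
  · by_cases he : b = b'
    · rw [he]
    · refine .single ⟨hm, h', ?_⟩
      rw [mem_corners] at h h'
      simp only [gridNb, mem_insert, mem_singleton, Prod.mk.injEq]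
      have h1 := h.2
      have h2 := h'.2
      dsimp only at h1 h2
      clear * - h1 h2 he
      simp only [and_true, true_and]
      omega

lemma finite_corners {K : Set (ℝ × ℝ)} {ε : ℝ} (hε : 0 < ε) (hK : IsCompact K) :
    {k | ∃ p ∈ K, k ∈ corners ε p}.Finite := by
  obtain ⟨M, hM⟩ := hK.isBounded.subset_closedBall 0
  obtain ⟨N, hN⟩ := exists_nat_gt (M / ε + 1)
  have hN' : M < (N - 1) * ε := by
    rw [← div_lt_iff₀ hε]; linarith
  have hb : ∀ (x : ℝ) (k : ℤ), |x| ≤ M → (k = ⌊x / ε⌋ ∨ k = ⌊x / ε⌋ + 1) →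
      k ∈ Set.Icc (-(N : ℤ)) N := by
    intro x k hx hk
    have h1 := abs_le.1 (abs_sub_le_of_floor hε hk)
    rw [abs_le] at hx
    have k1 : (k : ℝ) < N := by
      by_contra hcon
      rw [not_lt] at hcon
      nlinarith
    have k2 : -(N : ℝ) < k := by
      by_contra hcon
      rw [not_lt] at hcon
      nlinarith
    have k1' : k < N := by exact_mod_cast k1
    have k2' : -(N : ℤ) < k := by exact_mod_cast k2
    exact ⟨k2'.le, k1'.le⟩
  refine ((Set.finite_Icc (-(N : ℤ)) N).prod (Set.finite_Icc (-(N : ℤ)) N)).subset ?_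
  rintro k ⟨p, hp, hk⟩
  have := hM hp
  rw [mem_closedBall_zero_iff, Prod.norm_def, max_le_iff, Real.norm_eq_abs, Real.norm_eq_abs] at this
  rw [mem_corners] at hk
  exact ⟨hb _ _ this.1 hk.1, hb _ _ this.2 hk.2⟩

/-- The mesh points near a set in the plane. -/
noncomputable def mesh (ε : ℝ) (K : Set (ℝ × ℝ)) : Finset (ℤ × ℤ) :=
  if h : {k | ∃ p ∈ K, k ∈ corners ε p}.Finite then h.toFinset else ∅

lemma mem_mesh {K : Set (ℝ × ℝ)} {ε : ℝ} (hε : 0 < ε) (hK : IsCompact K) {k : ℤ × ℤ} :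
    k ∈ mesh ε K ↔ ∃ p ∈ K, k ∈ corners ε p := by
  rw [mesh, dif_pos (finite_corners hε hK)]; simp

lemma hostConn_mesh {K : Set (ℝ × ℝ)} {ε : ℝ} (hε : 0 < ε) (hK : IsCompact K)
    (hc : IsPreconnected K) : HostConn gridNb (mesh ε K) := by
  have hsub : ∀ p ∈ K, corners ε p ⊆ mesh ε K := fun p hp k hk => (mem_mesh hε hK).2 ⟨p, hp, hk⟩
  have key : ∀ p ∈ K, ∀ q ∈ K, ∀ a ∈ corners ε p, ∀ b ∈ corners ε q, Relation.ReflTransGen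
      (fun x y => x ∈ mesh ε K ∧ y ∈ mesh ε K ∧ y ∈ gridNb x) a b := by
    intro p hp q hq
    refine hc.induction₂' (fun p q => ∀ a ∈ corners ε p, ∀ b ∈ corners ε q,
      Relation.ReflTransGen (fun x y => x ∈ mesh ε K ∧ y ∈ mesh ε K ∧ y ∈ gridNb x) a b)
      ?_ ?_ hp hq
    · intro p hp
      have hloc : ∀ p ∈ K, ∀ q ∈ K, dist p q < ε → ∀ a ∈ corners ε p, ∀ b ∈ corners ε q,
          Relation.ReflTransGen (fun x y => x ∈ mesh ε K ∧ y ∈ mesh ε K ∧ y ∈ gridNb x) a b := by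
        intro p hp q hq hd a ha b hb
        rw [Prod.dist_eq, Real.dist_eq, Real.dist_eq, max_lt_iff] at hd
        obtain ⟨i, hi, hi'⟩ := exists_common_floor hε hd.1
        obtain ⟨j, hj, hj'⟩ := exists_common_floor hε hd.2
        exact ((hostConn_corners ε p).rtg (hsub p hp) ha (mem_corners.2 ⟨hi, hj⟩ : (i, j) ∈ _)).trans
          ((hostConn_corners ε q).rtg (hsub q hq) (mem_corners.2 ⟨hi', hj'⟩) hb)
      filter_upwards [self_mem_nhdsWithin, mem_nhdsWithin_of_mem_nhds (Metric.ball_mem_nhds p hε)]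
        with q hq hq'
      rw [Metric.mem_ball] at hq'
      exact ⟨hloc p hp q hq (by rwa [dist_comm]), hloc q hq p hp hq'⟩
    · intro x y z hx hy hz h1 h2 a ha b hb
      have hm : (⌊y.1 / ε⌋, ⌊y.2 / ε⌋) ∈ corners ε y := mem_corners.2 ⟨.inl rfl, .inl rfl⟩
      exact (h1 a ha _ hm).trans (h2 _ hm b hb)
  intro a ha b hb
  obtain ⟨p, hp, hpa⟩ := (mem_mesh hε hK).1 ha
  obtain ⟨q, hq, hqb⟩ := (mem_mesh hε hK).1 hb
  exact key p hp q hq a hpa b hqb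

open Filter Topology in
lemma eventually_disjoint_mesh {K L : Set (ℝ × ℝ)} (hK : IsCompact K) (hL : IsCompact L)
    (h : Disjoint K L) : ∀ᶠ ε in 𝓝[>] (0 : ℝ), Disjoint (mesh ε K) (mesh ε L) := by
  obtain ⟨r, hr, hd⟩ := Metric.exists_pos_forall_lt_edist hK hL.isClosed h
  have hr' : (0 : ℝ) < r / 2 := by positivity
  filter_upwards [self_mem_nhdsWithin, mem_nhdsWithin_of_mem_nhds (Iio_mem_nhds hr')] with ε h0 h1
  rw [disjoint_left]
  intro k hk hk'
  obtain ⟨p, hp, hpk⟩ := (mem_mesh h0 hK).1 hk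
  obtain ⟨q, hq, hqk⟩ := (mem_mesh h0 hL).1 hk'
  have h2 := dist_le_of_mem_corners h0 hpk hqk
  have h3 := hd p hp q hq
  rw [edist_nndist, ENNReal.coe_lt_coe, ← NNReal.coe_lt_coe, coe_nndist] at h3
  rw [Set.mem_Iio] at h1
  linarith

end GridRegions

section Drawings

section Topology
open Filter Topology

lemma eventually_disjoint_closedBall {X : Type*} [MetricSpace X] {p : X} {C : Set X}
    (hC : IsClosed C) (hp : p ∉ C) : ∀ᶠ r in 𝓝[>] (0 : ℝ), Disjoint (Metric.closedBall p r) C := by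
  obtain ⟨δ, hδ, h⟩ := Metric.nhds_basis_closedBall.mem_iff.1 (hC.isOpen_compl.mem_nhds hp)
  filter_upwards [mem_nhdsWithin_of_mem_nhds (Iio_mem_nhds hδ)] with r hr
  rw [Set.disjoint_left]
  exact fun x hx => h (Metric.closedBall_subset_closedBall (le_of_lt hr) hx)

lemma isClosed_arc [Fintype V] {G : SimpleGraph V} (E : GraphEmbeddingIn (ℝ × ℝ) G) {u v : V}
    (h : G.Adj u v) : IsClosed (E.edgeArc u v h '' Set.Icc 0 1) :=
  (isCompact_Icc.image_of_continuousOn (E.arc_cont u v h)).isClosed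

lemma notMem_arc {G : SimpleGraph V} (E : GraphEmbeddingIn (ℝ × ℝ) G) {u v w : V}
    (h : G.Adj u v) (hu : w ≠ u) (hv : w ≠ v) : E.vertexPos w ∉ E.edgeArc u v h '' Set.Icc 0 1 := by
  rintro ⟨t, ht, he⟩
  rcases eq_or_lt_of_le ht.1 with h0 | h0
  · rw [← h0, E.arc_start] at he
    exact hu (E.vertexInj he).symm
  · rcases eq_or_lt_of_le ht.2 with h1 | h1
    · rw [h1, E.arc_end] at he
      exact hv (E.vertexInj he).symm
    · exact E.arc_avoid u v h w ⟨t, ⟨h0, h1⟩, he⟩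

lemma exists_subarc {G : SimpleGraph V} (E : GraphEmbeddingIn (ℝ × ℝ) G) {u v : V}
    (h : G.Adj u v) {r : ℝ} (hr : 0 < r) : ∃ A ⊆ E.edgeArc u v h '' Set.Ioo 0 1, IsCompact A ∧
      IsPreconnected A ∧ (Metric.closedBall (E.vertexPos u) r ∩ A).Nonempty ∧
      (Metric.closedBall (E.vertexPos v) r ∩ A).Nonempty := by
  have h01 : Set.Ioo (0 : ℝ) 1 ⊆ Set.Icc 0 1 := Set.Ioo_subset_Icc_self
  obtain ⟨t, ht, ht'⟩ : ∃ t ∈ Set.Ioo (0 : ℝ) 1,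
      E.edgeArc u v h t ∈ Metric.closedBall (E.vertexPos u) r := by
    have h1 := ((E.arc_cont u v h) 0 (by simp)).mono h01
    have : (𝓝[Set.Ioo 0 1] (0 : ℝ)).NeBot := left_nhdsWithin_Ioo_neBot one_pos
    have h2 := h1.eventually (Metric.closedBall_mem_nhds (E.edgeArc u v h 0) hr)
    obtain ⟨t, ht1, ht2⟩ := (h2.and self_mem_nhdsWithin).exists
    rw [E.arc_start] at ht1
    exact ⟨t, ht2, ht1⟩
  obtain ⟨t', hs, hs'⟩ : ∃ t ∈ Set.Ioo (0 : ℝ) 1,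
      E.edgeArc u v h t ∈ Metric.closedBall (E.vertexPos v) r := by
    have h1 := ((E.arc_cont u v h) 1 (by simp)).mono h01
    have : (𝓝[Set.Ioo 0 1] (1 : ℝ)).NeBot := right_nhdsWithin_Ioo_neBot one_pos
    have h2 := h1.eventually (Metric.closedBall_mem_nhds (E.edgeArc u v h 1) hr)
    obtain ⟨t, ht1, ht2⟩ := (h2.and self_mem_nhdsWithin).exists
    rw [E.arc_end] at ht1
    exact ⟨t, ht2, ht1⟩
  have hsub : Set.uIcc t t' ⊆ Set.Ioo 0 1 := Set.ordConnected_Ioo.uIcc_subset ht hs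
  have hcont := (E.arc_cont u v h).mono (hsub.trans h01)
  exact ⟨E.edgeArc u v h '' Set.uIcc t t', Set.image_mono hsub,
    isCompact_uIcc.image_of_continuousOn hcont, isPreconnected_uIcc.image _ hcont,
    ⟨_, ht', _, Set.left_mem_uIcc, rfl⟩, ⟨_, hs', _, Set.right_mem_uIcc, rfl⟩⟩

/-- Planar graphs have dual structures. -/
theorem hasDual_of_isPlanar [Fintype V] {G : SimpleGraph V} (h : G.IsPlanar) : HasDual G := by
  obtain ⟨E⟩ := h
  have hr : ∀ᶠ r in 𝓝[>] (0 : ℝ), (∀ u v : V, u ≠ v →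
      Disjoint (Metric.closedBall (E.vertexPos u) r) (Metric.closedBall (E.vertexPos v) r)) ∧
      ∀ (u v : V) (hu : G.Adj u v) (w : V), w ≠ u → w ≠ v →
      Disjoint (Metric.closedBall (E.vertexPos w) r) (E.edgeArc u v hu '' Set.Icc 0 1) := by
    refine Filter.Eventually.and ?_ ?_
    · simp only [eventually_all]
      intro u v huv
      have : 0 < dist (E.vertexPos u) (E.vertexPos v) / 2 :=
        half_pos (dist_pos.2 fun he => huv (E.vertexInj he))
      filter_upwards [mem_nhdsWithin_of_mem_nhds (Iio_mem_nhds this)] with r hr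
      rw [Set.mem_Iio] at hr
      exact Metric.closedBall_disjoint_closedBall (by linarith)
    · simp only [eventually_all]
      intro u v hu w h1 h2
      exact eventually_disjoint_closedBall (isClosed_arc E hu) (notMem_arc E hu h1 h2)
  obtain ⟨r, ⟨hr1, hr2⟩, hr0⟩ := (hr.and self_mem_nhdsWithin).exists
  have hA : ∀ u v, ∃ A : Set (ℝ × ℝ), IsCompact A ∧ ∀ hu : G.Adj u v,
      A ⊆ E.edgeArc u v hu '' Set.Ioo 0 1 ∧
      IsPreconnected A ∧ (Metric.closedBall (E.vertexPos u) r ∩ A).Nonempty ∧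
      (Metric.closedBall (E.vertexPos v) r ∩ A).Nonempty := by
    intro u v
    by_cases hu : G.Adj u v
    · obtain ⟨A, h1, h2, h3⟩ := exists_subarc E hu hr0
      exact ⟨A, h2, fun _ => ⟨h1, h3⟩⟩
    · exact ⟨∅, isCompact_empty, fun h => (hu h).elim⟩
  choose A hAc hA using hA
  set K : V → Set (ℝ × ℝ) := fun w => Metric.closedBall (E.vertexPos w) r with hK
  have hKc : ∀ w, IsCompact (K w) := fun w => isCompact_closedBall _ _
  let e := Fintype.equivFin V
  have hKA : ∀ u v w, G.Adj u v → w ≠ u → w ≠ v → Disjoint (K w) (A u v) :=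
    fun u v w hu h1 h2 => (hr2 u v hu w h1 h2).mono_right
      ((hA u v hu).1.trans (Set.image_mono Set.Ioo_subset_Icc_self))
  have hAA : ∀ u v u' v', G.Adj u v → e u < e v → G.Adj u' v' → e u' < e v' → u ≠ u' →
      Disjoint (A u v) (A u' v') := by
    intro u v u' v' hu hlt hu' hlt' hne
    rw [Set.disjoint_iff_inter_eq_empty, ← Set.subset_empty_iff,
      ← E.arc_disjoint u v hu u' v' hu' fun he => ?_]
    · exact Set.inter_subset_inter (hA u v hu).1
        ((hA u' v' hu').1.trans (Set.image_mono Set.Ioo_subset_Icc_self))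
    · rcases Sym2.eq_iff.1 he with ⟨h1, -⟩ | ⟨rfl, rfl⟩
      · exact hne h1
      · exact lt_asymm hlt hlt'
  have hε : ∀ᶠ ε in 𝓝[>] (0 : ℝ), (∀ u v, u ≠ v → Disjoint (mesh ε (K u)) (mesh ε (K v))) ∧
      (∀ u v w, G.Adj u v → w ≠ u → w ≠ v → Disjoint (mesh ε (K w)) (mesh ε (A u v))) ∧
      ∀ u v u' v', G.Adj u v → e u < e v → G.Adj u' v' → e u' < e v' → u ≠ u' →
        Disjoint (mesh ε (A u v)) (mesh ε (A u' v')) := by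
    refine Filter.Eventually.and ?_ (Filter.Eventually.and ?_ ?_)
    · simp only [eventually_all]
      exact fun u v huv => eventually_disjoint_mesh (hKc u) (hKc v) (hr1 u v huv)
    · simp only [eventually_all]
      exact fun u v w hu h1 h2 => eventually_disjoint_mesh (hKc w) (hAc u v) (hKA u v w hu h1 h2)
    · simp only [eventually_all]
      exact fun u v u' v' h1 h2 h3 h4 h5 => eventually_disjoint_mesh (hAc u v) (hAc u' v')
        (hAA u v u' v' h1 h2 h3 h4 h5)
  obtain ⟨ε, ⟨h1, h2, h3⟩, h0⟩ := (hε.and self_mem_nhdsWithin).exists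
  have hmeet : ∀ P Q : Set (ℝ × ℝ), IsCompact P → IsCompact Q → (P ∩ Q).Nonempty →
      ∃ k ∈ mesh ε P, k ∈ mesh ε Q := by
    rintro P Q hP hQ ⟨p, hp, hq⟩
    have hm : (⌊p.1 / ε⌋, ⌊p.2 / ε⌋) ∈ corners ε p := mem_corners.2 ⟨.inl rfl, .inl rfl⟩
    exact ⟨_, (mem_mesh h0 hP).2 ⟨p, hp, hm⟩, (mem_mesh h0 hQ).2 ⟨p, hq, hm⟩⟩
  refine hostDual_grid.of_model G e (fun u => mesh ε (K u)) (fun u v => mesh ε (A u v)) ?_ ?_ h1 ?_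
    (fun u v w hu _ => h2 u v w hu) h3
  · intro u
    obtain ⟨k, hk⟩ := hmeet (K u) (K u) (hKc u) (hKc u)
      ⟨E.vertexPos u, by simp [hK, hr0.le]⟩
    exact ⟨k, hk.1⟩
  · exact fun u => hostConn_mesh h0 (hKc u) (convex_closedBall _ _).isPreconnected
  · intro u v hu _
    exact ⟨hostConn_mesh h0 (hAc u v) (hA u v hu).2.1,
      hmeet _ _ (hKc u) (hAc u v) (hA u v hu).2.2.1, hmeet _ _ (hKc v) (hAc u v) (hA u v hu).2.2.2⟩

end Topology

end Drawings

section Tight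

variable [Fintype V]

/-- A dual structure without superfluous faces. -/
structure IsTight {F : Type*} (G : SimpleGraph V) (f : V → V → F) : Prop extends IsDual G f where
  const : ∀ s : F → ZMod 2, cob G f s = 0 → ∀ x y, s x = s y

lemma HasDual.exists_tight {G : SimpleGraph V} (h : HasDual G) :
    ∃ (k : ℕ) (f : V → V → Fin k), IsTight G f := by
  obtain ⟨k, f, hf⟩ := h
  induction k with
  | zero => exact ⟨0, f, hf, fun s _ x => x.elim0⟩
  | succ m ih =>
    by_cases hc : ∀ s : Fin (m + 1) → ZMod 2, cob G f s = 0 → ∀ x y, s x = s y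
    · exact ⟨_, f, hf, hc⟩
    · push Not at hc
      obtain ⟨s, hs, x, y, hxy⟩ := hc
      have hne : x ≠ y := fun he => hxy (by rw [he])
      let e := finSuccAboveEquiv y
      let g : Fin (m + 1) → Fin m := fun i =>
        if h : i ≠ y then e.symm ⟨i, h⟩ else e.symm ⟨x, hne⟩
      refine ih (fun u v => g (f u v)) ⟨fun t u => hf.even (t ∘ g) u, fun z hz => ?_⟩
      obtain ⟨t, ht, hxt⟩ : ∃ t, z = cob G f t ∧ t x = t y := by
        obtain ⟨t, ht⟩ := hf.exact z hz
        by_cases h : t x = t y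
        · exact ⟨t, ht, h⟩
        · refine ⟨t + s, by rw [cob_add, hs, add_zero, ht], ?_⟩
          simp only [Pi.add_apply]
          have key : ∀ a b c d : ZMod 2, ¬ a = b → c ≠ d → a + c = b + d := by decide
          exact key _ _ _ _ h hxy
      refine ⟨fun i => t (e i).1, ?_⟩
      rw [ht, cob_comp]
      congr 1
      funext i
      simp only [Function.comp, g]
      by_cases hi : i = y
      · simp [hi, hxt]
      · simp [hi]

/-- The set of vertices that are not isolated. -/
noncomputable def supp (G : SimpleGraph V) : Finset V := univ.filter fun u => ∃ v, G.Adj u v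

lemma mem_supp {G : SimpleGraph V} {u : V} : u ∈ supp G ↔ ∃ v, G.Adj u v := by simp [supp]

lemma supp_left {G : SimpleGraph V} {u v : V} (h : G.Adj u v) : u ∈ supp G := mem_supp.2 ⟨v, h⟩

lemma supp_right {G : SimpleGraph V} {u v : V} (h : G.Adj u v) : v ∈ supp G := supp_left h.symm

lemma darts_supp (G : SimpleGraph V) :
    darts G (supp G) (supp G) = #(univ.filter fun p : V × V => G.Adj p.1 p.2) := by
  rw [card_filter, ← univ_product_univ, sum_product, Nat.cast_sum]
  unfold darts
  rw [← sum_subset (subset_univ (supp G))]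
  · refine sum_congr rfl fun u _ => ?_
    rw [Nat.cast_sum, ← sum_subset (subset_univ (supp G))]
    · refine sum_congr rfl fun v _ => by push_cast; rfl
    · intro v _ hv
      rw [if_neg fun h => hv (supp_right h), Nat.cast_zero]
  · intro u _ hu
    rw [Nat.cast_eq_zero]
    exact sum_eq_zero fun v _ => if_neg fun h => hu (supp_left h)

lemma darts_eq_card_edges (G : SimpleGraph V) :
    darts G (supp G) (supp G) = 2 * Fintype.card G.edgeSet := by
  rw [darts_supp, ← SimpleGraph.edgeFinset_card]
  have := G.sum_degrees_eq_twice_card_edges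
  rw [card_filter, ← univ_product_univ, sum_product]
  simp only [← card_filter]
  have h2 : ∑ x : V, #(univ.filter fun y => G.Adj x y) = ∑ v, G.degree v :=
    sum_congr rfl fun v _ => by rw [← SimpleGraph.card_neighborFinset_eq_degree]; congr 1; ext; simp
  rw [h2, this]
  push_cast
  rfl

open Module in
/-- The easy half of Euler's formula. -/
lemma IsTight.euler {k : ℕ} {G : SimpleGraph V} {f : V → V → Fin k} (h : IsTight G f)
    (hne : (supp G).Nonempty) : darts G (supp G) (supp G) + 4 ≤ 2 * (#(supp G) : ℤ) + 2 * k := by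
  obtain ⟨s₀, hs₀⟩ := hne
  let ext : (G.edgeSet → ZMod 2) →ₗ[ZMod 2] (V → V → ZMod 2) :=
    { toFun := fun x u v => if h : G.Adj u v then x ⟨s(u, v), h⟩ else 0
      map_add' := fun x y => by funext u v; by_cases h : G.Adj u v <;> simp [h]
      map_smul' := fun c y => by funext u v; by_cases h : G.Adj u v <;> simp [h] }
  let D : (G.edgeSet → ZMod 2) →ₗ[ZMod 2] (V → ZMod 2) :=
    { toFun := fun x u => ∑ v, ext x u v
      map_add' := fun x y => by funext u; simp [sum_add_distrib]
      map_smul' := fun c y => by funext u; simp [mul_sum] }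
  let C : (Fin k → ZMod 2) →ₗ[ZMod 2] (V → V → ZMod 2) :=
    { toFun := cob G f
      map_add' := cob_add G f
      map_smul' := fun c s => by
        funext u v; simp only [cob, Pi.smul_apply, smul_eq_mul, RingHom.id_apply]
        split_ifs <;> ring }
  have hext : ∀ x u v (hu : G.Adj u v), ext x u v = x ⟨s(u, v), hu⟩ := fun x u v hu => dif_pos hu
  have hext0 : ∀ x u v (hu : ¬ G.Adj u v), ext x u v = 0 := fun x u v hu => dif_neg hu
  have hsym : ∀ x u v, ext x u v = ext x v u := by
    intro x u v
    by_cases hu : G.Adj u v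
    · rw [hext _ _ _ hu, hext _ _ _ hu.symm]; congr 2; exact Sym2.eq_swap
    · rw [hext0 _ _ _ hu, hext0 _ _ _ fun h => hu h.symm]
  have h1 : finrank (ZMod 2) (LinearMap.range D) ≤ #((supp G).erase s₀) := by
    let π : (V → ZMod 2) →ₗ[ZMod 2] (((supp G).erase s₀ : Finset V) → ZMod 2) :=
      LinearMap.funLeft (ZMod 2) (ZMod 2) Subtype.val
    have hinj : Function.Injective (π.comp (LinearMap.range D).subtype) := by
      rw [← LinearMap.ker_eq_bot, LinearMap.ker_eq_bot']
      rintro ⟨y, x, rfl⟩ hy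
      have h0 : ∀ u, u ≠ s₀ → D x u = 0 := by
        intro u hu
        by_cases hus : u ∈ supp G
        · exact congrFun hy ⟨u, mem_erase.2 ⟨hu, hus⟩⟩
        · exact sum_eq_zero fun v _ => hext0 _ _ _ fun h => hus (supp_left h)
      have hsum : ∑ u, D x u = 0 := by
        change ∑ u, ∑ v, ext x u v = 0
        exact sum_symm_eq_zero univ _ (hsym x) fun u => hext0 _ _ _ (G.loopless.irrefl u)
      rw [sum_eq_single s₀ (fun u _ hu => h0 u hu) (by simp)] at hsum
      ext u
      by_cases hu : u = s₀
      · rw [hu]; exact hsum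
      · exact h0 u hu
    have := LinearMap.finrank_le_finrank_of_injective hinj
    rwa [finrank_fintype_fun_eq_card, Fintype.card_coe] at this
  have h2 : finrank (ZMod 2) (LinearMap.ker D) ≤ finrank (ZMod 2) (LinearMap.range C) := by
    let ι : LinearMap.ker D →ₗ[ZMod 2] LinearMap.range C :=
      (ext.comp (LinearMap.ker D).subtype).codRestrict _ fun x => by
        obtain ⟨s, hs⟩ := h.exact (ext x.1) ⟨hsym _, fun u v hu => hext0 _ _ _ hu,
          fun u => congrFun x.2 u⟩
        exact ⟨s, hs.symm⟩
    refine LinearMap.finrank_le_finrank_of_injective (f := ι) ?_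
    rw [← LinearMap.ker_eq_bot, LinearMap.ker_eq_bot']
    rintro ⟨x, hx⟩ hy
    have hy' : ext x = 0 := congrArg Subtype.val hy
    ext ⟨e, he⟩
    induction e with
    | _ u v =>
      have := congrFun (congrFun hy' u) v
      rwa [hext _ _ _ he] at this
  have h3 : finrank (ZMod 2) (LinearMap.range C) + 1 ≤ k := by
    have hr := LinearMap.finrank_range_add_finrank_ker C
    have hk : 0 < finrank (ZMod 2) (LinearMap.ker C) := by
      rw [Module.finrank_pos_iff_exists_ne_zero]
      refine ⟨⟨1, ?_⟩, fun h0 => ?_⟩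
      · have := cob_one_add G f 0
        rw [add_zero] at this
        change cob G f 1 = 0
        rw [this]
        funext u v; simp [cob]
      · have := congrFun (congrArg Subtype.val h0) (f s₀ s₀)
        simp at this
    simp only [finrank_fintype_fun_eq_card, Fintype.card_fin] at hr
    omega
  have h4 := LinearMap.finrank_range_add_finrank_ker D
  rw [finrank_fintype_fun_eq_card] at h4
  have h5 : #((supp G).erase s₀) + 1 = #(supp G) := card_erase_add_one hs₀
  rw [darts_eq_card_edges]
  omega

/-- The number of darts in the support of a function. -/
noncomputable def nd (z : V → V → ZMod 2) : ℕ := #(univ.filter fun p : V × V => z p.1 p.2 ≠ 0)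

lemma sum_nd_le {k : ℕ} (G : SimpleGraph V) (f : V → V → Fin k) :
    (∑ g, (nd (cob G f (ind g)) : ℤ)) ≤ 2 * darts G (supp G) (supp G) := by
  rw [darts_supp]
  have : ∑ g, nd (cob G f (ind g)) ≤ 2 * #(univ.filter fun p : V × V => G.Adj p.1 p.2) := by
    unfold nd
    simp only [card_filter]
    rw [sum_comm, mul_sum]
    refine sum_le_sum fun p _ => ?_
    rw [← card_filter]
    by_cases hp : G.Adj p.1 p.2
    · rw [if_pos hp]
      refine le_trans (card_le_card (t := {f p.1 p.2, f p.2 p.1}) fun g hg => ?_) card_le_two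
      by_contra hgn
      simp only [mem_insert, mem_singleton, not_or] at hgn
      simp [cob, ind, hp, Ne.symm hgn.1, Ne.symm hgn.2] at hg
    · simp [cob, hp]
  exact_mod_cast this

end Tight

section Discharging

lemma z2_ne_zero {a : ZMod 2} : a ≠ 0 ↔ a = 1 := by decide +revert

lemma z2_ne_one {a : ZMod 2} : a ≠ 1 ↔ a = 0 := by decide +revert

lemma cyc3_apply_ne_zero {a b c u v : V} (h : cyc3 a b c u v ≠ 0) :
    (u = a ∧ v = b) ∨ (u = b ∧ v = a) ∨ (u = b ∧ v = c) ∨ (u = c ∧ v = b) ∨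
      (u = a ∧ v = c) ∨ (u = c ∧ v = a) := by
  by_contra hc; exact h (cyc3_eq_zero hc)

lemma cyc4_apply_ne_zero {a b c d u v : V} (h : cyc4 a b c d u v ≠ 0) :
    (u = a ∧ v = b) ∨ (u = b ∧ v = a) ∨ (u = b ∧ v = c) ∨ (u = c ∧ v = b) ∨
      (u = c ∧ v = d) ∨ (u = d ∧ v = c) ∨ (u = d ∧ v = a) ∨ (u = a ∧ v = d) := by
  by_contra hc
  simp only [not_or] at hc
  obtain ⟨h1, h2, h3, h4, h5, h6, h7, h8⟩ := hc
  exact h (by simp [cyc4, edg, h1, h2, h3, h4, h5, h6, h7, h8])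

lemma cyc5_apply_ne_zero {a b c d e u v : V} (h : cyc5 a b c d e u v ≠ 0) :
    (u = a ∧ v = b) ∨ (u = b ∧ v = a) ∨ (u = b ∧ v = c) ∨ (u = c ∧ v = b) ∨
      (u = c ∧ v = d) ∨ (u = d ∧ v = c) ∨ (u = d ∧ v = e) ∨ (u = e ∧ v = d) ∨
      (u = e ∧ v = a) ∨ (u = a ∧ v = e) := by
  by_contra hc
  simp only [not_or] at hc
  obtain ⟨h1, h2, h3, h4, h5, h6, h7, h8, h9, h10⟩ := hc
  exact h (by simp [cyc5, edg, h1, h2, h3, h4, h5, h6, h7, h8, h9, h10])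

variable [Fintype V]

/-- The set of triangles. -/
noncomputable def tri (G : SimpleGraph V) : Finset (Finset V) := univ.filter fun s => G.IsNClique 3 s

/-- The vertices of an edge set. -/
noncomputable def vset (z : V → V → ZMod 2) : Finset V := univ.filter fun u => ∃ v, z u v ≠ 0

lemma mem_vset {z : V → V → ZMod 2} {u : V} : u ∈ vset z ↔ ∃ v, z u v ≠ 0 := by simp [vset]

lemma IsEven.adj {G : SimpleGraph V} {z : V → V → ZMod 2} (hz : IsEven G z) {u v : V}
    (h : z u v ≠ 0) : G.Adj u v := by
  by_contra hn; exact h (hz.supp u v hn)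

lemma IsEven.exists_ne {G : SimpleGraph V} {z : V → V → ZMod 2} (hz : IsEven G z) {u v : V}
    (h : z u v ≠ 0) : ∃ w, w ≠ v ∧ z u w ≠ 0 := by
  by_contra hc
  push Not at hc
  have := hz.sum u
  rw [sum_eq_single v (fun w _ hw => hc w hw) (by simp)] at this
  exact h this

lemma IsEven.eq_of_two {G : SimpleGraph V} {z : V → V → ZMod 2} (hz : IsEven G z) {p q r : V}
    (hqr : q ≠ r) (h : ∀ v, v ≠ q → v ≠ r → z p v = 0) : z p q = z p r := by
  have h1 := hz.sum p
  rw [← sum_subset (subset_univ {q, r}) fun v _ hv => by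
    simp only [mem_insert, mem_singleton, not_or] at hv; exact h v hv.1 hv.2, sum_pair hqr] at h1
  exact z2_eq_of_add h1

lemma IsEven.two_mul_card_vset_le {G : SimpleGraph V} {z : V → V → ZMod 2} (hz : IsEven G z) :
    2 * #(vset z) ≤ nd z := by
  unfold nd
  rw [card_filter, ← univ_product_univ, sum_product]
  simp only [← card_filter]
  refine le_trans ?_ (sum_le_sum_of_subset (subset_univ (vset z)))
  rw [mul_comm, ← smul_eq_mul]
  refine card_nsmul_le_sum _ _ _ fun u hu => ?_
  obtain ⟨v, hv⟩ := mem_vset.1 hu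
  obtain ⟨w, hw, hw'⟩ := hz.exists_ne hv
  refine le_trans (card_pair hw).ge (card_le_card fun x hx => ?_)
  simp only [mem_insert, mem_singleton] at hx
  rcases hx with rfl | rfl <;> simpa

lemma IsEven.two_paths {G : SimpleGraph V} {z : V → V → ZMod 2} (hz : IsEven G z) (h0 : z ≠ 0) :
    ∃ a b d, a ≠ b ∧ a ≠ d ∧ b ≠ d ∧ z a b = 1 ∧ z a d = 1 := by
  obtain ⟨a, b, hab⟩ : ∃ a b, z a b ≠ 0 := by
    by_contra hc
    push Not at hc
    exact h0 (by funext u v; exact hc u v)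
  obtain ⟨d, hdb, had⟩ := hz.exists_ne hab
  exact ⟨a, b, d, (hz.adj hab).ne, (hz.adj had).ne, hdb.symm, z2_ne_zero.1 hab, z2_ne_zero.1 had⟩

lemma IsEven.three_le {G : SimpleGraph V} {z : V → V → ZMod 2} (hz : IsEven G z) (h0 : z ≠ 0) :
    3 ≤ #(vset z) := by
  obtain ⟨a, b, d, h1, h2, h3, h4, h5⟩ := hz.two_paths h0
  have : #{a, b, d} = 3 := by rw [card_eq_three]; exact ⟨a, b, d, h1, h2, h3, rfl⟩
  rw [← this]
  refine card_le_card fun x hx => mem_vset.2 ?_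
  simp only [mem_insert, mem_singleton] at hx
  rcases hx with rfl | rfl | rfl
  · exact ⟨b, by simp [h4]⟩
  · exact ⟨a, by simp [hz.symm, h4]⟩
  · exact ⟨a, by simp [hz.symm, h5]⟩

/-- Even subgraphs are empty, triangles, quadrilaterals, or have at least five edges. -/
lemma IsEven.classify {G : SimpleGraph V} {z : V → V → ZMod 2} (hz : IsEven G z) (h0 : z ≠ 0) :
    (∃ a b c, G.Adj a b ∧ G.Adj b c ∧ G.Adj c a ∧ z = cyc3 a b c) ∨
    (∃ a b c d, G.Adj a b ∧ G.Adj b c ∧ G.Adj c d ∧ G.Adj d a ∧ a ≠ c ∧ b ≠ d ∧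
      z = cyc4 a b c d) ∨ 10 ≤ nd z := by
  obtain ⟨a, b, d, hab, had, hbd, zab, zad⟩ := hz.two_paths h0
  by_cases h5 : 5 ≤ #(vset z)
  · exact .inr (.inr (by have := hz.two_mul_card_vset_le; omega))
  have haW : a ∈ vset z := mem_vset.2 ⟨b, by simp [zab]⟩
  have hbW : b ∈ vset z := mem_vset.2 ⟨a, by simp [hz.symm, zab]⟩
  have hdW : d ∈ vset z := mem_vset.2 ⟨a, by simp [hz.symm, zad]⟩
  have hirr : ∀ x, z x x = 0 := fun x => hz.supp x x (G.loopless.irrefl x)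
  have zba : z b a = 1 := by rw [hz.symm, zab]
  have zda : z d a = 1 := by rw [hz.symm, zad]
  have hadj : ∀ {x y}, z x y = 1 → G.Adj x y := fun h => hz.adj (by simp [h])
  by_cases hsub : vset z ⊆ {a, b, d}
  · have hz0 : ∀ u v, v ≠ a → v ≠ b → v ≠ d → z u v = 0 := by
      intro u v h1 h2 h3
      by_contra hne
      have := hsub (mem_vset.2 ⟨u, by rwa [hz.symm] at hne⟩)
      simp [h1, h2, h3] at this
    have hz0' : ∀ u v, u ≠ a → u ≠ b → u ≠ d → z u v = 0 := fun u v h1 h2 h3 => by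
      rw [hz.symm]; exact hz0 v u h1 h2 h3
    have zbd : z b d = 1 := by
      rw [← zba]
      refine hz.eq_of_two had.symm fun v h1 h2 => ?_
      by_cases h3 : v = b
      · rw [h3, hirr]
      · exact hz0 b v h2 h3 h1
    have zdb : z d b = 1 := by rw [hz.symm, zbd]
    refine .inl ⟨a, b, d, hadj zab, hadj zbd, hadj zda, ?_⟩
    funext u v
    by_cases hu : u = a ∨ u = b ∨ u = d
    · by_cases hv : v = a ∨ v = b ∨ v = d
      · rcases hu with rfl | rfl | rfl <;> rcases hv with rfl | rfl | rfl <;>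
          simp [cyc3, edg, *, Ne.symm hab, Ne.symm had, Ne.symm hbd]
      · simp only [not_or] at hv
        rw [hz0 _ _ hv.1 hv.2.1 hv.2.2, cyc3_eq_zero]
        clear * - hv; tauto
    · simp only [not_or] at hu
      rw [hz0' _ _ hu.1 hu.2.1 hu.2.2, cyc3_eq_zero]
      clear * - hu; tauto
  · rw [not_subset] at hsub
    obtain ⟨c, hcW, hc⟩ := hsub
    simp only [mem_insert, mem_singleton, not_or] at hc
    obtain ⟨hca, hcb, hcd⟩ := hc
    have hW : vset z = {a, b, d, c} := by
      symm
      refine eq_of_subset_of_card_le (fun x hx => ?_) ?_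
      · simp only [mem_insert, mem_singleton] at hx
        rcases hx with rfl | rfl | rfl | rfl <;> assumption
      · rw [card_insert_of_notMem (by simp [hab, had, Ne.symm hca]),
          card_insert_of_notMem (by simp [hbd, Ne.symm hcb]),
          card_insert_of_notMem (by simp [Ne.symm hcd]), card_singleton]
        omega
    have hz0 : ∀ u v, v ≠ a → v ≠ b → v ≠ c → v ≠ d → z u v = 0 := by
      intro u v h1 h2 h3 h4
      by_contra hne
      have : v ∈ vset z := mem_vset.2 ⟨u, by rwa [hz.symm] at hne⟩
      simp [hW, h1, h2, h3, h4] at this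
    have hz0' : ∀ u v, u ≠ a → u ≠ b → u ≠ c → u ≠ d → z u v = 0 := fun u v h1 h2 h3 h4 => by
      rw [hz.symm]; exact hz0 v u h1 h2 h3 h4
    have hsum : ∀ u, z u a + z u b + z u d + z u c = 0 := by
      intro u
      have h1 := hz.sum u
      rw [← sum_subset (subset_univ (vset z)) fun v _ hv => by
        by_contra hne; exact hv (mem_vset.2 ⟨u, by rwa [hz.symm] at hne⟩), hW,
        sum_insert (by simp [hab, had, Ne.symm hca]), sum_insert (by simp [hbd, Ne.symm hcb]),
        sum_insert (by simp [Ne.symm hcd]), sum_singleton] at h1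
      rw [← h1]; ring
    have ha := hsum a
    have hb := hsum b
    have hd := hsum d
    have hcc := hsum c
    simp only [hirr, zab, zad, zba, zda, hz.symm c, hz.symm d b] at ha hb hd hcc
    have zac : z a c = 0 := by clear * - ha; grind
    have zca : z c a = 0 := by rw [hz.symm, zac]
    have zbd : z b d = 0 := by
      obtain ⟨y, hy⟩ := mem_vset.1 hcW
      by_contra hne
      rw [← ne_eq, z2_ne_zero] at hne
      have e1 : z b c = 0 := by clear * - hne hb; grind
      have e2 : z d c = 0 := by clear * - hne hd; grind
      refine hy ?_
      by_cases h1 : y = a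
      · rw [h1, hz.symm, zac]
      by_cases h2 : y = b
      · rw [h2, hz.symm, e1]
      by_cases h3 : y = c
      · rw [h3, hirr]
      by_cases h4 : y = d
      · rw [h4, hz.symm, e2]
      exact hz0 c y h1 h2 h3 h4
    have zbc : z b c = 1 := by clear * - zbd hb; grind
    have zdc : z d c = 1 := by clear * - zbd hd; grind
    have zcb : z c b = 1 := by rw [hz.symm, zbc]
    have zcd : z c d = 1 := by rw [hz.symm, zdc]
    have zdb : z d b = 0 := by rw [hz.symm, zbd]
    refine .inr (.inl ⟨a, b, c, d, hadj zab, hadj zbc, hadj zcd, hadj zda, Ne.symm hca, hbd, ?_⟩)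
    clear ha hb hd hcc hsum
    have hcyc : ∀ u v, v ≠ a → v ≠ b → v ≠ c → v ≠ d → cyc4 a b c d u v = 0 := by
      intro u v h1 h2 h3 h4
      simp [cyc4, edg, h1, h2, h3, h4]
    have hcyc' : ∀ u v, u ≠ a → u ≠ b → u ≠ c → u ≠ d → cyc4 a b c d u v = 0 := by
      intro u v h1 h2 h3 h4
      simp [cyc4, edg, h1, h2, h3, h4]
    funext u v
    by_cases hu : u = a ∨ u = b ∨ u = c ∨ u = d
    · by_cases hv : v = a ∨ v = b ∨ v = c ∨ v = d
      · rcases hu with rfl | rfl | rfl | rfl <;> rcases hv with rfl | rfl | rfl | rfl <;>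
          simp [cyc4, edg, hirr, zab, zba, zac, zca, zad, zda, zbc, zcb, zbd, zdb, zcd, zdc,
            hab, had, hbd, hca, hcb, hcd, Ne.symm hab, Ne.symm had, Ne.symm hbd, Ne.symm hca,
            Ne.symm hcb, Ne.symm hcd]
      · simp only [not_or] at hv
        rw [hz0 _ _ hv.1 hv.2.1 hv.2.2.1 hv.2.2.2, hcyc _ _ hv.1 hv.2.1 hv.2.2.1 hv.2.2.2]
    · simp only [not_or] at hu
      rw [hz0' _ _ hu.1 hu.2.1 hu.2.2.1 hu.2.2.2, hcyc' _ _ hu.1 hu.2.1 hu.2.2.1 hu.2.2.2]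

lemma mem_tri {G : SimpleGraph V} {s : Finset V} : s ∈ tri G ↔ G.IsNClique 3 s := by simp [tri]

lemma tri_mem {G : SimpleGraph V} {a b c : V} (h1 : G.Adj a b) (h2 : G.Adj b c) (h3 : G.Adj c a) :
    {a, b, c} ∈ tri G := mem_tri.2 (SimpleGraph.is3Clique_triple_iff.2 ⟨h1, h3.symm, h2⟩)

lemma vset_cyc3 {a b c : V} (hab : a ≠ b) (hbc : b ≠ c) (hac : a ≠ c) :
    vset (cyc3 a b c) = {a, b, c} := by
  ext u
  rw [mem_vset]
  simp only [mem_insert, mem_singleton]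
  constructor
  · rintro ⟨v, hv⟩
    have := cyc3_apply_ne_zero hv
    clear * - this; tauto
  · rintro (rfl | rfl | rfl)
    · exact ⟨b, by rw [cyc3_eq_one hab hbc hac (by simp)]; simp⟩
    · exact ⟨c, by rw [cyc3_eq_one hab hbc hac (by simp)]; simp⟩
    · exact ⟨a, by rw [cyc3_eq_one hab hbc hac (by simp)]; simp⟩

lemma cyc3_eq_of_vset {a b c : V} (hab : a ≠ b) (hbc : b ≠ c) (hac : a ≠ c) :
    cyc3 a b c = fun u v => if u ∈ ({a, b, c} : Finset V) ∧ v ∈ ({a, b, c} : Finset V) ∧ u ≠ v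
      then 1 else 0 := by
  funext u v
  split_ifs with h
  · simp only [mem_insert, mem_singleton] at h
    refine cyc3_eq_one hab hbc hac ?_
    obtain ⟨rfl | rfl | rfl, rfl | rfl | rfl, h3⟩ := h <;> simp_all
  · refine cyc3_eq_zero fun hc => h ?_
    rcases hc with ⟨rfl, rfl⟩ | ⟨rfl, rfl⟩ | ⟨rfl, rfl⟩ | ⟨rfl, rfl⟩ | ⟨rfl, rfl⟩ | ⟨rfl, rfl⟩ <;>
      simp [hab, hbc, hac, Ne.symm hab, Ne.symm hbc, Ne.symm hac]

/-- The face `g` is bounded by a triangle. -/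
def TriFace {F : Type*} (G : SimpleGraph V) (f : V → V → F) (g : F) : Prop :=
  ∃ a b c, G.Adj a b ∧ G.Adj b c ∧ G.Adj c a ∧ cob G f (ind g) = cyc3 a b c

/-- The face `g` is bounded by a quadrilateral. -/
def QuadFace {F : Type*} (G : SimpleGraph V) (f : V → V → F) (g : F) (a b c d : V) : Prop :=
  G.Adj a b ∧ G.Adj b c ∧ G.Adj c d ∧ G.Adj d a ∧ a ≠ c ∧ b ≠ d ∧ cob G f (ind g) = cyc4 a b c d

lemma IsTight.cob_ind_ne_zero {k : ℕ} {G : SimpleGraph V} {f : V → V → Fin k} (h : IsTight G f)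
    (hk : 2 ≤ k) (g : Fin k) : cob G f (ind g) ≠ 0 := by
  intro h0
  have : Nontrivial (Fin k) := Fin.nontrivial_iff_two_le.2 hk
  obtain ⟨g', hg'⟩ := exists_ne g
  have := h.const _ h0 g g'
  simp [ind, hg'] at this

lemma IsTight.cob_ind_inj {k : ℕ} {G : SimpleGraph V} {f : V → V → Fin k} (h : IsTight G f)
    (hk : 3 ≤ k) {g g' : Fin k} (hg : cob G f (ind g) = cob G f (ind g')) : g = g' := by
  by_contra hne
  obtain ⟨x, hx1, hx2⟩ := Fin.exists_ne_and_ne_of_two_lt g g' hk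
  have h0 : cob G f (ind g + ind g') = 0 := by
    rw [cob_add, hg]; funext u v; exact z2_add_self _
  have := h.const _ h0 g x
  simp [ind, hne, hx1, hx2] at this

/-- An edge bound for planar graphs without quadrilateral faces. -/
lemma IsTight.count {k : ℕ} {G : SimpleGraph V} {f : V → V → Fin k} (h : IsTight G f)
    (hne : (supp G).Nonempty) (h4 : ∀ g a b c d, ¬ QuadFace G f g a b c d) :
    darts G (supp G) (supp G) + 2 ≤ 2 * (#(supp G) : ℤ) ∨
    (darts G (supp G) (supp G) ≤ 2 * (#(supp G) : ℤ) ∧ (tri G).Nonempty) ∨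
    3 * darts G (supp G) (supp G) + 20 ≤ 10 * (#(supp G) : ℤ) + 4 * #(tri G) := by
  have he := h.euler hne
  by_cases hk : k ≤ 1
  · left; omega
  let T := univ.filter fun g => TriFace G f g
  have hsum : 10 * (k : ℤ) - 4 * #T ≤ ∑ g, (nd (cob G f (ind g)) : ℤ) := by
    have h1 : ∀ g ∈ (univ : Finset (Fin k)),
        (10 : ℤ) - 4 * (if TriFace G f g then 1 else 0) ≤ nd (cob G f (ind g)) := by
      intro g _
      have hev := h.isEven (ind g)
      have hn0 := h.cob_ind_ne_zero (by omega) g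
      split_ifs with hg
      · have := hev.two_mul_card_vset_le
        have := hev.three_le hn0
        omega
      · rcases hev.classify hn0 with ⟨a, b, c, ha⟩ | ⟨a, b, c, d, ha⟩ | ha
        · exact (hg ⟨a, b, c, ha⟩).elim
        · exact (h4 g a b c d ha).elim
        · omega
    refine le_trans (le_of_eq ?_) (sum_le_sum h1)
    rw [sum_sub_distrib, ← mul_sum, sum_const, card_univ, Fintype.card_fin, nsmul_eq_mul]
    simp only [T, card_filter]
    push_cast
    ring
  have hle := sum_nd_le G f
  have hT : T = ∅ ∨ k = 2 ∨ #T ≤ #(tri G) := by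
    by_cases hk3 : k = 2
    · exact .inr (.inl hk3)
    · refine .inr (.inr ?_)
      refine card_le_card_of_injOn (fun g => vset (cob G f (ind g))) ?_ ?_
      · intro g hg
        obtain ⟨a, b, c, h1, h2, h3, h4⟩ := (mem_filter.1 hg).2
        dsimp only
        rw [h4, vset_cyc3 h1.ne h2.ne h3.ne.symm]
        exact tri_mem h1 h2 h3
      · intro g hg g' hg' hgg
        obtain ⟨a, b, c, h1, h2, h3, h4⟩ := (mem_filter.1 hg).2
        obtain ⟨a', b', c', h1', h2', h3', h4'⟩ := (mem_filter.1 hg').2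
        dsimp only at hgg
        refine h.cob_ind_inj (by omega) ?_
        rw [h4, h4', vset_cyc3 h1.ne h2.ne h3.ne.symm, vset_cyc3 h1'.ne h2'.ne h3'.ne.symm] at hgg
        rw [h4, h4', cyc3_eq_of_vset h1.ne h2.ne h3.ne.symm,
          cyc3_eq_of_vset h1'.ne h2'.ne h3'.ne.symm, hgg]
  by_cases hT0 : T = ∅
  · right; right
    rw [hT0] at hsum
    simp only [card_empty] at hsum
    omega
  · have hne : (tri G).Nonempty := by
      obtain ⟨g, hg⟩ := nonempty_iff_ne_empty.2 hT0
      obtain ⟨a, b, c, h1, h2, h3, h4⟩ := (mem_filter.1 hg).2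
      exact ⟨_, tri_mem h1 h2 h3⟩
    rcases hT with h1 | h1 | h1
    · exact (hT0 h1).elim
    · right; left
      exact ⟨by omega, hne⟩
    · right; right; omega

end Discharging

section ShortCycles

/-- The indicator function of a pair, counted modulo two. -/
noncomputable def two (q r v : V) : ZMod 2 := (if v = q then 1 else 0) + if v = r then 1 else 0

lemma two_left {q r : V} (h : q ≠ r) : two q r q = 1 := by simp [two, h]
lemma two_right {q r : V} (h : q ≠ r) : two q r r = 1 := by simp [two, Ne.symm h]
lemma two_ne {q r v : V} (h : v ≠ q) (h' : v ≠ r) : two q r v = 0 := by simp [two, h, h']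
lemma two_ne_zero' {q r v : V} (h : two q r v ≠ 0) : v = q ∨ v = r := by
  by_contra hc
  rw [not_or] at hc
  exact h (two_ne hc.1 hc.2)

lemma cyc3_at {a b c : V} (h1 : a ≠ b) (h2 : a ≠ c) (v : V) : cyc3 a b c a v = two b c v := by
  simp [cyc3, edg, two, h1, h2]

lemma cyc4_at {a b c d : V} (h1 : a ≠ b) (h2 : a ≠ c) (h3 : a ≠ d) (v : V) :
    cyc4 a b c d a v = two b d v := by
  simp [cyc4, edg, two, h1, h2, h3]

lemma cyc5_at {a b c d e : V} (h1 : a ≠ b) (h2 : a ≠ c) (h3 : a ≠ d) (h4 : a ≠ e) (v : V) :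
    cyc5 a b c d e a v = two b e v := by
  simp [cyc5, edg, two, h1, h2, h3, h4]

lemma cyc3_rot (a b c : V) : cyc3 a b c = cyc3 b c a := by unfold cyc3; abel
lemma cyc4_rot (a b c d : V) : cyc4 a b c d = cyc4 b c d a := by unfold cyc4; abel
lemma cyc5_rot (a b c d e : V) : cyc5 a b c d e = cyc5 b c d e a := by unfold cyc5; abel
lemma cyc4_flip (a b c d : V) : cyc4 a b c d = cyc4 a d c b := by
  unfold cyc4; rw [edg_swap a b, edg_swap b c, edg_swap c d, edg_swap d a]; abel
lemma cyc3_out {a b c u : V} (h1 : u ≠ a) (h2 : u ≠ b) (h3 : u ≠ c) (v : V) :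
    cyc3 a b c u v = 0 := by simp [cyc3, edg, h1, h2, h3]
lemma cyc4_out {a b c d u : V} (h1 : u ≠ a) (h2 : u ≠ b) (h3 : u ≠ c) (h4 : u ≠ d) (v : V) :
    cyc4 a b c d u v = 0 := by simp [cyc4, edg, h1, h2, h3, h4]
lemma cyc5_out {a b c d e u : V} (h1 : u ≠ a) (h2 : u ≠ b) (h3 : u ≠ c) (h4 : u ≠ d) (h5 : u ≠ e)
    (v : V) : cyc5 a b c d e u v = 0 := by simp [cyc5, edg, h1, h2, h3, h4, h5]

attribute [irreducible] two
attribute [local irreducible] cyc3 cyc4 cyc5 edg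

variable [Fintype V] {F : Type*} {G : SimpleGraph V} {f : V → V → F}

/-- A cycle that contains no other nonempty even subgraph. -/
def MinCyc (G : SimpleGraph V) (C : V → V → ZMod 2) : Prop :=
  IsEven G C ∧ C ≠ 0 ∧ ∀ z, IsEven G z → (∀ u v, z u v ≠ 0 → C u v ≠ 0) → z = 0 ∨ z = C

omit [Fintype V] in
lemma eq_zero_or_of_edges {C z : V → V → ZMod 2} (L : List (V × V)) (hz : ∀ u v, z u v = z v u)
    (hC : ∀ u v, C u v ≠ 0 → (u, v) ∈ L ∨ (v, u) ∈ L) (hCs : ∀ u v, C u v = C v u)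
    (hz0 : ∀ u v, z u v ≠ 0 → C u v ≠ 0) (c : ZMod 2) (hL : ∀ p ∈ L, z p.1 p.2 = c)
    (hL' : ∀ p ∈ L, C p.1 p.2 = 1) : z = 0 ∨ z = C := by
  rcases z2_cases c with rfl | rfl
  · left
    funext u v
    by_contra h
    rcases hC u v (hz0 u v h) with h1 | h1
    · exact h (hL _ h1)
    · rw [hz] at h; exact h (hL _ h1)
  · right
    funext u v
    by_cases h : C u v = 0
    · rw [h]; by_contra h1; exact hz0 u v h1 h
    · rcases hC u v h with h1 | h1
      · rw [hL _ h1, hL' _ h1]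
      · rw [hz, hCs, hL _ h1, hL' _ h1]

lemma eq_of_at {C z : V → V → ZMod 2} (hz : IsEven G z) {p q r : V} (hqr : q ≠ r)
    (hC : ∀ v, C p v = two q r v) (hz0 : ∀ u v, z u v ≠ 0 → C u v ≠ 0) : z p q = z p r :=
  hz.eq_of_two hqr fun v h1 h2 => by
    by_contra h; exact hz0 p v h (by rw [hC, two_ne h1 h2])

lemma minCyc_cyc3 {a b c : V} (h1 : G.Adj a b) (h2 : G.Adj b c) (h3 : G.Adj c a) :
    MinCyc G (cyc3 a b c) := by
  have ea := fun v => cyc3_at h1.ne h3.ne.symm v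
  have eb := fun v => cyc3_at h2.ne h1.ne.symm v
  have ec := fun v => cyc3_at h3.ne h2.ne.symm v
  simp only [← cyc3_rot a b c, cyc3_rot c a b] at eb ec
  refine ⟨isEven_cyc3 h1 h2 h3, fun h => ?_, fun z hz hz0 => ?_⟩
  · have := ea b
    rw [h, two_left h2.ne] at this
    exact absurd this (by simp)
  · have k1 := eq_of_at hz h2.ne ea hz0
    have k2 := eq_of_at hz h3.ne eb hz0
    refine eq_zero_or_of_edges [(a, b), (b, c), (a, c)] hz.symm (fun u v h => ?_)
      (isEven_cyc3 h1 h2 h3).symm hz0 (z a b) ?_ ?_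
    · have := cyc3_apply_ne_zero h
      simp only [List.mem_cons, Prod.mk.injEq, List.not_mem_nil, or_false]
      clear * - this; tauto
    · simp only [List.mem_cons, List.not_mem_nil, or_false]
      rintro p (rfl | rfl | rfl)
      · rfl
      · rw [k2, hz.symm]
      · exact k1.symm
    · simp only [List.mem_cons, List.not_mem_nil, or_false]
      rintro p (rfl | rfl | rfl)
      · exact (ea _).trans (two_left h2.ne)
      · exact (eb _).trans (two_left h3.ne)
      · exact (ea _).trans (two_right h2.ne)

lemma minCyc_cyc4 {a b c d : V} (h1 : G.Adj a b) (h2 : G.Adj b c) (h3 : G.Adj c d)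
    (h4 : G.Adj d a) (hac : a ≠ c) (hbd : b ≠ d) : MinCyc G (cyc4 a b c d) := by
  have ea := fun v => cyc4_at h1.ne hac h4.ne.symm v
  have eb := fun v => cyc4_at h2.ne hbd h1.ne.symm v
  have ec := fun v => cyc4_at h3.ne hac.symm h2.ne.symm v
  rw [← cyc4_rot a b c d] at eb
  rw [← cyc4_rot b c d a, ← cyc4_rot a b c d] at ec
  refine ⟨isEven_cyc4 h1 h2 h3 h4, fun h => ?_, fun z hz hz0 => ?_⟩
  · have := ea b
    rw [h, two_left hbd] at this
    exact absurd this (by simp)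
  · have k1 := eq_of_at hz hbd ea hz0
    have k2 := eq_of_at hz hac.symm eb hz0
    have k3 := eq_of_at hz hbd.symm ec hz0
    refine eq_zero_or_of_edges [(a, b), (b, c), (a, d), (c, d)] hz.symm (fun u v h => ?_)
      (isEven_cyc4 h1 h2 h3 h4).symm hz0 (z a b) ?_ ?_
    · have := cyc4_apply_ne_zero h
      simp only [List.mem_cons, Prod.mk.injEq, List.not_mem_nil, or_false]
      clear * - this; tauto
    · simp only [List.mem_cons, List.not_mem_nil, or_false]
      rintro p (rfl | rfl | rfl | rfl)
      · rfl
      · rw [k2, hz.symm]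
      · exact k1.symm
      · rw [k3, hz.symm, k2, hz.symm]
    · simp only [List.mem_cons, List.not_mem_nil, or_false]
      rintro p (rfl | rfl | rfl | rfl)
      · exact (ea _).trans (two_left hbd)
      · exact (eb _).trans (two_left hac.symm)
      · exact (ea _).trans (two_right hbd)
      · exact (ec _).trans (two_left hbd.symm)

lemma minCyc_cyc5 {a b c d e : V} (h1 : G.Adj a b) (h2 : G.Adj b c) (h3 : G.Adj c d)
    (h4 : G.Adj d e) (h5 : G.Adj e a) (hac : a ≠ c) (had : a ≠ d) (hbd : b ≠ d) (hbe : b ≠ e)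
    (hce : c ≠ e) : MinCyc G (cyc5 a b c d e) := by
  have ea := fun v => cyc5_at h1.ne hac had h5.ne.symm v
  have eb := fun v => cyc5_at h2.ne hbd hbe h1.ne.symm v
  have ec := fun v => cyc5_at h3.ne hce hac.symm h2.ne.symm v
  have ed := fun v => cyc5_at h4.ne had.symm hbd.symm h3.ne.symm v
  rw [← cyc5_rot a b c d e] at eb
  rw [← cyc5_rot b c d e a, ← cyc5_rot a b c d e] at ec
  rw [← cyc5_rot c d e a b, ← cyc5_rot b c d e a, ← cyc5_rot a b c d e] at ed
  refine ⟨isEven_cyc5 h1 h2 h3 h4 h5, fun h => ?_, fun z hz hz0 => ?_⟩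
  · have := ea b
    rw [h, two_left hbe] at this
    exact absurd this (by simp)
  · have k1 := eq_of_at hz hbe ea hz0
    have k2 := eq_of_at hz hac.symm eb hz0
    have k3 := eq_of_at hz hbd.symm ec hz0
    have k4 := eq_of_at hz hce.symm ed hz0
    refine eq_zero_or_of_edges [(a, b), (b, c), (a, e), (c, d), (d, e)] hz.symm (fun u v h => ?_)
      (isEven_cyc5 h1 h2 h3 h4 h5).symm hz0 (z a b) ?_ ?_
    · have := cyc5_apply_ne_zero h
      simp only [List.mem_cons, Prod.mk.injEq, List.not_mem_nil, or_false]
      clear * - this; grind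
    · simp only [List.mem_cons, List.not_mem_nil, or_false]
      rintro p (rfl | rfl | rfl | rfl | rfl)
      · rfl
      · rw [k2, hz.symm]
      · exact k1.symm
      · rw [k3, hz.symm, k2, hz.symm]
      · rw [k4, hz.symm, k3, hz.symm, k2, hz.symm]
    · simp only [List.mem_cons, List.not_mem_nil, or_false]
      rintro p (rfl | rfl | rfl | rfl | rfl)
      · exact (ea _).trans (two_left hbe)
      · exact (eb _).trans (two_left hac.symm)
      · exact (ea _).trans (two_right hbe)
      · exact (ec _).trans (two_left hbd.symm)
      · exact (ed _).trans (two_left hce.symm)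

omit [Fintype V] in
lemma cob_adj {u v : V} (h : G.Adj u v) (s : F → ZMod 2) :
    cob G f s u v = s (f u v) + s (f v u) := if_pos h

omit [Fintype V] in
lemma eq_of_cob {u v : V} (h : G.Adj u v) {s : F → ZMod 2} (hs : cob G f s u v = 0) :
    s (f u v) = s (f v u) := by
  rw [cob_adj h] at hs; exact z2_eq_of_add hs

omit [Fintype V] in
lemma side_of_cob_ind {u v : V} {g : F} (h : cob G f (ind g) u v = 1) :
    (f u v = g ∧ f v u ≠ g) ∨ (f v u = g ∧ f u v ≠ g) := by
  unfold cob ind at h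
  by_cases h0 : G.Adj u v <;> by_cases h1 : f u v = g <;> by_cases h2 : f v u = g <;>
    simp_all [z2_add_self]

/-- Rotation at a vertex that the boundary of `s` avoids. -/
lemma IsDual.transfer (h : IsDual G f) {s : F → ZMod 2} {p q r : V}
    (hs : ∀ v, cob G f s p v = 0) {t : F → ZMod 2} (ht : ∀ v, cob G f t p v = two q r v) :
    s (f p q) = s (f p r) := by
  have h1 := h.even (s * t) p
  have h2 : ∀ v, cob G f (s * t) p v = s (f p v) * two q r v := by
    intro v
    by_cases hv : G.Adj p v
    · have := eq_of_cob hv (hs v)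
      rw [← ht, cob_adj hv, cob_adj hv, Pi.mul_apply, Pi.mul_apply, ← this]; ring
    · rw [← ht, cob, cob, if_neg hv, if_neg hv, mul_zero]
  simp only [h2, two, mul_add, mul_ite, mul_one, mul_zero, sum_add_distrib, sum_ite_eq',
    mem_univ, if_true] at h1
  exact z2_eq_of_add h1

/-- Two disjoint paths between opposite corners of a quadrilateral face cannot exist. -/
theorem IsDual.crossing (h : IsDual G f) {g : F} {v0 v1 v2 v3 x y z w : V}
    (hg : QuadFace G f g v0 v1 v2 v3) (hx : G.Adj v0 x) (hxy : G.Adj x y) (hy : G.Adj y v2)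
    (hz : G.Adj v1 z) (hzw : G.Adj z w) (hw : G.Adj w v3) (hx1 : x ≠ v1) (hx3 : x ≠ v3)
    (hy1 : y ≠ v1) (hy3 : y ≠ v3) (hz0 : z ≠ v0) (hz2 : z ≠ v2) (hw0 : w ≠ v0) (hw2 : w ≠ v2)
    (hxz : x ≠ z) (hxw : x ≠ w) (hyz : y ≠ z) (hyw : y ≠ w) (hx2 : x ≠ v2) (hy0 : y ≠ v0)
    (hz3 : z ≠ v3) (hw1 : w ≠ v1) : False := by
  obtain ⟨a01, a12, a23, a30, n02, n13, hC⟩ := hg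
  obtain ⟨s1, hs1, hs1g⟩ : ∃ s, cob G f s = cyc5 v0 x y v2 v1 ∧ s g = 0 := by
    obtain ⟨s, hs⟩ := h.exact _ (isEven_cyc5 hx hxy hy a12.symm a01.symm)
    rcases z2_cases (s g) with h0 | h0
    · exact ⟨s, hs.symm, h0⟩
    · exact ⟨1 + s, by rw [cob_one_add, hs], by simp [h0, z2_add_self]⟩
  obtain ⟨s2, hs2⟩ := h.exact _ (isEven_cyc5 hz hzw hw a23.symm a12.symm)
  have ev3 : ∀ v, cob G f s2 v3 v = two v2 w v := fun v => by
    rw [← hs2, cyc5_rot, cyc5_rot, cyc5_rot]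
    exact cyc5_at a23.ne.symm n13.symm hz3.symm hw.ne.symm v
  have ew : ∀ v, cob G f s2 w v = two v3 z v := fun v => by
    rw [← hs2, cyc5_rot, cyc5_rot]
    exact cyc5_at hw.ne hw2 hw1 hzw.ne.symm v
  have ez : ∀ v, cob G f s2 z v = two w v1 v := fun v => by
    rw [← hs2, cyc5_rot]
    exact cyc5_at hzw.ne hz3 hz2 hz.ne.symm v
  have e1 : ∀ v, cob G f s2 v1 v = two z v2 v := fun v => by
    rw [← hs2]
    exact cyc5_at hz.ne hw1.symm n13 a12.ne v
  have o3 : ∀ v, cob G f s1 v3 v = 0 := fun v => by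
    rw [hs1]; exact cyc5_out a30.ne hx3.symm hy3.symm a23.ne.symm n13.symm v
  have ow : ∀ v, cob G f s1 w v = 0 := fun v => by
    rw [hs1]; exact cyc5_out hw0 hxw.symm hyw.symm hw2 hw1 v
  have oz : ∀ v, cob G f s1 z v = 0 := fun v => by
    rw [hs1]; exact cyc5_out hz0 hxz.symm hyz.symm hz2 hz.ne.symm v
  have g32 : cob G f (ind g) v3 v2 = 1 := by
    rw [hC, cyc4_rot, cyc4_rot, cyc4_rot, cyc4_at a30.ne n13.symm a23.ne.symm, two_right n02]
  have g12 : cob G f (ind g) v1 v2 = 1 := by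
    rw [hC, cyc4_rot, cyc4_at a12.ne n13 a01.ne.symm, two_left n02.symm]
  have k3 : s1 (f v3 v2) = 0 := by
    rcases side_of_cob_ind g32 with ⟨h1, -⟩ | ⟨h1, -⟩
    · rw [h1, hs1g]
    · rw [eq_of_cob a23.symm (o3 v2), h1, hs1g]
  have k4 : s1 (f v3 w) = 0 := by rw [← h.transfer o3 ev3, k3]
  have k5 : s1 (f w z) = 0 := by
    rw [← h.transfer ow ew, ← eq_of_cob hw.symm (o3 w), k4]
  have k6 : s1 (f z v1) = 0 := by
    rw [← h.transfer oz ez, ← eq_of_cob hzw.symm (ow z), k5]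
  have k7 : s1 (f v1 z) = 0 := by rw [← eq_of_cob hz.symm (oz v1), k6]
  have o1 : ∀ v, cob G f (1 + (s1 + ind g)) v1 v = 0 := fun v => by
    rw [cob_one_add, cob_add, hC, hs1, Pi.add_apply, Pi.add_apply, cyc4_rot,
      cyc4_at a12.ne n13 a01.ne.symm, ← cyc5_rot, cyc5_at a01.ne.symm hx1.symm hy1.symm a12.ne]
    unfold two
    rw [add_comm (ite (v = v2) _ _)]
    exact z2_add_self _
  have k8 : (1 + (s1 + ind g)) (f v1 v2) = 0 := by
    rcases side_of_cob_ind g12 with ⟨h1, -⟩ | ⟨h1, -⟩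
    · rw [h1]; simp [ind, hs1g, z2_add_self]
    · rw [eq_of_cob a12 (o1 v2), h1]; simp [ind, hs1g, z2_add_self]
  have k9 : (1 + (s1 + ind g)) (f v1 z) = 0 := by rw [h.transfer o1 e1, k8]
  have k10 : (1 + (s1 + ind g)) (f z v1) = 0 := by rw [← eq_of_cob hz (o1 z), k9]
  simp only [Pi.add_apply, Pi.one_apply, k6, k7, ind, zero_add] at k9 k10
  have m1 : f v1 z = g := by by_contra hne; simp [hne] at k9
  have m2 : f z v1 = g := by by_contra hne; simp [hne] at k10
  have := e1 z
  rw [two_left hz2, cob_adj hz, m1, m2, z2_add_self] at this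
  exact absurd this (by simp)

end ShortCycles

section Critical

/-- A proper colouring with three colours. -/
def Proper (G : SimpleGraph V) (φ : V → Fin 3) : Prop := ∀ u v, G.Adj u v → φ u ≠ φ v

/-- The graph obtained by isolating a vertex. -/
def del (G : SimpleGraph V) (w : V) : SimpleGraph V where
  Adj u v := G.Adj u v ∧ u ≠ w ∧ v ≠ w
  symm := ⟨fun _ _ h => ⟨h.1.symm, h.2.2, h.2.1⟩⟩
  loopless := ⟨fun _ h => G.irrefl h.1⟩

lemma del_le (G : SimpleGraph V) (w : V) : del G w ≤ G := fun _ _ h => h.1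

variable [Fintype V] {F : Type*} {G : SimpleGraph V} {f : V → V → F}

/-- A graph that is not colourable, but becomes so after isolating any vertex. -/
structure Crit (G : SimpleGraph V) : Prop where
  not_proper : ∀ φ, ¬ Proper G φ
  exists_del : ∀ w ∈ supp G, ∃ φ, Proper (del G w) φ

lemma exists_perm (a b : V → Fin 3) (K : Finset V) (h : ∀ x ∈ K, ∀ y ∈ K, a x = a y ↔ b x = b y) :
    ∃ σ : Equiv.Perm (Fin 3), ∀ x ∈ K, σ (a x) = b x := by
  have hg : ∀ x ∈ K, ∃ y ∈ K, a y = a x := fun x hx => ⟨x, hx, rfl⟩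
  let q : Fin 3 → Fin 3 := fun c => if hc : ∃ y ∈ K, a y = c then b hc.choose else 0
  have hq : ∀ x ∈ K, q (a x) = b x := fun x hx => by
    have hc := hg x hx
    simp only [q, dif_pos hc]
    exact (h _ hc.choose_spec.1 x hx).1 hc.choose_spec.2
  obtain ⟨g, hg⟩ := Finset.exists_equiv_extend_of_card_eq (α := Fin 3) (β := Fin 3)
    (t := univ) (by simp) (s := K.image a) (f := q) (subset_univ _) (by
      intro c hc d hd hcd
      simp only [coe_image, Set.mem_image, mem_coe] at hc hd
      obtain ⟨x, hx, rfl⟩ := hc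
      obtain ⟨y, hy, rfl⟩ := hd
      rw [hq x hx, hq y hy] at hcd
      exact (h x hx y hy).2 hcd)
  refine ⟨Equiv.ofBijective (fun c => (g c : Fin 3)) ?_, fun x hx => ?_⟩
  · exact Finite.injective_iff_bijective.1 fun c d hcd => g.injective (Subtype.ext hcd)
  · change (g (a x) : Fin 3) = b x
    rw [hg _ (mem_image_of_mem _ hx), hq x hx]

/-- A clique does not separate a critical graph. -/
lemma Crit.cut (h : Crit G) (K : Finset V) (hK : ∀ x ∈ K, ∀ y ∈ K, x = y ∨ G.Adj x y)
    (U : V → Prop) (hUK : ∀ x ∈ K, ¬ U x) (hU : ∀ u v, U u → G.Adj u v → U v ∨ v ∈ K)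
    {x y : V} (hx : U x) (hxs : x ∈ supp G) (hy : ¬ U y) (hyK : y ∉ K) (hys : y ∈ supp G) :
    False := by
  obtain ⟨φ, hφ⟩ := h.exists_del y hys
  obtain ⟨χ, hχ⟩ := h.exists_del x hxs
  have p1 : ∀ u v, G.Adj u v → (U u ∨ u ∈ K) → (U v ∨ v ∈ K) → φ u ≠ φ v := by
    intro u v huv h1 h2
    refine hφ u v ⟨huv, ?_, ?_⟩
    · rintro rfl; exact h1.elim hy hyK
    · rintro rfl; exact h2.elim hy hyK
  have p2 : ∀ u v, G.Adj u v → ¬ U u → ¬ U v → χ u ≠ χ v := by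
    intro u v huv h1 h2
    refine hχ u v ⟨huv, ?_, ?_⟩
    · rintro rfl; exact h1 hx
    · rintro rfl; exact h2 hx
  obtain ⟨σ, hσ⟩ := exists_perm χ φ K (by
    intro u hu v hv
    rcases hK u hu v hv with rfl | huv
    · simp
    · exact iff_of_false (p2 u v huv (hUK u hu) (hUK v hv)) (p1 u v huv (.inr hu) (.inr hv)))
  refine h.not_proper (fun v => if U v then φ v else σ (χ v)) fun u v huv => ?_
  by_cases hu : U u <;> by_cases hv : U v
  · simp only [hu, hv, if_true]; exact p1 u v huv (.inl hu) (.inl hv)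
  · have hvK := (hU u v hu huv).resolve_left hv
    simp only [hu, hv, if_true, if_false, hσ v hvK]
    exact p1 u v huv (.inl hu) (.inr hvK)
  · have huK := (hU v u hv huv.symm).resolve_left hu
    simp only [hu, hv, if_true, if_false, hσ u huK]
    exact p1 u v huv (.inr huK) (.inl hv)
  · simp only [hu, hv, if_false]
    exact fun he => p2 u v huv hu hv (σ.injective he)

lemma Crit.two_lt (h : Crit G) {u : V} (hu : u ∈ supp G) (x y : V)
    (hA : ∀ v, G.Adj u v → v = x ∨ v = y) : False := by
  obtain ⟨φ, hφ⟩ := h.exists_del u hu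
  obtain ⟨c, hc⟩ := KYMin.exists_avoid {φ x, φ y} card_le_two
  rw [mem_insert, mem_singleton, not_or] at hc
  have hne : ∀ v, G.Adj u v → c ≠ φ v := fun v hv => by
    rcases hA v hv with rfl | rfl
    exacts [hc.1, hc.2]
  refine h.not_proper (Function.update φ u c) fun a b hab => ?_
  by_cases ha : a = u
  · subst ha
    rw [Function.update_self, Function.update_of_ne hab.ne']
    exact hne b hab
  · by_cases hb : b = u
    · subst hb
      rw [Function.update_self, Function.update_of_ne hab.ne]
      exact (hne a hab.symm).symm
    · rw [Function.update_of_ne ha, Function.update_of_ne hb]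
      exact hφ a b ⟨hab, ha, hb⟩

lemma Crit.exists_cycle (h : Crit G) {w a b : V} (ha : G.Adj w a) (hb : G.Adj w b) (hab : a ≠ b) :
    ∃ z, IsEven G z ∧ ∀ v, z w v = two a b v := by
  have hr : Relation.ReflTransGen (fun x y => x ∈ univ.erase w ∧ y ∈ univ.erase w ∧
      y ∈ univ.filter (G.Adj x)) a b := by
    by_contra hr
    refine h.cut {w} (by simp) (fun x => Relation.ReflTransGen (fun x y => x ∈ univ.erase w ∧
      y ∈ univ.erase w ∧ y ∈ univ.filter (G.Adj x)) a x) ?_ ?_ (x := a) (y := b) .refl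
      (supp_right ha) hr (by simpa using hb.ne') (supp_right hb)
    · intro x hx hax
      rw [mem_singleton] at hx
      subst hx
      rcases Relation.ReflTransGen.cases_tail hax with h1 | ⟨c, -, h1⟩
      · exact ha.ne h1
      · simp at h1
    · intro u v hu huv
      by_cases hv : v = w
      · right; simp [hv]
      · left
        by_cases huw : u = w
        · exfalso
          subst huw
          rcases Relation.ReflTransGen.cases_tail hu with h1 | ⟨c, -, h1⟩
          · exact ha.ne h1
          · simp at h1
        · exact hu.tail ⟨by simp [huw], by simp [hv], by simp [huv]⟩
  obtain ⟨κ, hκs, hκ0, hκ⟩ := exists_chain (nb := fun x => univ.filter (G.Adj x)) (by simp)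
    (by simp [G.adj_comm]) _ hr
  have hk : ∀ x y, ¬ G.Adj x y → κ x y = 0 := fun x y hxy => by
    by_contra hc; exact hxy (by simpa using (hκ0 x y hc).2.2)
  have hkw : ∀ y, κ w y = 0 := fun y => by
    by_contra hc; simpa using (hκ0 w y hc).1
  refine ⟨κ + edg w a + edg w b, ⟨fun u v => ?_, fun u v huv => ?_, fun u => ?_⟩, fun v => ?_⟩
  · simp only [Pi.add_apply]
    rw [hκs, edg_symm w a, edg_symm w b]
  · simp only [Pi.add_apply]
    rw [hk u v huv, edg_supp ha huv, edg_supp hb huv]; rfl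
  · simp only [Pi.add_apply, sum_add_distrib]
    rw [sum_edg' ha.ne, sum_edg' hb.ne]
    have := hκ u
    rw [sum_filter, sum_congr rfl (g := κ u) (fun y _ => by
      by_cases hy : G.Adj u y
      · rw [if_pos hy]
      · rw [if_neg hy, hk u y hy])] at this
    rw [this]
    grind
  · simp only [Pi.add_apply]
    rw [hkw]
    simp [edg, two, ha.ne, hb.ne]

lemma Crit.rotate (h : Crit G) (hd : IsDual G f) {s : F → ZMod 2} {w a b : V}
    (hs : ∀ v, cob G f s w v = 0) (ha : G.Adj w a) (hb : G.Adj w b) :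
    s (f w a) = s (f w b) := by
  by_cases hab : a = b
  · rw [hab]
  · obtain ⟨z, hz, hz1⟩ := h.exists_cycle ha hb hab
    obtain ⟨t, rfl⟩ := hd.exact z hz
    exact hd.transfer hs hz1

lemma Crit.exists_other (h : Crit G) {u v : V} (huv : G.Adj u v) : ∃ w, G.Adj u w ∧ w ≠ v := by
  by_contra! hc
  exact h.two_lt (supp_left huv) v v fun w hw => .inl (hc w hw)

lemma Crit.bridgeless (h : Crit G) (hd : IsDual G f) {u v : V} (huv : G.Adj u v) :
    f u v ≠ f v u := by
  intro he
  obtain ⟨w, hw, hwv⟩ := h.exists_other huv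
  obtain ⟨z, hz, hz1⟩ := h.exists_cycle huv hw hwv.symm
  obtain ⟨t, rfl⟩ := hd.exact z hz
  have := hz1 v
  rw [two_left hwv.symm, cob_adj huv, he, z2_add_self] at this
  exact absurd this (by simp)

lemma Crit.cob_ind (h : Crit G) (hd : IsDual G f) {u v : V} (huv : G.Adj u v) :
    cob G f (ind (f u v)) u v = 1 := by
  rw [cob_adj huv]
  simp [ind, (h.bridgeless hd huv).symm]

lemma cob_sum (Φ : Finset F) (u v : V) :
    cob G f (fun x => if x ∈ Φ then 1 else 0) u v = ∑ g ∈ Φ, cob G f (ind g) u v := by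
  by_cases h : G.Adj u v
  · simp [cob, h, ind, sum_add_distrib]
  · simp [cob, h]

/-- Faces that cancel at a vertex are all the faces there. -/
lemma Crit.faces_at (h : Crit G) (hd : IsDual G f) (Φ : Finset F) {p q : V} {g : F} (hg : g ∈ Φ)
    (h0 : ∀ v, ∑ g ∈ Φ, cob G f (ind g) p v = 0) (hq : cob G f (ind g) p q = 1) {u : V}
    (hu : G.Adj p u) : ∃ g ∈ Φ, cob G f (ind g) p u = 1 := by
  have hs : ∀ v, cob G f (fun x => if x ∈ Φ then 1 else 0) p v = 0 := fun v => by
    rw [cob_sum, h0]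
  have hpq : G.Adj p q := by
    by_contra hc; simp [cob, hc] at hq
  have h1 := h.rotate hd hs hu hpq
  have h2 : (if f p q ∈ Φ then 1 else 0 : ZMod 2) = 1 := by
    rcases side_of_cob_ind hq with ⟨h2, -⟩ | ⟨h2, -⟩
    · rw [h2, if_pos hg]
    · have := eq_of_cob hpq (hs q)
      rw [this, h2, if_pos hg]
  simp only [h2] at h1
  refine ⟨f p u, ?_, h.cob_ind hd hu⟩
  by_contra hc
  simp [hc] at h1

lemma IsTight.eq_ind (h : IsTight G f) {C : V → V → ZMod 2} (hC : MinCyc G C) {s : F → ZMod 2}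
    (hs : cob G f s = C) (h1 : ∀ u v, G.Adj u v → s (f u v) = 1 → s (f v u) = 1 → False) :
    ∃ g, s = ind g := by
  have hs0 : s ≠ 0 := by
    rintro rfl
    apply hC.2.1
    rw [← hs]; funext u v; simp [cob]
  obtain ⟨g, hg⟩ := Function.ne_iff.1 hs0
  replace hg : s g = 1 := z2_ne_zero.1 hg
  refine ⟨g, ?_⟩
  have hz : ∀ u v, cob G f (ind g) u v ≠ 0 → C u v ≠ 0 := by
    intro u v huv
    have ha : G.Adj u v := by
      by_contra hc; simp [cob, hc] at huv
    rw [← hs, cob_adj ha]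
    intro h3
    have h4 := z2_eq_of_add h3
    rcases side_of_cob_ind (z2_ne_zero.1 huv) with ⟨e, -⟩ | ⟨e, -⟩
    · rw [e, hg] at h4
      exact h1 u v ha (by rw [e, hg]) h4.symm
    · rw [e, hg] at h4
      exact h1 u v ha h4 (by rw [e, hg])
  rcases hC.2.2 _ (h.toIsDual.isEven (ind g)) hz with h0 | h0
  · have := h.const _ h0
    funext x
    have hx := this g x
    by_cases hxg : x = g
    · rw [hxg, hg]; simp [ind]
    · simp [ind, hxg] at hx
  · have := h.const (ind g + s) (by
      rw [cob_add, h0, hs]; funext u v; exact z2_add_self _)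
    funext x
    have hx := this x g
    simp only [Pi.add_apply, hg] at hx
    have h2 : ind g g = 1 := by simp [ind]
    rw [h2, z2_add_self] at hx
    exact (z2_eq_of_add hx).symm

/-- Every triangle of a critical graph bounds a face. -/
theorem Crit.triFace (h : Crit G) (hd : IsTight G f) {a b c : V} (h1 : G.Adj a b)
    (h2 : G.Adj b c) (h3 : G.Adj c a) : ∃ g, cob G f (ind g) = cyc3 a b c := by
  have hmin := minCyc_cyc3 h1 h2 h3
  obtain ⟨s, hs⟩ := hd.exact _ hmin.1
  have hK : ∀ x ∈ ({a, b, c} : Finset V), ∀ y ∈ ({a, b, c} : Finset V), x = y ∨ G.Adj x y := by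
    simp only [mem_insert, mem_singleton]
    rintro x (rfl | rfl | rfl) y (rfl | rfl | rfl) <;> simp [h1, h2, h3, h1.symm, h2.symm, h3.symm]
  have hedge : ∀ x ∈ ({a, b, c} : Finset V), ∀ y ∈ ({a, b, c} : Finset V), G.Adj x y →
      cob G f s x y = 1 := by
    rw [← hs]
    have e1 := cyc3_eq_one (u := a) (v := b) h1.ne h2.ne h3.ne'
    simp only [mem_insert, mem_singleton]
    rintro x (rfl | rfl | rfl) y (rfl | rfl | rfl) hxy
    all_goals first | exact absurd rfl hxy.ne | exact cyc3_eq_one h1.ne h2.ne h3.ne' (by simp)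
  have hout : ∀ u, u ∉ ({a, b, c} : Finset V) → ∀ v, cob G f s u v = 0 := fun u hu v => by
    simp only [mem_insert, mem_singleton, not_or] at hu
    rw [← hs]; exact cyc3_out hu.1 hu.2.1 hu.2.2 v
  by_cases hin : ∃ x y, x ∉ ({a, b, c} : Finset V) ∧ G.Adj x y ∧ s (f x y) = 1
  · obtain ⟨x, x', hx, hxx, hx1⟩ := hin
    have hall : ∀ u v, u ∉ ({a, b, c} : Finset V) → G.Adj u v → s (f u v) = 1 := by
      intro u v hu huv
      by_contra hc
      refine h.cut _ hK (fun u => u ∉ ({a, b, c} : Finset V) ∧ ∃ v, G.Adj u v ∧ s (f u v) = 1)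
        (fun x hx hc => hc.1 hx) ?_ (x := x) (y := u) ⟨hx, x', hxx, hx1⟩ (supp_left hxx) ?_ hu
        (supp_left huv)
      · rintro u v ⟨hu, w, huw, hw⟩ huv
        by_cases hv : v ∈ ({a, b, c} : Finset V)
        · exact .inr hv
        · refine .inl ⟨hv, u, huv.symm, ?_⟩
          rw [← eq_of_cob huv (hout u hu v), h.rotate hd.toIsDual (hout u hu) huv huw, hw]
      · rintro ⟨-, w, huw, hw⟩
        exact hc ((h.rotate hd.toIsDual (hout u hu) huv huw).trans hw)
    obtain ⟨g, hg⟩ := hd.eq_ind hmin (s := 1 + s) (by rw [cob_one_add, hs]) (by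
      intro u v huv e1 e2
      have e3 : s (f u v) = 0 := by
        clear * - e1; simp only [Pi.add_apply, Pi.one_apply] at e1; grind
      have e4 : s (f v u) = 0 := by
        clear * - e2; simp only [Pi.add_apply, Pi.one_apply] at e2; grind
      by_cases hu : u ∈ ({a, b, c} : Finset V)
      · by_cases hv : v ∈ ({a, b, c} : Finset V)
        · have := hedge u hu v hv huv
          rw [cob_adj huv, e3, e4] at this
          exact absurd this (by simp)
        · rw [hall v u hv huv.symm] at e4; exact absurd e4 (by simp)
      · rw [hall u v hu huv] at e3; exact absurd e3 (by simp))
    exact ⟨g, by rw [← hg, cob_one_add, hs]⟩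
  · obtain ⟨g, hg⟩ := hd.eq_ind hmin hs.symm (by
      intro u v huv e1 e2
      by_cases hu : u ∈ ({a, b, c} : Finset V)
      · by_cases hv : v ∈ ({a, b, c} : Finset V)
        · have := hedge u hu v hv huv
          rw [cob_adj huv, e1, e2] at this
          exact absurd this (by simp)
        · exact hin ⟨v, u, hv, huv.symm, e2⟩
      · exact hin ⟨u, v, hu, huv, e1⟩)
    exact ⟨g, by rw [← hg, hs]⟩

lemma QuadFace.rot {g : F} {a b c d : V} (h : QuadFace G f g a b c d) : QuadFace G f g b c d a :=
  ⟨h.2.1, h.2.2.1, h.2.2.2.1, h.1, h.2.2.2.2.2.1, h.2.2.2.2.1.symm, by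
    rw [h.2.2.2.2.2.2, cyc4_rot]⟩

lemma QuadFace.flip {g : F} {a b c d : V} (h : QuadFace G f g a b c d) : QuadFace G f g a d c b :=
  ⟨h.2.2.2.1.symm, h.2.2.1.symm, h.2.1.symm, h.1.symm, h.2.2.2.2.1, h.2.2.2.2.2.1.symm, by
    rw [h.2.2.2.2.2.2, cyc4_flip]⟩

theorem Crit.not_adj_diag (h : Crit G) (hd : IsTight G f) {g : F} {a b c d : V}
    (hg : QuadFace G f g a b c d) : ¬ G.Adj a c := by
  intro hac
  obtain ⟨h1, h2, h3, h4, nac, nbd, hC⟩ := hg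
  obtain ⟨g', hg'⟩ := h.triFace hd h1 h2 hac.symm
  have e1 : ∀ v, cob G f (ind g) b v = two c a v := fun v => by
    rw [hC, cyc4_rot, cyc4_at h2.ne nbd h1.ne']
  have e2 : ∀ v, cob G f (ind g') b v = two c a v := fun v => by
    rw [hg', cyc3_rot, cyc3_at h2.ne h1.ne']
  have hgg : g ≠ g' := by
    rintro rfl
    have : cyc3 a b c d c = cyc4 a b c d d c := by rw [← hC, hg']
    rw [cyc3_out h4.ne nbd.symm h3.ne', cyc4_rot, cyc4_rot, cyc4_rot,
      cyc4_at h4.ne nbd.symm h3.ne', two_right nac] at this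
    exact absurd this (by simp)
  refine h.two_lt (supp_right h1) c a fun v hv => ?_
  obtain ⟨x, hx, hx1⟩ := h.faces_at hd.toIsDual {g, g'} (g := g) (by simp) (p := b) (q := c)
    (fun v => by rw [sum_pair hgg, e1, e2, z2_add_self]) (by rw [e1, two_left nac.symm]) hv
  rw [mem_insert, mem_singleton] at hx
  rcases hx with rfl | rfl
  · exact two_ne_zero' (by rw [← e1, hx1]; simp)
  · exact two_ne_zero' (by rw [← e2, hx1]; simp)

end Critical

section Regions

/-- A path between two vertices that becomes a new triangle when they are identified. -/
def New (G : SimpleGraph V) (a c r s : V) : Prop :=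
  G.Adj a r ∧ G.Adj r s ∧ G.Adj s c ∧ ¬ G.Adj r c ∧ ¬ G.Adj s a

lemma Proper.mono {G G' : SimpleGraph V} {φ : V → Fin 3} (h : Proper G φ) (hle : G' ≤ G) :
    Proper G' φ := fun u v huv => h u v (hle huv)

lemma Proper.of_ident {G : SimpleGraph V} {a c : V} (hne : a ≠ c) (hac : ¬ G.Adj a c) {φ : V → Fin 3}
    (h : Proper (ident G a c) φ) : Proper G (fun v => if v = c then φ a else φ v) := by
  intro u v huv
  by_cases hu : u = c
  · subst hu
    have hv : v ≠ u := huv.ne'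
    have hva : v ≠ a := by rintro rfl; exact hac huv.symm
    simp only [if_true, if_neg hv]
    exact h a v ⟨hva.symm, hne, hv, .inr (.inl ⟨rfl, huv⟩)⟩
  · by_cases hv : v = c
    · subst hv
      have hua : u ≠ a := by rintro rfl; exact hac huv
      simp only [if_true, if_neg hu]
      exact h u a ⟨hua, hu, hne, .inr (.inr ⟨rfl, huv.symm⟩)⟩
    · simp only [if_neg hu, if_neg hv]
      exact h u v ⟨huv.ne, hu, hv, .inl huv⟩

lemma ident_adj_of_ne {G : SimpleGraph V} {a c u v : V} (hu : u ≠ a) (hv : v ≠ a)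
    (h : (ident G a c).Adj u v) : G.Adj u v := by
  obtain ⟨-, -, -, h | h | h⟩ := h
  exacts [h, absurd h.1 hu, absurd h.1 hv]

lemma ident_adj_left {G : SimpleGraph V} {a c v : V}
    (h : (ident G a c).Adj a v) : G.Adj a v ∨ G.Adj c v := by
  obtain ⟨h1, -, -, h | h | h⟩ := h
  exacts [.inl h, .inr h.2, absurd h.1.symm h1]

variable [Fintype V] {F : Type*} {G : SimpleGraph V} {f : V → V → F}

lemma supp_mono {G G' : SimpleGraph V} (h : G' ≤ G) : supp G' ⊆ supp G := fun u hu => by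
  obtain ⟨v, hv⟩ := mem_supp.1 hu
  exact supp_left (h hv)

lemma tri_mono {G G' : SimpleGraph V} (h : G' ≤ G) : tri G' ⊆ tri G := fun s hs => by
  rw [mem_tri] at *
  exact hs.mono h

lemma card_supp_del_lt {w : V} (hw : w ∈ supp G) : #(supp (del G w)) < #(supp G) := by
  refine card_lt_card ⟨supp_mono (del_le G w), fun h => ?_⟩
  obtain ⟨v, hv⟩ := mem_supp.1 (h hw)
  exact hv.2.1 rfl

lemma card_supp_ident_lt {a c : V} (ha : a ∈ supp G) (hc : c ∈ supp G) :
    #(supp (ident G a c)) < #(supp G) := by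
  refine card_lt_card ⟨fun u hu => ?_, fun h => ?_⟩
  · obtain ⟨v, -, -, -, h | h | h⟩ := mem_supp.1 hu
    · exact supp_left h
    · rw [h.1]; exact ha
    · exact supp_right h.2
  · obtain ⟨v, hv⟩ := mem_supp.1 (h hc)
    exact hv.2.1 rfl

lemma QuadFace.hasDual_ident {g : F} {a b c d : V} (hg : QuadFace G f g a b c d)
    (h : IsDual G f) (hac : ¬ G.Adj a c) : HasDual (ident G a c) := by
  have := h.addEdge hg.2.2.2.2.2.2 hg.1 hg.2.1 hg.2.2.2.2.1 hac hg.2.2.2.2.2.1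
  have h2 := this.contract (a := a) (c := c) (by
    rw [SimpleGraph.sup_adj, SimpleGraph.edge_adj]
    exact .inr ⟨.inl ⟨rfl, rfl⟩, hg.2.2.2.2.1⟩)
  rwa [ident_sup_edge G hg.2.2.2.2.1] at h2

lemma tri_cases {T : Finset V} (h : T ∈ tri G) (a : V) : (a ∉ T) ∨
    ∃ y z, T = {a, y, z} ∧ G.Adj a y ∧ G.Adj y z ∧ G.Adj z a := by
  by_cases ha : a ∈ T
  · right
    rw [mem_tri, SimpleGraph.is3Clique_iff] at h
    obtain ⟨x, y, z, h1, h2, h3, rfl⟩ := h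
    simp only [mem_insert, mem_singleton] at ha
    rcases ha with rfl | rfl | rfl
    · exact ⟨y, z, rfl, h1, h3, h2.symm⟩
    · exact ⟨z, x, by ext; simp; tauto, h3, h2.symm, h1⟩
    · exact ⟨x, y, by ext; simp; tauto, h2.symm, h1, h3⟩
  · exact .inl ha

lemma tri_ident_card (a c : V) (P : Finset (V × V)) (hP : ∀ r s, New G a c r s → (r, s) ∈ P) :
    #(tri (ident G a c)) ≤ #(tri G) + #P := by
  have hsub : tri (ident G a c) ⊆ (tri G).image (fun T => T.image fun v => if v = c then a else v) ∪
      P.image (fun p => {a, p.1, p.2}) := by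
    intro T hT
    rw [mem_union, mem_image, mem_image]
    have hcT : c ∉ T := fun hc => by
      rcases tri_cases hT c with h | ⟨y, z, -, h, -⟩
      · exact h hc
      · exact h.2.1 rfl
    have hid : T.image (fun v => if v = c then a else v) = T := by
      ext x
      simp only [mem_image]
      constructor
      · rintro ⟨y, hy, rfl⟩
        rw [if_neg (by rintro rfl; exact hcT hy)]; exact hy
      · exact fun hx => ⟨x, hx, if_neg (by rintro rfl; exact hcT hx)⟩
    rcases tri_cases hT a with h | ⟨y, z, rfl, h1, h2, h3⟩
    · left
      refine ⟨T, ?_, hid⟩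
      rw [mem_tri, SimpleGraph.is3Clique_iff] at *
      obtain ⟨x, y, z, h1, h2, h3, rfl⟩ := hT
      simp only [mem_insert, mem_singleton, not_or] at h
      exact ⟨x, y, z, ident_adj_of_ne (Ne.symm h.1) (Ne.symm h.2.1) h1,
        ident_adj_of_ne (Ne.symm h.1) (Ne.symm h.2.2) h2,
        ident_adj_of_ne (Ne.symm h.2.1) (Ne.symm h.2.2) h3, rfl⟩
    · have hyz := ident_adj_of_ne h1.ne' h3.ne h2
      have hyc : y ≠ c := h2.2.1
      have hzc : z ≠ c := h3.2.1
      have h4 := ident_adj_left h1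
      have h5 := ident_adj_left h3.symm
      by_cases ha : G.Adj a y ∧ G.Adj a z
      · exact .inl ⟨_, tri_mem ha.1 hyz ha.2.symm, hid⟩
      by_cases hc : G.Adj c y ∧ G.Adj c z
      · refine .inl ⟨_, tri_mem hc.1 hyz hc.2.symm, ?_⟩
        simp [image_insert, hyc, hzc]
      · right
        by_cases hay : G.Adj a y
        · have haz : ¬ G.Adj a z := fun h => ha ⟨hay, h⟩
          have hcz := h5.resolve_left haz
          exact ⟨(y, z), hP _ _ ⟨hay, hyz, hcz.symm, fun h => hc ⟨h.symm, hcz⟩,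
            fun h => haz h.symm⟩, rfl⟩
        · have hcy := h4.resolve_left hay
          have hcz : ¬ G.Adj c z := fun h => hc ⟨hcy, h⟩
          have haz := h5.resolve_right hcz
          exact ⟨(z, y), hP _ _ ⟨haz, hyz.symm, hcy.symm, fun h => hcz h.symm,
            fun h => hay h.symm⟩, by ext; simp; tauto⟩
  exact (card_le_card hsub).trans ((card_union_le _ _).trans
    (Nat.add_le_add card_image_le card_image_le))

/-- The subgraph of all edges that meet a region. -/
def reg (G : SimpleGraph V) (f : V → V → F) (s : F → ZMod 2) : SimpleGraph V where
  Adj u v := G.Adj u v ∧ (s (f u v) = 1 ∨ s (f v u) = 1)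
  symm := ⟨fun _ _ h => ⟨h.1.symm, h.2.symm⟩⟩
  loopless := ⟨fun _ h => G.irrefl h.1⟩

/-- The faces of a region, with everything outside merged into one face. -/
noncomputable def regFace (f : V → V → F) (s : F → ZMod 2) (u v : V) : Option F :=
  if s (f u v) = 1 then some (f u v) else none

lemma reg_le (s : F → ZMod 2) : reg G f s ≤ G := fun _ _ h => h.1

lemma reg_adj {s : F → ZMod 2} {u v : V} (h : cob G f s u v = 1) : (reg G f s).Adj u v := by
  have ha : G.Adj u v := by
    by_contra hc; simp [cob, hc] at h
  rw [cob_adj ha] at h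
  refine ⟨ha, ?_⟩
  by_contra hc
  rw [not_or] at hc
  rw [z2_ne_one.1 hc.1, z2_ne_one.1 hc.2] at h
  exact absurd h (by simp)

lemma cob_reg (s : F → ZMod 2) (t : Option F → ZMod 2) :
    cob (reg G f s) (regFace f s) t = cob G f (fun x => if s x = 1 then t (some x) else t none) := by
  funext u v
  by_cases ha : G.Adj u v
  · by_cases h1 : s (f u v) = 1 <;> by_cases h2 : s (f v u) = 1 <;>
      simp [cob, reg, regFace, ha, h1, h2, z2_add_self]
  · simp [cob, reg, ha]

/-- An even subgraph that avoids the outside of a cycle does not separate its faces. -/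
lemma IsTight.nest (h : IsTight G f) {s t : F → ZMod 2} (hs : MinCyc G (cob G f s))
    (ht : ∀ u v, G.Adj u v → s (f u v) = 0 → s (f v u) = 0 → cob G f t u v = 0) :
    ∃ c, ∀ x, s x = 0 → t x = c := by
  by_cases hne : ∃ x, s x = 0
  swap
  · exact ⟨0, fun x hx => (hne ⟨x, hx⟩).elim⟩
  obtain ⟨x0, hx0⟩ := hne
  have hz : ∀ u v, cob G f (t * (1 + s)) u v ≠ 0 → cob G f s u v ≠ 0 := by
    intro u v huv h3
    apply huv
    by_cases ha : G.Adj u v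
    · rw [cob_adj ha]
      have h4 := eq_of_cob ha h3
      simp only [Pi.mul_apply, Pi.add_apply, Pi.one_apply]
      rcases z2_cases (s (f u v)) with h5 | h5
      · have := ht u v ha h5 (by rw [← h4, h5])
        rw [cob_adj ha] at this
        rw [← h4, h5, add_zero, mul_one, mul_one, this]
      · rw [← h4, h5, z2_add_self, mul_zero, mul_zero, add_zero]
    · simp [cob, ha]
  rcases hs.2.2 _ (h.toIsDual.isEven (t * (1 + s))) hz with h0 | h0
  · refine ⟨t x0, fun x hx => ?_⟩
    have := h.const _ h0 x x0
    simpa [hx, hx0] using this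
  · refine ⟨t x0, fun x hx => ?_⟩
    have := h.const (t * (1 + s) + s) (by
      rw [cob_add, h0]; funext u v; exact z2_add_self _) x x0
    simpa [hx, hx0] using this

lemma IsTight.isDual_reg (h : IsTight G f) {s : F → ZMod 2} (hs : MinCyc G (cob G f s)) :
    IsDual (reg G f s) (regFace f s) where
  even t u := by rw [cob_reg]; exact h.even _ u
  exact z hz := by
    obtain ⟨t, rfl⟩ := h.exact z ⟨hz.symm, fun u v huv => hz.supp u v fun hc => huv hc.1, hz.sum⟩
    obtain ⟨c, hc⟩ := h.nest hs (t := t) (fun u v _ h1 h2 => hz.supp u v fun hr => by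
      rcases hr.2 with h3 | h3
      · rw [h1] at h3; exact absurd h3 (by simp)
      · rw [h2] at h3; exact absurd h3 (by simp))
    refine ⟨fun x => x.elim c t, ?_⟩
    rw [cob_reg]
    congr 1
    funext x
    by_cases hx : s x = 1
    · simp [hx]
    · rw [if_neg hx]; exact hc x (z2_ne_one.1 hx)

lemma cob_reg_none (s : F → ZMod 2) :
    cob (reg G f s) (regFace f s) (ind none) = cob G f s := by
  rw [cob_reg, ← cob_one_add]
  congr 1
  funext x
  rcases z2_cases (s x) with h | h <;> simp [ind, h, z2_add_self]

lemma cyc3_all {a b c x y : V} (h1 : G.Adj a b) (h2 : G.Adj b c) (h3 : G.Adj c a)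
    (h : cyc3 a b c x y ≠ 0) (P : V → V → Prop) (hP : ∀ u v, P u v → P v u)
    (p1 : P a b) (p2 : P b c) (p3 : P c a) : P x y := by
  rcases cyc3_apply_ne_zero h with ⟨rfl, rfl⟩ | ⟨rfl, rfl⟩ | ⟨rfl, rfl⟩ | ⟨rfl, rfl⟩ |
    ⟨rfl, rfl⟩ | ⟨rfl, rfl⟩
  exacts [p1, hP _ _ p1, p2, hP _ _ p2, hP _ _ p3, p3]

/-- A triangle that meets only inner edges of a region bounds a face inside it. -/
lemma Crit.tri_reg (h : Crit G) (hd : IsTight G f) {s : F → ZMod 2} (hs : MinCyc G (cob G f s))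
    (h3 : ∀ a b c, G.Adj a b → G.Adj b c → G.Adj c a → cob G f s ≠ cyc3 a b c) {a b c : V}
    (h1 : (reg G f s).Adj a b) (h2 : (reg G f s).Adj b c) (h4 : (reg G f s).Adj c a) :
    ∃ g, s g = 1 ∧ cob G f (ind g) = cyc3 a b c := by
  obtain ⟨g, hg⟩ := h.triFace hd h1.1 h2.1 h4.1
  refine ⟨g, ?_, hg⟩
  by_contra hsg
  replace hsg := z2_ne_one.1 hsg
  have key : ∀ u v, (reg G f s).Adj u v → cob G f (ind g) u v = 1 → cob G f s u v ≠ 0 := by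
    intro u v huv huv1
    rcases side_of_cob_ind huv1 with ⟨e, -⟩ | ⟨e, -⟩
    · rcases huv.2 with e1 | e1
      · rw [e, hsg] at e1; exact absurd e1 (by simp)
      · rw [cob_adj huv.1, e, hsg, e1]; simp
    · rcases huv.2 with e1 | e1
      · rw [cob_adj huv.1, e, hsg, e1]; simp
      · rw [e, hsg] at e1; exact absurd e1 (by simp)
  have hz : ∀ u v, cob G f (ind g) u v ≠ 0 → cob G f s u v ≠ 0 := by
    intro u v huv
    refine key u v ?_ (z2_ne_zero.1 huv)
    rw [hg] at huv
    exact cyc3_all h1.1 h2.1 h4.1 huv (reg G f s).Adj (fun _ _ h => h.symm) h1 h2 h4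
  rcases hs.2.2 _ (hd.toIsDual.isEven (ind g)) hz with h0 | h0
  · have : cyc3 a b c a b = 0 := by rw [← hg, h0]; rfl
    rw [cyc3_at h1.ne h4.ne', two_left h2.ne] at this
    exact absurd this (by simp)
  · exact h3 a b c h1.1 h2.1 h4.1 (by rw [← h0, hg])

end Regions

section Minimal

/-- Join a new vertex to the vertices in `N`. -/
def cone (G : SimpleGraph V) (N : Finset V) : SimpleGraph (Option V) where
  Adj u v := (∃ a b, u = some a ∧ v = some b ∧ G.Adj a b) ∨
    (u = none ∧ ∃ a ∈ N, v = some a) ∨ (v = none ∧ ∃ a ∈ N, u = some a)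
  symm := ⟨by
    rintro u v (⟨a, b, h1, h2, h3⟩ | h | h)
    exacts [.inl ⟨b, a, h2, h1, h3.symm⟩, .inr (.inr h), .inr (.inl h)]⟩
  loopless := ⟨by
    rintro u (⟨a, b, h1, h2, h3⟩ | ⟨h, a, -, h'⟩ | ⟨h, a, -, h'⟩)
    · exact h3.ne (Option.some_injective _ (h1.symm.trans h2))
    · rw [h] at h'; exact absurd h' (by simp)
    · rw [h] at h'; exact absurd h' (by simp)⟩

lemma cone_some {G : SimpleGraph V} {N : Finset V} {a b : V} :
    (cone G N).Adj (some a) (some b) ↔ G.Adj a b := by simp [cone]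

lemma cone_none {G : SimpleGraph V} {N : Finset V} {b : V} :
    (cone G N).Adj none (some b) ↔ b ∈ N := by simp [cone]

/-- The old vertices of a cone. -/
def old (A : Finset V) : Finset (Option V) := A.map .some

lemma none_notMem_old (A : Finset V) : none ∉ old A := by simp [old]

lemma pot_old (G : SimpleGraph V) (N A : Finset V) :
    pot (cone G N) (old A) = 10 * (#A : ℤ) - 3 * darts G A A := by
  simp only [pot, old, darts, sum_map, card_map, Function.Embedding.some_apply, cone_some]

lemma pot_insert_old (G : SimpleGraph V) (N A : Finset V) :
    10 * (#A : ℤ) + 10 - 3 * (darts G A A + 2 * #(A.filter (· ∈ N))) ≤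
      pot (cone G N) (insert none (old A)) := by
  have h1 := pot_old G N A
  have h3 : ∑ v ∈ old A, (if (cone G N).Adj none v then (1 : ℤ) else 0) = #(A.filter (· ∈ N)) := by
    simp only [old, sum_map, Function.Embedding.some_apply, cone_none]
    rw [sum_boole]
  have h4 : ∑ v ∈ old A, (if (cone G N).Adj v none then (1 : ℤ) else 0) = #(A.filter (· ∈ N)) := by
    rw [← h3]; simp only [(cone G N).adj_comm]
  unfold pot darts at *
  rw [card_insert_of_notMem (none_notMem_old A)]
  simp only [sum_insert (none_notMem_old A), sum_add_distrib, SimpleGraph.irrefl, if_false, h3, h4]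
  push_cast
  linarith

variable [Fintype V] {F : Type*} {G : SimpleGraph V} {f : V → V → F}

lemma exists_coned_coloring (N : Finset V) (hG : HasDual G) (htri : tri G = ∅) (hN : #N ≤ 4)
    (h4 : ∀ (k : ℕ) (f : V → V → Fin k), IsTight G f → ∀ g a b c d, ¬ QuadFace G f g a b c d)
    (hdel : ∀ w ∈ supp G, ∃ φ col, Proper (del G w) φ ∧ ∀ x ∈ N, φ x ≠ col) :
    ∃ φ col, Proper G φ ∧ ∀ x ∈ N, φ x ≠ col := by
  by_cases hne : (supp G).Nonempty
  swap
  · exact ⟨fun _ => 0, 1, fun u v huv => (hne ⟨u, supp_left huv⟩).elim, fun _ _ => by simp⟩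
  by_contra hc
  have hS : ¬ ColOn (cone G N) (insert none (old (supp G))) := by
    rintro ⟨φ, hφ⟩
    have hm : ∀ v ∈ supp G, some v ∈ insert none (old (supp G)) := fun v hv => by
      simp [old, hv]
    obtain ⟨c, hcc⟩ := KYMin.exists_avoid {φ none} (by simp)
    rw [mem_singleton] at hcc
    refine hc ⟨fun v => if v ∈ supp G then φ (some v) else c, φ none, fun u v huv => ?_,
      fun x hx => ?_⟩
    · simp only [supp_left huv, supp_right huv, if_true]
      exact hφ _ (hm u (supp_left huv)) _ (hm v (supp_right huv)) (cone_some.2 huv)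
    · by_cases hxs : x ∈ supp G
      · simp only [hxs, if_true]
        exact (hφ _ (mem_insert_self _ _) _ (hm x hxs) (cone_none.2 hx)).symm
      · simpa only [hxs, if_false] using hcc
  obtain ⟨W, hW, hWc, hWp⟩ := exists_pot_le_four _ _ _ _ rfl hS
  have hsub : old (supp G) ⊆ W := by
    intro x hx
    obtain ⟨w, hw, rfl⟩ : ∃ w ∈ supp G, some w = x := by simpa [old] using hx
    by_contra hwW
    obtain ⟨φ, col, h1, h2⟩ := hdel w hw
    have hne : ∀ {u}, some u ∈ W → u ≠ w := fun hu he => hwW (he ▸ hu)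
    refine hWc ⟨fun x => x.elim col φ, fun u hu v hv huv => ?_⟩
    rcases huv with ⟨a, b, rfl, rfl, h3⟩ | ⟨rfl, a, ha, rfl⟩ | ⟨rfl, a, ha, rfl⟩
    · exact h1 a b ⟨h3, hne hu, hne hv⟩
    · exact (h2 a ha).symm
    · exact h2 a ha
  obtain ⟨k, f, hf⟩ := hG.exists_tight
  have hcount := hf.count hne (h4 k f hf)
  rw [htri, card_empty] at hcount
  have h1 : #((supp G).filter (· ∈ N)) ≤ #(supp G) := card_filter_le _ _
  have h2 : #((supp G).filter (· ∈ N)) ≤ 4 := by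
    refine (card_le_card fun x hx => ?_).trans hN
    exact (mem_filter.1 hx).2
  have h3 : 1 ≤ #(supp G) := card_pos.2 hne
  by_cases hnone : none ∈ W
  · have : W = insert none (old (supp G)) :=
      Subset.antisymm hW (insert_subset hnone hsub)
    have h5 := pot_insert_old G N (supp G)
    rw [← this] at h5
    rcases hcount with h | h | h
    · omega
    · exact absurd h.2 (by simp)
    · push_cast at h; omega
  · have : W = old (supp G) := by
      refine Subset.antisymm (fun x hx => ?_) hsub
      rcases mem_insert.1 (hW hx) with rfl | h
      exacts [absurd hx hnone, h]
    rw [this, pot_old] at hWp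
    rcases hcount with h | h | h
    · omega
    · exact absurd h.2 (by simp)
    · push_cast at h; omega

lemma no_tri (htri : tri G = ∅) {a b c : V} (h1 : G.Adj a b) (h2 : G.Adj b c) (h3 : G.Adj c a) :
    False := by
  have := tri_mem h1 h2 h3
  rw [htri] at this
  exact absurd this (by simp)

/-- A planar graph without triangles has a colouring in which four given vertices avoid a
colour. -/
theorem exists_coloring_avoiding (n : ℕ) : ∀ (G : SimpleGraph V) (N : Finset V), #(supp G) = n →
    HasDual G → tri G = ∅ → #N ≤ 4 → ∃ φ col, Proper G φ ∧ ∀ x ∈ N, φ x ≠ col := by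
  induction n using Nat.strong_induction_on with
  | _ n ih =>
    intro G N hn hG htri hN
    by_cases h4 : ∀ (k : ℕ) (f : V → V → Fin k), IsTight G f → ∀ g a b c d, ¬ QuadFace G f g a b c d
    · refine exists_coned_coloring N hG htri hN h4 fun w hw => ?_
      refine ih _ (hn ▸ card_supp_del_lt hw) _ N rfl (hG.mono (del_le G w)) ?_ hN
      exact subset_empty.1 (htri ▸ tri_mono (del_le G w))
    push Not at h4
    obtain ⟨k, f, hf, g, v0, v1, v2, v3, hg⟩ := h4
    have main : ∀ a b c d, QuadFace G f g a b c d → (∀ r s, ¬ New G a c r s) →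
        ∃ φ col, Proper G φ ∧ ∀ x ∈ N, φ x ≠ col := by
      intro a b c d hg hnew
      have hac : ¬ G.Adj a c := fun h => no_tri htri hg.1 hg.2.1 h.symm
      have hne := hg.2.2.2.2.1
      have ht : tri (ident G a c) = ∅ := by
        have := tri_ident_card (G := G) a c ∅ fun r s h => (hnew r s h).elim
        rw [htri] at this
        simpa using this
      obtain ⟨φ, col, h1, h2⟩ := ih _ (hn ▸ card_supp_ident_lt (supp_left hg.1) (supp_right hg.2.1))
        (ident G a c) (N.image fun v => if v = c then a else v) rfl
        (hg.hasDual_ident hf.toIsDual hac) ht (card_image_le.trans hN)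
      refine ⟨_, col, Proper.of_ident hne hac h1, fun x hx => ?_⟩
      have := h2 _ (mem_image_of_mem _ hx)
      by_cases hxc : x = c
      · simpa [hxc] using this
      · simpa [hxc] using this
    by_cases hA : ∀ r s, ¬ New G v0 v2 r s
    · exact main _ _ _ _ hg hA
    by_cases hB : ∀ r s, ¬ New G v1 v3 r s
    · exact main _ _ _ _ hg.rot hB
    push Not at hA hB
    obtain ⟨x, y, hx, hxy, hy, hx2, hy0⟩ := hA
    obtain ⟨z, w, hz, hzw, hw, hz3, hw1⟩ := hB
    obtain ⟨a01, a12, a23, a30, n02, n13, hC⟩ := hg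
    have T : ∀ a b c, G.Adj a b → G.Adj b c → G.Adj c a → False := fun a b c => no_tri htri
    have n02' : ¬ G.Adj v0 v2 := fun h => T _ _ _ a01 a12 h.symm
    have n13' : ¬ G.Adj v1 v3 := fun h => T _ _ _ a12 a23 h.symm
    refine (hf.toIsDual.crossing ⟨a01, a12, a23, a30, n02, n13, hC⟩ hx hxy hy hz hzw hw
      ?_ ?_ ?_ ?_ ?_ ?_ ?_ ?_ ?_ ?_ ?_ ?_ ?_ ?_ ?_ ?_).elim
    · rintro rfl; exact hx2 a12
    · rintro rfl; exact hx2 a23.symm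
    · rintro rfl; exact hy0 a01.symm
    · rintro rfl; exact hy0 a30
    · rintro rfl; exact hz3 a30.symm
    · rintro rfl; exact hz3 a23
    · rintro rfl; exact hw1 a01
    · rintro rfl; exact hw1 a12.symm
    · rintro rfl; exact T _ _ _ hx hz.symm a01.symm
    · rintro rfl; exact T _ _ _ hx hw a30
    · rintro rfl; exact T _ _ _ hy a12.symm hz
    · rintro rfl; exact T _ _ _ hy a23 hw.symm
    · rintro rfl; exact n02' hx
    · rintro rfl; exact n02' hy
    · rintro rfl; exact n13' hz
    · rintro rfl; exact n13' hw.symm.symm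

/-- A minimal planar graph with at most three triangles that is not colourable. -/
structure MinBad (G : SimpleGraph V) : Prop where
  not_proper : ∀ φ, ¬ Proper G φ
  hasDual : HasDual G
  tri_le : #(tri G) ≤ 3
  exists_proper : ∀ G' : SimpleGraph V, #(supp G') < #(supp G) → HasDual G' → #(tri G') ≤ 3 →
    ∃ φ, Proper G' φ

lemma MinBad.crit (h : MinBad G) : Crit G :=
  ⟨h.not_proper, fun w hw => h.exists_proper _ (card_supp_del_lt hw) (h.hasDual.mono (del_le G w))
    ((card_le_card (tri_mono (del_le G w))).trans h.tri_le)⟩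

lemma MinBad.exists_quadFace (h : MinBad G) {k : ℕ} {f : V → V → Fin k} (hf : IsTight G f) :
    ∃ g a b c d, QuadFace G f g a b c d := by
  by_contra! h4
  have hne : (supp G).Nonempty := by
    by_contra hne
    exact h.not_proper (fun _ => 0) fun u v huv => (hne ⟨u, supp_left huv⟩).elim
  have hcount := hf.count hne h4
  have hS : ¬ ColOn G (supp G) := fun ⟨φ, hφ⟩ => h.not_proper φ fun u v huv =>
    hφ u (supp_left huv) v (supp_right huv) huv
  obtain ⟨W, hW, hWc, hWp⟩ := exists_pot_le_four _ _ _ _ rfl hS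
  have hWS : W = supp G := by
    refine Subset.antisymm hW fun w hw => ?_
    by_contra hwW
    obtain ⟨φ, hφ⟩ := h.crit.exists_del w hw
    exact hWc ⟨φ, fun u hu v hv huv => hφ u v ⟨huv, by rintro rfl; exact hwW hu,
      by rintro rfl; exact hwW hv⟩⟩
  rw [hWS] at hWp
  unfold pot at hWp
  have h2 : 2 ≤ #(supp G) := by
    obtain ⟨u, hu⟩ := hne
    obtain ⟨v, huv⟩ := mem_supp.1 hu
    rw [← card_pair huv.ne]
    exact card_le_card (insert_subset hu (singleton_subset_iff.2 (supp_right huv)))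
  have h3 := h.tri_le
  rcases hcount with h | h | h
  · omega
  · omega
  · omega

lemma MinBad.exists_new (h : MinBad G) (hf : IsTight G f) {g : F} {a b c d : V}
    (hg : QuadFace G f g a b c d) : ∃ r s, New G a c r s := by
  by_contra! hnew
  have hac := h.crit.not_adj_diag hf hg
  have := tri_ident_card (G := G) a c ∅ fun r s h => (hnew r s h).elim
  obtain ⟨φ, hφ⟩ := h.exists_proper _ (card_supp_ident_lt (supp_left hg.1) (supp_right hg.2.1))
    (hg.hasDual_ident hf.toIsDual hac) (by have := h.tri_le; simp at *; omega)
  exact h.not_proper _ (hφ.of_ident hg.2.2.2.2.1 hac)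

end Minimal

section Configurations

lemma two_swap (a b v : V) : two a b v = two b a v := by unfold two; rw [add_comm]

lemma two_add_two (a b c v : V) : two a b v + two b c v + two c a v = 0 := by
  unfold two
  have key : ∀ p q r : ZMod 2, p + q + (q + r) + (r + p) = 0 := by decide
  exact key _ _ _

variable [Fintype V] {F : Type*} {G : SimpleGraph V} {f : V → V → F}

omit [Fintype V] in
lemma face_ne {g g' : F} {p q : V} (h : cob G f (ind g) p q = 1)
    (h' : cob G f (ind g') p q = 0) : g ≠ g' := by
  rintro rfl
  rw [h] at h'
  exact absurd h' (by simp)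

omit [Fintype V] in
lemma adj_of_cob {s : F → ZMod 2} {p q : V} (h : cob G f s p q = 1) : G.Adj p q := by
  by_contra hc
  simp [cob, hc] at h

lemma Crit.two_faces (h : Crit G) (hd : IsDual G f) {g g' : F} {p a b : V} (hab : a ≠ b)
    (hg : ∀ v, cob G f (ind g) p v = two a b v) (hg' : ∀ v, cob G f (ind g') p v = two a b v) :
    g = g' := by
  by_contra hgg
  have h1 : cob G f (ind g) p a = 1 := by rw [hg, two_left hab]
  refine h.two_lt (supp_left (adj_of_cob h1)) a b fun v hv => ?_
  obtain ⟨x, hx, hx1⟩ := h.faces_at hd {g, g'} (g := g) (by simp)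
    (fun v => by rw [sum_pair hgg, hg, hg', z2_add_self]) h1 hv
  rw [mem_insert, mem_singleton] at hx
  rcases hx with rfl | rfl
  · exact two_ne_zero' (by rw [← hg, hx1]; simp)
  · exact two_ne_zero' (by rw [← hg', hx1]; simp)

lemma Crit.three_faces (h : Crit G) (hd : IsDual G f) {g1 g2 g3 : F} {p a b c : V} (hab : a ≠ b)
    (hbc : b ≠ c) (hca : c ≠ a) (h1 : ∀ v, cob G f (ind g1) p v = two a b v)
    (h2 : ∀ v, cob G f (ind g2) p v = two b c v) (h3 : ∀ v, cob G f (ind g3) p v = two c a v)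
    {v : V} (hv : G.Adj p v) : v = a ∨ v = b ∨ v = c := by
  have n12 : g1 ≠ g2 := face_ne ((h1 a).trans (two_left hab)) ((h2 a).trans (two_ne hab hca.symm))
  have n23 : g2 ≠ g3 := face_ne ((h2 b).trans (two_left hbc)) ((h3 b).trans (two_ne hbc hab.symm))
  have n13 : g1 ≠ g3 := face_ne ((h1 b).trans (two_right hab)) ((h3 b).trans (two_ne hbc hab.symm))
  obtain ⟨x, hx, hx1⟩ := h.faces_at hd {g1, g2, g3} (g := g1) (p := p) (q := a) (by simp)
    (fun v => by
      rw [sum_insert (by simp [n12, n13]), sum_pair n23, h1, h2, h3, ← add_assoc, two_add_two])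
    ((h1 a).trans (two_left hab)) hv
  simp only [mem_insert, mem_singleton] at hx
  rcases hx with rfl | rfl | rfl
  · rcases two_ne_zero' (v := v) (by rw [← h1, hx1]; simp) with h | h
    exacts [.inl h, .inr (.inl h)]
  · rcases two_ne_zero' (v := v) (by rw [← h2, hx1]; simp) with h | h
    exacts [.inr (.inl h), .inr (.inr h)]
  · rcases two_ne_zero' (v := v) (by rw [← h3, hx1]; simp) with h | h
    exacts [.inr (.inr h), .inl h]

lemma QuadFace.at {g : F} {a b c d : V} (h : QuadFace G f g a b c d) (v : V) :
    cob G f (ind g) a v = two b d v := by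
  rw [h.2.2.2.2.2.2, cyc4_at h.1.ne h.2.2.2.2.1 h.2.2.2.1.ne']

lemma four_tri (h : #(tri G) ≤ 3) {S T U W : Finset V} (hS : S ∈ tri G) (hT : T ∈ tri G)
    (hU : U ∈ tri G) (hW : W ∈ tri G) (h1 : S ≠ T) (h2 : S ≠ U) (h3 : S ≠ W) (h4 : T ≠ U)
    (h5 : T ≠ W) (h6 : U ≠ W) : False := by
  have : #({S, T, U, W} : Finset (Finset V)) = 4 := by
    rw [card_insert_of_notMem (by simp [h1, h2, h3]), card_insert_of_notMem (by simp [h4, h5]),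
      card_pair h6]
  have h7 : ({S, T, U, W} : Finset (Finset V)) ⊆ tri G := by
    intro x hx
    simp only [mem_insert, mem_singleton] at hx
    rcases hx with rfl | rfl | rfl | rfl <;> assumption
  have := card_le_card h7
  omega

/-- The configuration left over by the crossing argument at a quadrilateral face. -/
structure Cfg (G : SimpleGraph V) (f : V → V → F) (g : F) (v0 v1 v2 v3 x y w : V) : Prop where
  face : QuadFace G f g v0 v1 v2 v3
  x0 : G.Adj x v0
  x1 : G.Adj x v1
  xy : G.Adj x y
  y2 : G.Adj y v2
  xw : G.Adj x w
  w3 : G.Adj w v3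
  nx2 : ¬ G.Adj x v2
  nx3 : ¬ G.Adj x v3
  ny0 : ¬ G.Adj y v0
  nw1 : ¬ G.Adj w v1

lemma Cfg.symm {g : F} {v0 v1 v2 v3 x y w : V} (h : Cfg G f g v0 v1 v2 v3 x y w) :
    Cfg G f g v1 v0 v3 v2 x w y :=
  ⟨h.face.flip.rot.rot.rot, h.x1, h.x0, h.xw, h.w3, h.xy, h.y2, h.nx3, h.nx2, h.nw1, h.ny0⟩

lemma MinBad.exists_cfg (h : MinBad G) {k : ℕ} {f : V → V → Fin k} (hf : IsTight G f) :
    ∃ g v0 v1 v2 v3 x y w, Cfg G f g v0 v1 v2 v3 x y w := by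
  obtain ⟨g, v0, v1, v2, v3, hg⟩ := h.exists_quadFace hf
  obtain ⟨x, y, hx, hxy, hy, hx2, hy0⟩ := h.exists_new hf hg
  obtain ⟨z, w, hz, hzw, hw, hz3, hw1⟩ := h.exists_new hf hg.rot
  by_cases e1 : x = z
  · subst e1
    exact ⟨g, v0, v1, v2, v3, x, y, w, hg, hx.symm, hz.symm, hxy, hy, hzw, hw, hx2, hz3, hy0, hw1⟩
  by_cases e2 : x = w
  · subst e2
    exact ⟨g, v0, v3, v2, v1, x, y, z, hg.flip, hx.symm, hw, hxy, hy, hzw.symm, hz.symm, hx2, hw1,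
      hy0, hz3⟩
  by_cases e3 : y = z
  · subst e3
    exact ⟨g, v2, v1, v0, v3, y, x, w, hg.flip.rot.rot, hy, hz.symm, hxy.symm, hx.symm, hzw, hw,
      hy0, hz3, hx2, hw1⟩
  by_cases e4 : y = w
  · subst e4
    exact ⟨g, v2, v3, v0, v1, y, x, z, hg.rot.rot, hy, hw, hxy.symm, hx.symm, hzw.symm, hz.symm,
      hy0, hw1, hx2, hz3⟩
  have n02 := h.crit.not_adj_diag hf hg
  have n13 := h.crit.not_adj_diag hf hg.rot
  obtain ⟨a01, a12, a23, a30, -⟩ := id hg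
  refine (hf.toIsDual.crossing hg hx hxy hy hz hzw hw
    ?_ ?_ ?_ ?_ ?_ ?_ ?_ ?_ e1 e2 e3 e4 ?_ ?_ ?_ ?_).elim
  · rintro rfl; exact hx2 a12
  · rintro rfl; exact hx2 a23.symm
  · rintro rfl; exact hy0 a01.symm
  · rintro rfl; exact hy0 a30
  · rintro rfl; exact hz3 a30.symm
  · rintro rfl; exact hz3 a23
  · rintro rfl; exact hw1 a01
  · rintro rfl; exact hw1 a12.symm
  · rintro rfl; exact n02 hx
  · rintro rfl; exact n02 hy
  · rintro rfl; exact n13 hz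
  · rintro rfl; exact n13 hw

lemma MinBad.exists_second (h : MinBad G) (hf : IsTight G f) {g B : F} {a b c d x w : V}
    (hg : QuadFace G f g a b c d) (hB : QuadFace G f B x a d w) (hxb : G.Adj x b)
    (ha : ∀ v, G.Adj a v → v = b ∨ v = d ∨ v = x) (hd : ∀ v, G.Adj d v → v = a ∨ v = c ∨ v = w) :
    ∃ p, p ≠ a ∧ p ≠ b ∧ G.Adj x p ∧ G.Adj p c ∧ ¬ G.Adj p d := by
  by_contra! hp
  have hxd := h.crit.not_adj_diag hf hB
  have hne := hB.2.2.2.2.1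
  have hxa := hB.1
  have hdel : ¬ (del G a).Adj x d := fun h => hxd h.1
  have hwa : w ≠ a := hB.2.2.2.2.2.1.symm
  have hnew : ∀ r s, New (del G a) x d r s → (r, s) ∈ ({(b, c)} : Finset (V × V)) := by
    rintro r s ⟨h1, h2, h3, h4, h5⟩
    have hs : s = c := by
      rcases hd s h3.1.symm with rfl | rfl | rfl
      · exact absurd rfl h3.2.1
      · rfl
      · exact absurd ⟨hB.2.2.2.1, hwa, hxa.ne⟩ h5
    subst hs
    have hr : r = b := by
      by_contra hrb
      exact h4 ⟨hp r h1.2.2 hrb h1.1 h2.1, h1.2.2, h3.2.2⟩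
    rw [hr]; simp
  have hT : {x, a, b} ∈ tri G := tri_mem hxa hg.1 hxb.symm
  have h2 : #(tri (del G a)) ≤ 2 := by
    have h1 : tri (del G a) ⊂ tri G := by
      refine ⟨tri_mono (del_le G a), fun hsub => ?_⟩
      have := hsub hT
      rcases tri_cases this a with h | ⟨y, z, -, h, -⟩
      · simp at h
      · exact h.2.1 rfl
    have := card_lt_card h1
    have := h.tri_le
    omega
  have h3 := tri_ident_card (G := del G a) x d _ hnew
  rw [card_singleton] at h3
  have hle : ident (del G a) x d ≤ ident G x d := by
    rintro u v ⟨h1, h2, h3, h4⟩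
    refine ⟨h1, h2, h3, ?_⟩
    rcases h4 with h4 | h4 | h4
    exacts [.inl h4.1, .inr (.inl ⟨h4.1, h4.2.1⟩), .inr (.inr ⟨h4.1, h4.2.1⟩)]
  obtain ⟨φ, hφ⟩ := h.exists_proper (ident (del G a) x d)
    ((card_le_card (supp_mono hle)).trans_lt (card_supp_ident_lt (supp_left hxa)
      (supp_left hg.2.2.2.1)))
    ((hB.hasDual_ident hf.toIsDual hxd).mono hle) (by omega)
  have hφ' := hφ.of_ident hne hdel
  set ψ : V → Fin 3 := fun v => if v = d then φ x else φ v with hψ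
  have hxd' : ψ x = ψ d := by simp [hψ]
  obtain ⟨col, hc⟩ := KYMin.exists_avoid {ψ b, ψ x} card_le_two
  rw [mem_insert, mem_singleton, not_or] at hc
  have hcol : ∀ v, G.Adj a v → col ≠ ψ v := by
    intro v hv
    rcases ha v hv with rfl | rfl | rfl
    exacts [hc.1, hxd' ▸ hc.2, hc.2]
  refine h.not_proper (Function.update ψ a col) fun u v huv => ?_
  by_cases hu : u = a
  · subst hu
    rw [Function.update_self, Function.update_of_ne huv.ne']
    exact hcol v huv
  · by_cases hv : v = a
    · subst hv
      rw [Function.update_self, Function.update_of_ne huv.ne]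
      exact (hcol u huv.symm).symm
    · rw [Function.update_of_ne hu, Function.update_of_ne hv]
      exact hφ' u v ⟨huv, hu, hv⟩

lemma ne_of_notMem {S T : Finset V} {a : V} (h1 : a ∈ S) (h2 : a ∉ T) : S ≠ T := by
  rintro rfl; exact h2 h1

/-- A quadrilateral face next to the triangle of the configuration is impossible. -/
theorem MinBad.no_quad (h : MinBad G) (hf : IsTight G f) {g B : F} {v0 v1 v2 v3 x y w : V}
    (hc : Cfg G f g v0 v1 v2 v3 x y w) (hB : QuadFace G f B x v0 v3 w) : False := by
  obtain ⟨hg, x0, x1, xy, y2, xw, w3, nx2, nx3, ny0, nw1⟩ := hc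
  obtain ⟨a01, a12, a23, a30, d02, d13, -⟩ := id hg
  have n02 := h.crit.not_adj_diag hf hg
  have n13 := h.crit.not_adj_diag hf hg.rot
  have n0w := h.crit.not_adj_diag hf hB.rot
  have x2 : x ≠ v2 := by rintro rfl; exact n02 x0.symm
  have x3 : x ≠ v3 := by rintro rfl; exact n13 x1.symm
  have y0 : y ≠ v0 := by rintro rfl; exact n02 y2
  have y1 : y ≠ v1 := by rintro rfl; exact ny0 a01.symm
  have y3 : y ≠ v3 := by rintro rfl; exact ny0 a30
  have w0 : w ≠ v0 := by rintro rfl; exact nw1 a01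
  have w1 : w ≠ v1 := by rintro rfl; exact n13 w3
  have w2 : w ≠ v2 := by rintro rfl; exact nx2 xw
  obtain ⟨t, ht⟩ := h.crit.triFace hf x0 a01 x1.symm
  have nb0 : ∀ v, G.Adj v0 v → v = v1 ∨ v = v3 ∨ v = x := fun v hv =>
    h.crit.three_faces hf.toIsDual d13 x3.symm x1.ne hg.at (fun v => hB.rot.at v)
      (fun v => by rw [ht, cyc3_rot, cyc3_at a01.ne x0.ne', two_swap]) hv
  obtain ⟨r, q, h1, h2, h3, h4, h5⟩ := h.exists_new hf hB.rot
  have hr : r = v1 := by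
    rcases nb0 r h1 with rfl | rfl | rfl
    · rfl
    · exact absurd w3.symm h4
    · exact absurd xw h4
  subst hr
  have T1 : {x, v0, r} ∈ tri G := tri_mem x0 a01 x1.symm
  have w2' : G.Adj w v2 := by
    by_contra nw2
    have q2 : q ≠ v2 := by rintro rfl; exact nw2 h3.symm
    have q0 : q ≠ v0 := by rintro rfl; exact n0w h3
    have q3 : q ≠ v3 := by rintro rfl; exact n13 h2
    have qx : q ≠ x := by rintro rfl; exact h5 x0
    have yw : y ≠ w := by rintro rfl; exact nw2 y2
    by_cases hyq : y = q
    · subst hyq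
      refine four_tri h.tri_le T1 (tri_mem xy h2.symm x1.symm) (tri_mem h2 y2 a12.symm)
        (tri_mem xy h3 xw.symm) ?_ ?_ ?_ ?_ ?_ ?_
      · exact ne_of_notMem (a := v0) (by simp) (by simp [x0.ne', q0.symm, a01.ne])
      · exact ne_of_notMem (a := v0) (by simp) (by simp [a01.ne, q0.symm, d02])
      · exact ne_of_notMem (a := v0) (by simp) (by simp [x0.ne', q0.symm, w0.symm])
      · exact ne_of_notMem (a := x) (by simp) (by simp [x1.ne, qx.symm, x2])
      · exact ne_of_notMem (a := r) (by simp) (by simp [x1.ne', h2.ne, w1.symm])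
      · exact ne_of_notMem (a := r) (by simp) (by simp [x1.ne', h2.ne, w1.symm])
    · exact hf.toIsDual.crossing hg x0.symm xy y2 h2 h3 w3 x1.ne x3 y1 y3 q0 q2 w0 w2 qx.symm
        xw.ne hyq yw x2 y0 q3 w1
  obtain ⟨t', ht'⟩ := h.crit.triFace hf a23 w3.symm w2'
  have T2 : {v2, v3, w} ∈ tri G := tri_mem a23 w3.symm w2'
  have nb3 : ∀ v, G.Adj v3 v → v = v0 ∨ v = v2 ∨ v = w := fun v hv =>
    h.crit.three_faces hf.toIsDual d02 w2.symm w0 (fun v => hg.rot.rot.rot.at v)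
      (fun v => by rw [ht', cyc3_rot, cyc3_at w3.ne' a23.ne', two_swap])
      (fun v => hB.rot.rot.at v) hv
  obtain ⟨p, p0, p1, hxp, hp2, hp3⟩ := h.exists_second hf hg hB x1 nb0 nb3
  obtain ⟨p', q3, q2, hwq, hq1, hq0⟩ := h.exists_second hf hg.flip.rot hB.flip.rot w2'
    (fun v hv => by have := nb3 v hv; tauto) (fun v hv => by have := nb0 v hv; tauto)
  have p3 : p ≠ v3 := by rintro rfl; exact nx3 hxp
  have q0 : p' ≠ v0 := by rintro rfl; exact n0w hwq.symm
  have qx : p' ≠ x := by rintro rfl; exact hq0 x0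
  have pw : p ≠ w := by rintro rfl; exact hp3 w3
  by_cases hpq : p = p'
  · subst hpq
    refine four_tri h.tri_le T1 T2 (tri_mem hxp hq1 x1.symm) (tri_mem hq1.symm hp2 a12.symm)
      ?_ ?_ ?_ ?_ ?_ ?_
    · exact ne_of_notMem (a := x) (by simp) (by simp [x2, x3, xw.ne])
    · exact ne_of_notMem (a := v0) (by simp) (by simp [x0.ne', p0.symm, a01.ne])
    · exact ne_of_notMem (a := v0) (by simp) (by simp [d02, p0.symm, a01.ne])
    · exact ne_of_notMem (a := v2) (by simp) (by simp [x2.symm, q2.symm, a12.ne'])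
    · exact ne_of_notMem (a := v3) (by simp) (by simp [d13.symm, q3.symm, a23.ne'])
    · exact ne_of_notMem (a := x) (by simp) (by simp [x1.ne, hxp.ne, x2])
  · exact hf.toIsDual.crossing hg x0.symm hxp hp2 hq1.symm hwq.symm w3 x1.ne x3 p1 p3 q0 q2 w0 w2
      qx.symm xw.ne hpq pw x2 p0 q3 w1

end Configurations

section Pentagon

variable [Fintype V] {F : Type*} {G : SimpleGraph V} {f : V → V → F}

omit [Fintype V] in
lemma ne_cyc3 {C : V → V → ZMod 2} {K : Finset V} (hK : 4 ≤ #K)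
    (h : ∀ u ∈ K, ∃ v, C u v = 1) (p q r : V) : C ≠ cyc3 p q r := by
  rintro rfl
  have : K ⊆ {p, q, r} := fun u hu => by
    obtain ⟨v, hv⟩ := h u hu
    by_contra hc
    simp only [mem_insert, mem_singleton, not_or] at hc
    rw [cyc3_out hc.1 hc.2.1 hc.2.2] at hv
    exact absurd hv (by simp)
  have h1 := card_le_card this
  have h2 : #({p, q, r} : Finset V) ≤ 3 := card_le_three
  omega

lemma Crit.reg_of_inner (h : Crit G) (hd : IsDual G f) {s : F → ZMod 2} {u v : V}
    (hu : u ∈ supp (reg G f s)) (hs : ∀ v, cob G f s u v = 0) (huv : G.Adj u v) :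
    (reg G f s).Adj u v ∧ s (f u v) = 1 := by
  obtain ⟨w, hw⟩ := mem_supp.1 hu
  have h1 : s (f u w) = 1 := by
    rcases hw.2 with h1 | h1
    · exact h1
    · rw [eq_of_cob hw.1 (hs w), h1]
  have h2 := (h.rotate hd hs huv hw.1).trans h1
  exact ⟨⟨huv, .inl h2⟩, h2⟩

lemma Crit.glue (h : Crit G) (hd : IsDual G f) {s : F → ZMod 2} {K : Finset V}
    (hK : ∀ u, u ∉ K → ∀ v, cob G f s u v = 0) {φ χ : V → Fin 3} (hφ : Proper (reg G f s) φ)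
    {w : V} (hwK : w ∉ K) (hw : w ∈ supp (reg G f s)) (hχ : Proper (del G w) χ)
    (hφχ : ∀ x ∈ K, ∀ y ∈ K, χ x = χ y ↔ φ x = φ y) : False := by
  obtain ⟨σ, hσ⟩ := exists_perm χ φ K hφχ
  have key : ∀ u v, G.Adj u v → (u ∉ K ∧ u ∈ supp (reg G f s)) →
      φ u ≠ φ v ∧ (v ∈ K ∨ v ∈ supp (reg G f s)) := by
    intro u v huv hu
    have := (h.reg_of_inner hd hu.2 (hK u hu.1) huv).1
    exact ⟨hφ u v this, .inr (supp_right this)⟩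
  refine h.not_proper (fun u => if u ∈ K ∨ u ∈ supp (reg G f s) ∧ u ∉ K then φ u else σ (χ u))
    fun u v huv => ?_
  by_cases hu : u ∉ K ∧ u ∈ supp (reg G f s)
  · have := key u v huv hu
    have hv : v ∈ K ∨ v ∈ supp (reg G f s) ∧ v ∉ K := by tauto
    simp only [if_pos hv, if_pos (Or.inr hu.symm : u ∈ K ∨ u ∈ supp (reg G f s) ∧ u ∉ K)]
    exact this.1
  by_cases hv : v ∉ K ∧ v ∈ supp (reg G f s)
  · have := key v u huv.symm hv
    have hu : u ∈ K ∨ u ∈ supp (reg G f s) ∧ u ∉ K := by tauto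
    simp only [if_pos hu, if_pos (Or.inr hv.symm : v ∈ K ∨ v ∈ supp (reg G f s) ∧ v ∉ K)]
    exact this.1.symm
  have e : ∀ u, ¬ (u ∉ K ∧ u ∈ supp (reg G f s)) →
      (if u ∈ K ∨ u ∈ supp (reg G f s) ∧ u ∉ K then φ u else σ (χ u)) = σ (χ u) := by
    intro u hu
    split_ifs with h1
    · rw [hσ u (by tauto)]
    · rfl
  beta_reduce
  rw [e u hu, e v hv]
  refine σ.injective.ne (hχ u v ⟨huv, ?_, ?_⟩)
  · rintro rfl; exact hu ⟨hwK, hw⟩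
  · rintro rfl; exact hv ⟨hwK, hw⟩

/-- If a region has no inner vertices and no inner edges between boundary vertices, it is a
face. -/
lemma IsTight.region_eq_ind (h : IsTight G f) {s : F → ZMod 2} (hs : MinCyc G (cob G f s))
    {K : Finset V} (hK : ∀ u, u ∉ K → u ∉ supp (reg G f s))
    (hch : ∀ u ∈ K, ∀ v ∈ K, (reg G f s).Adj u v → cob G f s u v = 1) : ∃ g, s = ind g := by
  refine h.eq_ind hs rfl fun u v huv h1 h2 => ?_
  have hr : (reg G f s).Adj u v := ⟨huv, .inl h1⟩
  have := hch u (by by_contra hc; exact hK u hc (supp_left hr)) v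
    (by by_contra hc; exact hK v hc (supp_right hr)) hr
  rw [cob_adj huv, h1, h2] at this
  exact absurd this (by decide)

lemma Crit.pentagon_glue (h : Crit G) (hd : IsTight G f) {s : F → ZMod 2}
    (hmin : MinCyc G (cob G f s)) (htri : tri (reg G f s) = ∅) {a b c d e : V}
    (e1 : cob G f s a b = 1) (e2 : cob G f s b c = 1) (e3 : cob G f s c d = 1)
    (e4 : cob G f s d e = 1) (e5 : cob G f s e a = 1)
    (hout : ∀ u, u ∉ ({a, b, c, d, e} : Finset V) → ∀ v, cob G f s u v = 0) {w : V}
    (hwK : w ∉ ({a, b, c, d, e} : Finset V)) (hw : w ∈ supp (reg G f s)) {χ : V → Fin 3}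
    (hχ : Proper (del G w) χ) (hac : χ a = χ c) (hbd : χ b = χ d) : False := by
  have hdual : HasDual (reg G f s) := (hd.isDual_reg hmin).hasDual
  obtain ⟨φ, col, hφ, hcol⟩ := exists_coloring_avoiding _ (reg G f s) {a, b, c, d} rfl hdual
    htri card_le_four
  have f1 := hφ a b (reg_adj e1)
  have f2 := hφ b c (reg_adj e2)
  have f3 := hφ c d (reg_adj e3)
  have f4 := hφ d e (reg_adj e4)
  have f5 := hφ e a (reg_adj e5)
  have c1 := hcol a (by simp)
  have c2 := hcol b (by simp)
  have c3 := hcol c (by simp)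
  have c4 := hcol d (by simp)
  have hw' := hwK
  simp only [mem_insert, mem_singleton, not_or] at hw'
  obtain ⟨wa, wb, wc, wd, we⟩ := hw'
  have g1 := hχ a b ⟨adj_of_cob e1, Ne.symm wa, Ne.symm wb⟩
  have g4 := hχ d e ⟨adj_of_cob e4, Ne.symm wd, Ne.symm we⟩
  have g5 := hχ e a ⟨adj_of_cob e5, Ne.symm we, Ne.symm wa⟩
  have two : ∀ p q r s : Fin 3, p ≠ q → q ≠ r → p ≠ s → q ≠ s → r ≠ s → p = r := by decide
  have h1 : φ a = φ c := two _ _ _ _ f1 f2 c1 c2 c3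
  have h2 : φ b = φ d := two _ _ _ _ f2 f3 c2 c3 c4
  refine h.glue hd.toIsDual hout hφ hwK hw hχ ?_
  have q1 : φ a ≠ φ b := f1
  have q2 : φ b ≠ φ e := h2 ▸ f4
  have q4 : χ b ≠ χ e := hbd ▸ g4
  simp only [mem_insert, mem_singleton]
  rintro x (rfl | rfl | rfl | rfl | rfl) y (rfl | rfl | rfl | rfl | rfl) <;>
    simp only [← hac, ← hbd, ← h1, ← h2, g1, g1.symm, g5, g5.symm, q1, q1.symm, q2, q2.symm, f5,
      f5.symm, q4, q4.symm]

omit [Fintype V] in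
lemma rot_five (a b c d e : V) : ({b, c, d, e, a} : Finset V) = {a, b, c, d, e} := by
  ext x
  simp only [mem_insert, mem_singleton]
  constructor <;> rintro (h | h | h | h | h) <;> simp [h]

/-- A triangle-free region bounded by a pentagon is a face. -/
theorem Crit.pentagon_face (h : Crit G) (hd : IsTight G f) {s : F → ZMod 2} {a b c d e : V}
    (hmin : MinCyc G (cob G f s)) (hs : cob G f s = cyc5 a b c d e)
    (n : [a, b, c, d, e].Nodup) (htri : tri (reg G f s) = ∅) : ∃ g, s = ind g := by
  simp only [List.nodup_cons, List.mem_cons, List.not_mem_nil, or_false, not_or] at n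
  obtain ⟨⟨ab, ac, ad, ae⟩, ⟨bc, bd, be⟩, ⟨cd, ce⟩, de, -⟩ := n
  have e1 : cob G f s a b = 1 := by rw [hs, cyc5_at ab ac ad ae, two_left be]
  have e2 : cob G f s b c = 1 := by
    rw [hs, cyc5_rot, cyc5_at bc bd be (Ne.symm ab), two_left (Ne.symm ac)]
  have e3 : cob G f s c d = 1 := by
    rw [hs, cyc5_rot, cyc5_rot, cyc5_at cd ce (Ne.symm ac) (Ne.symm bc), two_left (Ne.symm bd)]
  have e4 : cob G f s d e = 1 := by
    rw [hs, cyc5_rot, cyc5_rot, cyc5_rot, cyc5_at de (Ne.symm ad) (Ne.symm bd) (Ne.symm cd),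
      two_left (Ne.symm ce)]
  have e5 : cob G f s e a = 1 := by
    rw [hs, cyc5_rot, cyc5_rot, cyc5_rot, cyc5_rot,
      cyc5_at (Ne.symm ae) (Ne.symm be) (Ne.symm ce) (Ne.symm de), two_left ad]
  have hout : ∀ u, u ∉ ({a, b, c, d, e} : Finset V) → ∀ v, cob G f s u v = 0 := by
    intro u hu v
    simp only [mem_insert, mem_singleton, not_or] at hu
    rw [hs, cyc5_out hu.1 hu.2.1 hu.2.2.1 hu.2.2.2.1 hu.2.2.2.2]
  refine hd.region_eq_ind hmin (K := {a, b, c, d, e}) (fun w hwK hw => ?_) ?_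
  · obtain ⟨χ, hχ⟩ := h.exists_del w (supp_mono (reg_le s) hw)
    have hw' := hwK
    simp only [mem_insert, mem_singleton, not_or] at hw'
    obtain ⟨wa, wb, wc, wd, we⟩ := hw'
    have g1 := hχ a b ⟨adj_of_cob e1, Ne.symm wa, Ne.symm wb⟩
    have g2 := hχ b c ⟨adj_of_cob e2, Ne.symm wb, Ne.symm wc⟩
    have g3 := hχ c d ⟨adj_of_cob e3, Ne.symm wc, Ne.symm wd⟩
    have g4 := hχ d e ⟨adj_of_cob e4, Ne.symm wd, Ne.symm we⟩
    have g5 := hχ e a ⟨adj_of_cob e5, Ne.symm we, Ne.symm wa⟩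
    have hcases : ∀ a b c d e : Fin 3, a ≠ b → b ≠ c → c ≠ d → d ≠ e → e ≠ a →
        (a = c ∧ b = d) ∨ (b = d ∧ c = e) ∨ (c = e ∧ d = a) ∨ (d = a ∧ e = b) ∨
        (e = b ∧ a = c) := by decide
    have r1 := rot_five a b c d e
    have r2 := (rot_five b c d e a).trans r1
    have r3 := (rot_five c d e a b).trans r2
    have r4 := (rot_five d e a b c).trans r3
    rcases hcases _ _ _ _ _ g1 g2 g3 g4 g5 with ⟨p, q⟩ | ⟨p, q⟩ | ⟨p, q⟩ | ⟨p, q⟩ | ⟨p, q⟩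
    · exact h.pentagon_glue hd hmin htri e1 e2 e3 e4 e5 hout hwK hw hχ p q
    · exact h.pentagon_glue hd hmin htri e2 e3 e4 e5 e1 (r1 ▸ hout) (r1 ▸ hwK) hw hχ p q
    · exact h.pentagon_glue hd hmin htri e3 e4 e5 e1 e2 (r2 ▸ hout) (r2 ▸ hwK) hw hχ p q
    · exact h.pentagon_glue hd hmin htri e4 e5 e1 e2 e3 (r3 ▸ hout) (r3 ▸ hwK) hw hχ p q
    · exact h.pentagon_glue hd hmin htri e5 e1 e2 e3 e4 (r4 ▸ hout) (r4 ▸ hwK) hw hχ p q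
  · have a1 := reg_adj e1
    have a2 := reg_adj e2
    have a3 := reg_adj e3
    have a4 := reg_adj e4
    have a5 := reg_adj e5
    have t1 : ¬ (reg G f s).Adj a c := fun h => no_tri htri a1 a2 h.symm
    have t2 : ¬ (reg G f s).Adj b d := fun h => no_tri htri a2 a3 h.symm
    have t3 : ¬ (reg G f s).Adj c e := fun h => no_tri htri a3 a4 h.symm
    have t4 : ¬ (reg G f s).Adj d a := fun h => no_tri htri a4 a5 h.symm
    have t5 : ¬ (reg G f s).Adj e b := fun h => no_tri htri a5 a1 h.symm
    have sy : ∀ u v, cob G f s u v = 1 → cob G f s v u = 1 := fun u v h => by rwa [cob_symm]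
    simp only [mem_insert, mem_singleton]
    rintro x (rfl | rfl | rfl | rfl | rfl) y (rfl | rfl | rfl | rfl | rfl) hxy
    all_goals first | exact absurd rfl hxy.ne | assumption | exact sy _ _ (by assumption) |
      exact absurd hxy (by assumption) | exact absurd hxy.symm (by assumption)

end Pentagon

section Disks

variable [Fintype V] {F : Type*} {G : SimpleGraph V} {f : V → V → F}

/-- A region bounded by a quadrilateral, with some vertex strictly outside. -/
structure Disk (G : SimpleGraph V) (f : V → V → F) (s : F → ZMod 2) (a b c d : V) : Prop where
  ab : G.Adj a b
  bc : G.Adj b c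
  cd : G.Adj c d
  da : G.Adj d a
  ac : a ≠ c
  bd : b ≠ d
  cob_eq : cob G f s = cyc4 a b c d
  out : ∃ w ∈ supp G, w ∉ supp (reg G f s)

variable {s : F → ZMod 2} {a b c d : V}

lemma Disk.rot (h : Disk G f s a b c d) : Disk G f s b c d a :=
  ⟨h.bc, h.cd, h.da, h.ab, h.bd, h.ac.symm, by rw [h.cob_eq, cyc4_rot], h.out⟩

lemma Disk.at (h : Disk G f s a b c d) (v : V) : cob G f s a v = two b d v := by
  rw [h.cob_eq, cyc4_at h.ab.ne h.ac h.da.ne']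

lemma Disk.edge (h : Disk G f s a b c d) : cob G f s a b = 1 :=
  (h.at b).trans (two_left h.bd)

lemma Disk.minCyc (h : Disk G f s a b c d) : MinCyc G (cob G f s) := by
  rw [h.cob_eq]; exact minCyc_cyc4 h.ab h.bc h.cd h.da h.ac h.bd

lemma Disk.vanish (h : Disk G f s a b c d) {u : V} (hu : u ∉ ({a, b, c, d} : Finset V)) (v : V) :
    cob G f s u v = 0 := by
  simp only [mem_insert, mem_singleton, not_or] at hu
  rw [h.cob_eq, cyc4_out hu.1 hu.2.1 hu.2.2.1 hu.2.2.2]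

lemma Disk.ne_cyc3 (h : Disk G f s a b c d) (p q r : V) :
    cob G f s ≠ cyc3 p q r := by
  refine ThreeTriangles.ne_cyc3 (K := {a, b, c, d}) ?_ ?_ p q r
  · rw [card_insert_of_notMem (by simp [h.ab.ne, h.ac, h.da.ne']),
      card_insert_of_notMem (by simp [h.bc.ne, h.bd]), card_pair h.cd.ne]
  · simp only [mem_insert, mem_singleton]
    rintro u (rfl | rfl | rfl | rfl)
    exacts [⟨_, h.edge⟩, ⟨_, h.rot.edge⟩, ⟨_, h.rot.rot.edge⟩, ⟨_, h.rot.rot.rot.edge⟩]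

lemma tri_sup_edge (hac : a ≠ c)
    (hcom : ∀ p, (reg G f s).Adj a p → (reg G f s).Adj p c → p = b ∨ p = d) :
    tri (reg G f s ⊔ SimpleGraph.edge a c) ⊆ tri (reg G f s) ∪ {{a, c, b}, {a, c, d}} := by
  intro T hT
  rw [mem_tri, SimpleGraph.is3Clique_iff] at hT
  obtain ⟨x, y, z, hxy, hxz, hyz, rfl⟩ := hT
  have key : ∀ u v, (reg G f s ⊔ SimpleGraph.edge a c).Adj u v →
      (reg G f s).Adj u v ∨ (u = a ∧ v = c) ∨ (u = c ∧ v = a) := by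
    intro u v h
    rw [SimpleGraph.sup_adj, SimpleGraph.edge_adj] at h
    rcases h with h | ⟨⟨h1, h2⟩ | ⟨h1, h2⟩, -⟩
    exacts [.inl h, .inr (.inl ⟨h1, h2⟩), .inr (.inr ⟨h1, h2⟩)]
  have key2 : ∀ w, (reg G f s ⊔ SimpleGraph.edge a c).Adj a w →
      (reg G f s ⊔ SimpleGraph.edge a c).Adj w c → w = b ∨ w = d := by
    intro w h1 h2
    rcases key a w h1 with k1 | ⟨-, k1⟩ | ⟨k1, -⟩
    · rcases key w c h2 with k2 | ⟨k2, -⟩ | ⟨-, k2⟩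
      · exact hcom w k1 k2
      · exact absurd k2.symm h1.ne
      · exact absurd k2.symm hac
    · exact absurd k1 h2.ne
    · exact absurd k1 hac
  have fin : ∀ w, w = b ∨ w = d → ({a, c, w} : Finset V) ∈
      tri (reg G f s) ∪ {{a, c, b}, {a, c, d}} := by
    rintro w (rfl | rfl) <;> simp
  have p1 : ∀ u v w : V, ({u, v, w} : Finset V) = {v, u, w} := fun u v w => insert_comm _ _ _
  have p2 : ∀ u v w : V, ({u, v, w} : Finset V) = {u, w, v} := fun u v w => by
    rw [pair_comm]
  rcases key x y hxy with h1 | ⟨rfl, rfl⟩ | ⟨rfl, rfl⟩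
  · rcases key x z hxz with h2 | ⟨rfl, rfl⟩ | ⟨rfl, rfl⟩
    · rcases key y z hyz with h3 | ⟨rfl, rfl⟩ | ⟨rfl, rfl⟩
      · exact mem_union_left _ (tri_mem h1 h3 h2.symm)
      · rw [p1 x y z, p2 y x z]; exact fin x (key2 x hxy.symm hxz)
      · rw [p1 x y z, p2 y x z, p1 y z x]; exact fin x (key2 x hxz.symm hxy)
    · rw [p2 x y z]; exact fin y (key2 y hxy hyz)
    · rw [p2 x y z, p1 x z y]; exact fin y (key2 y hyz.symm hxy.symm)
  · exact fin z (key2 z hxz hyz.symm)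
  · rw [p1 x y z]; exact fin z (key2 z hyz hxz.symm)

lemma Disk.exists_coloring_ne (hd : Disk G f s a b c d) (h : MinBad G) (hf : IsTight G f)
    (ht : #(tri (reg G f s)) ≤ 1) (hac : ¬ (reg G f s).Adj a c)
    (hcom : ∀ p, (reg G f s).Adj a p → (reg G f s).Adj p c → p = b ∨ p = d) :
    ∃ φ, Proper (reg G f s) φ ∧ φ a ≠ φ c := by
  have h1 := (hf.isDual_reg hd.minCyc).addEdge ((cob_reg_none s).trans hd.cob_eq) (reg_adj hd.edge)
    (reg_adj hd.rot.edge) hd.ac hac hd.bd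
  have hsub : supp (reg G f s ⊔ SimpleGraph.edge a c) ⊆ supp (reg G f s) := by
    intro u hu
    obtain ⟨v, hv⟩ := mem_supp.1 hu
    rw [SimpleGraph.sup_adj, SimpleGraph.edge_adj] at hv
    rcases hv with hv | ⟨⟨rfl, -⟩ | ⟨rfl, -⟩, -⟩
    exacts [supp_left hv, supp_left (reg_adj hd.edge), supp_right (reg_adj hd.rot.edge)]
  have hlt : #(supp (reg G f s ⊔ SimpleGraph.edge a c)) < #(supp G) := by
    obtain ⟨w, hw, hw'⟩ := hd.out
    exact card_lt_card ⟨hsub.trans (supp_mono (reg_le s)), fun h => hw' (hsub (h hw))⟩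
  obtain ⟨φ, hφ⟩ := h.exists_proper _ hlt h1 (by
    have h2 := card_le_card (tri_sup_edge hd.ac hcom)
    have h3 := card_union_le (tri (reg G f s)) {{a, c, b}, {a, c, d}}
    have h4 : #({{a, c, b}, {a, c, d}} : Finset (Finset V)) ≤ 2 := card_le_two
    omega)
  refine ⟨φ, hφ.mono le_sup_left, hφ a c ?_⟩
  rw [SimpleGraph.sup_adj, SimpleGraph.edge_adj]
  exact .inr ⟨.inl ⟨rfl, rfl⟩, hd.ac⟩

lemma reg_mono {t : F → ZMod 2} (h : ∀ x, t x = 1 → s x = 1) : reg G f t ≤ reg G f s :=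
  fun _ _ h1 => ⟨h1.1, h1.2.imp (h _) (h _)⟩

/-- A path through a disk between opposite corners splits it. -/
lemma Disk.split (hd : Disk G f s a b c d) (hf : IsTight G f) {p : V} (hpb : p ≠ b) (hpd : p ≠ d)
    (h1 : (reg G f s).Adj a p) (h2 : (reg G f s).Adj p c) :
    ∃ t, (∀ x, t x = 1 → s x = 1) ∧ Disk G f t a b c p ∧ Disk G f (s + t) a p c d := by
  obtain ⟨t, ht⟩ := hf.exact _ (isEven_cyc4 hd.ab hd.bc h2.1.symm h1.1.symm)
  obtain ⟨e, he⟩ := hf.nest hd.minCyc (t := t) (by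
    intro u v huv k1 k2
    by_contra hc
    rw [← ht] at hc
    have e1 := hd.edge
    have e2 := hd.rot.edge
    rw [cob_adj hd.ab] at e1
    rw [cob_adj hd.bc] at e2
    have e3 := h1.2
    have e4 := h2.2
    rcases cyc4_apply_ne_zero hc with ⟨rfl, rfl⟩ | ⟨rfl, rfl⟩ | ⟨rfl, rfl⟩ | ⟨rfl, rfl⟩ |
      ⟨rfl, rfl⟩ | ⟨rfl, rfl⟩ | ⟨rfl, rfl⟩ | ⟨rfl, rfl⟩ <;>
      simp [k1, k2] at e1 e2 e3 e4)
  obtain ⟨t, ht, hts⟩ : ∃ t, cyc4 a b c p = cob G f t ∧ ∀ x, s x = 0 → t x = 0 := by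
    rcases z2_cases e with rfl | rfl
    · exact ⟨t, ht, he⟩
    · exact ⟨1 + t, by rw [cob_one_add, ht], fun x hx => by
        rw [Pi.add_apply, he x hx, Pi.one_apply, z2_add_self]⟩
  have hle : ∀ x, t x = 1 → s x = 1 := fun x hx => by
    by_contra hc
    rw [hts x (z2_ne_one.1 hc)] at hx
    exact absurd hx (by simp)
  have hle' : ∀ x, (s + t) x = 1 → s x = 1 := fun x hx => by
    by_contra hc
    have := z2_ne_one.1 hc
    rw [Pi.add_apply, this, hts x this] at hx
    exact absurd hx (by simp)
  obtain ⟨w, hw, hw'⟩ := hd.out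
  refine ⟨t, hle, ⟨hd.ab, hd.bc, h2.1.symm, h1.1.symm, hd.ac, hpb.symm, ht.symm, w, hw,
    fun h => hw' (supp_mono (reg_mono hle) h)⟩, ⟨h1.1, h2.1, hd.cd, hd.da, hd.ac, hpd, ?_, w, hw,
    fun h => hw' (supp_mono (reg_mono hle') h)⟩⟩
  rw [cob_add, hd.cob_eq, ← ht]
  unfold cyc4
  rw [edg_swap a p, edg_swap p c]
  funext u v
  simp only [Pi.add_apply]
  clear * -
  have key : ∀ i j k l m n : ZMod 2, i + j + k + l + (i + j + m + n) = n + m + k + l := by decide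
  exact key _ _ _ _ _ _

variable [Fintype F]

/-- A triangle-free region bounded by a quadrilateral is a face. -/
theorem Disk.face (h : MinBad G) (hf : IsTight G f) (n : ℕ) : ∀ (s : F → ZMod 2) (a b c d : V),
    #{x | s x = 1} = n → Disk G f s a b c d → tri (reg G f s) = ∅ → ∃ g, s = ind g := by
  induction n using Nat.strong_induction_on with
  | _ n ih =>
  intro s a b c d hn hd htri
  have a1 := reg_adj hd.edge
  have a2 := reg_adj hd.rot.edge
  have a3 := reg_adj hd.rot.rot.edge
  have a4 := reg_adj hd.rot.rot.rot.edge
  have t1 : ¬ (reg G f s).Adj a c := fun h => no_tri htri a1 a2 h.symm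
  have t2 : ¬ (reg G f s).Adj b d := fun h => no_tri htri a2 a3 h.symm
  have hcom : ∀ a b c d, Disk G f s a b c d → ∀ p, (reg G f s).Adj a p → (reg G f s).Adj p c →
      p = b ∨ p = d := by
    intro a b c d hd p h1 h2
    by_contra! hc
    obtain ⟨t, hts, d1, d2⟩ := hd.split hf hc.1 hc.2 h1 h2
    have lt : ∀ t' t'' : F → ZMod 2, t' + t'' = s → (∀ x, t' x = 1 → s x = 1) →
        (∃ x, t'' x = 1) → #{x | t' x = 1} < n := by
      rintro t' t'' hs hle ⟨x, hx⟩
      rw [← hn]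
      refine card_lt_card ⟨fun y hy => ?_, fun hc => ?_⟩
      · rw [mem_filter] at *
        exact ⟨mem_univ _, hle y hy.2⟩
      · rcases z2_cases (t' x) with h0 | h0
        · have : x ∈ ({x | s x = 1} : Finset F) := by simp [← hs, h0, hx]
          have := (mem_filter.1 (hc this)).2
          rw [h0] at this; exact absurd this (by simp)
        · have := hle x h0
          rw [← hs, Pi.add_apply, h0, hx] at this
          exact absurd this (by decide)
    have ne : ∀ {t : F → ZMod 2} {a b c d : V}, Disk G f t a b c d → ∃ x, t x = 1 := by
      intro t a b c d hd
      by_contra! hc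
      have := hd.edge
      rw [cob_adj hd.ab, z2_ne_one.1 (hc _), z2_ne_one.1 (hc _)] at this
      exact absurd this (by simp)
    have hst : ∀ x, (s + t) x = 1 → s x = 1 := by
      intro x hx
      rcases z2_cases (s x) with h0 | h0
      · rw [Pi.add_apply, h0, zero_add] at hx
        rw [hts x hx]
      · exact h0
    have sub : ∀ t : F → ZMod 2, (∀ x, t x = 1 → s x = 1) → tri (reg G f t) = ∅ := fun t ht =>
      subset_empty.1 (htri ▸ tri_mono (reg_mono ht))
    have hadd : t + (s + t) = s := by
      funext x; simp only [Pi.add_apply]; rw [add_left_comm, z2_add_self, add_zero]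
    obtain ⟨g1, hg1⟩ := ih _ (lt t (s + t) hadd hts (ne d2)) t a b c p rfl d1 (sub t hts)
    obtain ⟨g2, hg2⟩ := ih _ (lt (s + t) t ((add_comm _ _).trans hadd) hst (ne d1)) (s + t) a p c d
      rfl d2 (sub _ hst)
    have e1 : ∀ v, cob G f (ind g1) p v = two a c v := fun v => by
      rw [← hg1]; exact d1.rot.rot.rot.at v
    have e2 : ∀ v, cob G f (ind g2) p v = two a c v := fun v => by
      rw [← hg2, d2.rot.at, two_swap]
    have e3 := h.crit.two_faces hf.toIsDual hd.ac e1 e2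
    obtain ⟨x, hx⟩ := ne hd
    rw [← hadd, hg2, hg1, e3, Pi.add_apply, z2_add_self] at hx
    exact absurd hx (by simp)
  refine hf.region_eq_ind hd.minCyc (K := {a, b, c, d}) (fun w hwK hw => ?_) ?_
  · obtain ⟨χ, hχ⟩ := h.crit.exists_del w (supp_mono (reg_le s) hw)
    have hw' := hwK
    simp only [mem_insert, mem_singleton, not_or] at hw'
    obtain ⟨wa, wb, wc, wd⟩ := hw'
    have g1 := hχ a b ⟨hd.ab, Ne.symm wa, Ne.symm wb⟩
    have g2 := hχ b c ⟨hd.bc, Ne.symm wb, Ne.symm wc⟩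
    have g3 := hχ c d ⟨hd.cd, Ne.symm wc, Ne.symm wd⟩
    have g4 := hχ d a ⟨hd.da, Ne.symm wd, Ne.symm wa⟩
    obtain ⟨φ, hφ, hac, hbd⟩ : ∃ φ, Proper (reg G f s) φ ∧ (χ a = χ c ↔ φ a = φ c) ∧
        (χ b = χ d ↔ φ b = φ d) := by
      have eqs : ∀ p q r s : Fin 3, p ≠ q → q ≠ r → r ≠ s → s ≠ p → p ≠ r → q = s := by
        intro p q r s h1 h2 h3 h4 h5
        clear * - h1 h2 h3 h4 h5
        omega
      by_cases k1 : χ a = χ c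
      · by_cases k2 : χ b = χ d
        · obtain ⟨φ, col, hφ, hcol⟩ := exists_coloring_avoiding _ (reg G f s) {a, b, c, d} rfl
            (hf.isDual_reg hd.minCyc).hasDual htri card_le_four
          have two : ∀ p q r s : Fin 3, p ≠ q → q ≠ r → p ≠ s → q ≠ s → r ≠ s → p = r := by decide
          have c1 := hcol a (by simp)
          have c2 := hcol b (by simp)
          have c3 := hcol c (by simp)
          have c4 := hcol d (by simp)
          have e1 := two _ _ _ _ (hφ a b a1) (hφ b c a2) c1 c2 c3
          have e2 := two _ _ _ _ (hφ b c a2) (hφ c d a3) c2 c3 c4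
          exact ⟨φ, hφ, iff_of_true k1 e1, iff_of_true k2 e2⟩
        · obtain ⟨φ, hφ, e⟩ := hd.rot.exists_coloring_ne h hf (by simp [htri]) t2
            (fun p h1 h2 => hcom b c d a hd.rot p h1 h2)
          exact ⟨φ, hφ, iff_of_true k1 (eqs _ _ _ _ (hφ _ _ a4) (hφ _ _ a1) (hφ _ _ a2)
            (hφ _ _ a3) e.symm), iff_of_false k2 e⟩
      · obtain ⟨φ, hφ, e⟩ := hd.exists_coloring_ne h hf (by simp [htri]) t1 (hcom a b c d hd)
        exact ⟨φ, hφ, iff_of_false k1 e, iff_of_true (eqs _ _ _ _ g1 g2 g3 g4 k1)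
          (eqs _ _ _ _ (hφ _ _ a1) (hφ _ _ a2) (hφ _ _ a3) (hφ _ _ a4) e)⟩
    have f1 := hφ a b a1
    have f2 := hφ b c a2
    have f3 := hφ c d a3
    have f4 := hφ d a a4
    refine h.crit.glue hf.toIsDual (fun u hu => hd.vanish hu) hφ hwK hw hχ ?_
    have hac' : χ c = χ a ↔ φ c = φ a := by rw [eq_comm, hac, eq_comm]
    have hbd' : χ d = χ b ↔ φ d = φ b := by rw [eq_comm, hbd, eq_comm]
    simp only [mem_insert, mem_singleton]
    rintro x (rfl | rfl | rfl | rfl) y (rfl | rfl | rfl | rfl)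
    all_goals first | exact iff_of_true rfl rfl | assumption |
      exact iff_of_false (by assumption) (by assumption) |
      exact iff_of_false (Ne.symm (by assumption)) (Ne.symm (by assumption))
  · have sy : ∀ u v, cob G f s u v = 1 → cob G f s v u = 1 := fun u v h => by rwa [cob_symm]
    have e1 := hd.edge
    have e2 := hd.rot.edge
    have e3 := hd.rot.rot.edge
    have e4 := hd.rot.rot.rot.edge
    simp only [mem_insert, mem_singleton]
    rintro x (rfl | rfl | rfl | rfl) y (rfl | rfl | rfl | rfl) hxy
    all_goals first | exact absurd rfl hxy.ne | assumption | exact sy _ _ (by assumption) |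
      exact absurd hxy (by assumption) | exact absurd hxy.symm (by assumption)

end Disks

section Separation

variable [Fintype V] {F : Type*} {G : SimpleGraph V} {f : V → V → F}

lemma tri_supp {S : Finset V} (h : S ∈ tri G) {v : V} (hv : v ∈ S) : v ∈ supp G := by
  rcases tri_cases h v with h1 | ⟨y, z, -, h1, -⟩
  · exact absurd hv h1
  · exact supp_left h1

omit [Fintype V] in
lemma face_val {s : F → ZMod 2} {g : F} {u v : V} (hg : cob G f (ind g) u v = 1)
    (hs : cob G f s u v = 0) : s (f u v) = s g := by
  rcases side_of_cob_ind hg with ⟨h, -⟩ | ⟨h, -⟩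
  · rw [h]
  · rw [eq_of_cob (adj_of_cob hg) hs, h]

lemma Crit.tri_disjoint (h : Crit G) (hd : IsTight G f) {s t : F → ZMod 2}
    (hs : MinCyc G (cob G f s)) (hs3 : ∀ p q r, cob G f s ≠ cyc3 p q r)
    (ht : MinCyc G (cob G f t)) (ht3 : ∀ p q r, cob G f t ≠ cyc3 p q r)
    (hst : ∀ x, s x = 1 → t x = 1 → False) {S T : Finset V} (hS : S ∈ tri (reg G f s))
    (hT : T ∈ tri (reg G f t)) : S ≠ T := by
  rintro rfl
  rw [mem_tri, SimpleGraph.is3Clique_iff] at hS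
  obtain ⟨a, b, c, h1, h2, h3, rfl⟩ := hS
  obtain ⟨k1, k2, k3⟩ : (reg G f t).Adj a b ∧ (reg G f t).Adj a c ∧ (reg G f t).Adj b c := by
    have hc := (mem_tri.1 hT).1
    exact ⟨hc (by simp) (by simp) h1.ne, hc (by simp) (by simp) h2.ne,
      hc (by simp) (by simp) h3.ne⟩
  obtain ⟨g, hg, hg'⟩ := h.tri_reg hd hs (fun _ _ _ _ _ _ => hs3 _ _ _) h1 h3 h2.symm
  obtain ⟨e, he, he'⟩ := h.tri_reg hd ht (fun _ _ _ _ _ _ => ht3 _ _ _) k1 k3 k2.symm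
  have := h.two_faces hd.toIsDual (g := g) (g' := e) (p := a) h3.ne
    (fun v => by rw [hg', cyc3_at h1.ne h2.ne]) (fun v => by rw [he', cyc3_at h1.ne h2.ne])
  exact hst g hg (this ▸ he)

variable {g : F} {v0 v1 v2 v3 x y w : V}

lemma Cfg.disk (hc : Cfg G f g v0 v1 v2 v3 x y w) (h : MinBad G) (hf : IsTight G f) :
    ∃ s, Disk G f s x v1 v2 y ∧ s g = 0 ∧ v0 ∉ supp (reg G f s) ∧ v3 ∉ supp (reg G f s) := by
  obtain ⟨hg, x0, x1, xy, y2, xw, w3, nx2, nx3, ny0, nw1⟩ := hc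
  obtain ⟨a01, a12, a23, a30, d02, d13, -⟩ := id hg
  have n02 := h.crit.not_adj_diag hf hg
  have n13 := h.crit.not_adj_diag hf hg.rot
  have x2 : x ≠ v2 := by rintro rfl; exact n02 x0.symm
  have x3 : x ≠ v3 := by rintro rfl; exact n13 x1.symm
  have y0 : y ≠ v0 := by rintro rfl; exact n02 y2
  have y1 : y ≠ v1 := by rintro rfl; exact ny0 a01.symm
  have y3 : y ≠ v3 := by rintro rfl; exact ny0 a30
  obtain ⟨s, hs, hsg⟩ : ∃ s, cob G f s = cyc4 x v1 v2 y ∧ s g = 0 := by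
    obtain ⟨s, hs⟩ := hf.exact _ (isEven_cyc4 x1 a12 y2.symm xy.symm)
    rcases z2_cases (s g) with h0 | h0
    · exact ⟨s, hs.symm, h0⟩
    · exact ⟨1 + s, by rw [cob_one_add, hs], by simp [h0, z2_add_self]⟩
  have key : ∀ u v, u ≠ x → u ≠ v1 → u ≠ v2 → u ≠ y → cob G f (ind g) u v = 1 →
      u ∉ supp (reg G f s) := by
    intro u v h1 h2 h3 h4 hu hsu
    have h0 : ∀ v, cob G f s u v = 0 := fun v => by rw [hs, cyc4_out h1 h2 h3 h4]
    have := (h.crit.reg_of_inner hf.toIsDual hsu h0 (adj_of_cob hu)).2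
    rw [face_val hu (h0 v), hsg] at this
    exact absurd this (by simp)
  have k0 := key v0 v1 x0.ne' a01.ne d02 y0.symm ((hg.at _).trans (two_left d13))
  have k3 := key v3 v0 x3.symm d13.symm a23.ne' y3.symm
    ((hg.rot.rot.rot.at _).trans (two_left d02))
  exact ⟨s, ⟨x1, a12, y2.symm, xy.symm, x2, y1.symm, hs, v0, supp_left a01, k0⟩, hsg, k0, k3⟩

lemma Disk.disjoint {s t : F → ZMod 2} (hf : IsTight G f) (hA : Disk G f s x v1 v2 y)
    (hB : Disk G f t x v0 v3 w) (hg : QuadFace G f g v0 v1 v2 v3) (tg : t g = 0)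
    (h0 : v0 ∉ supp (reg G f s)) (h3 : v3 ∉ supp (reg G f s)) (h1 : v1 ∉ supp (reg G f t))
    (hin : w ≠ y → w ∈ supp (reg G f s) → (reg G f s).Adj w v3) (z : F) (hz : s z = 1)
    (hz' : t z = 1) : False := by
  have hmin : MinCyc G (cob G f (1 + s)) := by rw [cob_one_add]; exact hA.minCyc
  obtain ⟨c, hc⟩ := hf.nest hmin (t := t) (by
    intro u v huv e1 e2
    by_contra hne
    have one : ∀ a : ZMod 2, 1 + a = 0 → a = 1 := by decide
    replace e1 := one _ e1
    replace e2 := one _ e2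
    have hr : (reg G f s).Adj u v := ⟨huv, .inl e1⟩
    have last : ∀ u v, u = w → v = x → (reg G f s).Adj u v → cob G f s u v = 0 → False := by
      rintro u v rfl rfl hr h0'
      by_cases hwy : u = y
      · subst hwy
        rw [hA.rot.rot.rot.edge] at h0'
        exact absurd h0' (by simp)
      · exact h3 (supp_right (hin hwy (supp_left hr)))
    have hzero : cob G f s u v = 0 := by rw [cob_adj huv, e1, e2]; decide
    rw [hB.cob_eq] at hne
    rcases cyc4_apply_ne_zero hne with ⟨rfl, rfl⟩ | ⟨rfl, rfl⟩ | ⟨rfl, rfl⟩ | ⟨rfl, rfl⟩ |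
      ⟨rfl, rfl⟩ | ⟨rfl, rfl⟩ | ⟨rfl, rfl⟩ | ⟨rfl, rfl⟩
    all_goals first | exact h0 (supp_left hr) | exact h0 (supp_right hr) | exact h3 (supp_left hr) |
      exact h3 (supp_right hr) | exact last _ _ rfl rfl hr hzero |
      exact last _ _ rfl rfl hr.symm (by rwa [cob_symm]))
  have hg12 : cob G f (ind g) v1 v2 = 1 := (hg.rot.at _).trans (two_left hg.2.2.2.2.1.symm)
  have ht12 : cob G f t v1 v2 = 0 := by
    by_contra hne
    exact h1 (supp_left (reg_adj (z2_ne_zero.1 hne)))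
  have e1 : t (f v1 v2) = 0 := by rw [face_val hg12 ht12, tg]
  have e2 : t (f v2 v1) = 0 := by
    rw [← eq_of_cob hA.bc ht12, e1]
  have e3 := hA.rot.edge
  rw [cob_adj hA.bc] at e3
  have hc' : ∀ a, s a = 1 → t a = c := fun a ha => hc a (by
    rw [Pi.add_apply, ha, Pi.one_apply, z2_add_self])
  have : c = 0 := by
    rcases z2_cases (s (f v1 v2)) with k | k
    · rw [k, zero_add] at e3
      rw [← hc' _ e3, e2]
    · rw [← hc' _ k, e1]
  rw [hc' z hz, this] at hz'
  exact absurd hz' (by simp)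

omit [Fintype V] in
lemma cyc_sum (x y v0 v1 v2 v3 w : V) :
    cyc4 x v1 v2 y + cyc4 x v0 v3 w + cyc4 v0 v1 v2 v3 + cyc3 x v0 v1 = cyc5 x y v2 v3 w := by
  unfold cyc3 cyc4 cyc5
  rw [edg_swap v1 x, edg_swap v3 v0, edg_swap y x, edg_swap y v2, edg_swap v3 w]
  funext a b
  simp only [Pi.add_apply]
  generalize edg x v1 a b = e1, edg v1 v2 a b = e2, edg v2 y a b = e3, edg x y a b = e4,
    edg x v0 a b = e5, edg v0 v3 a b = e6, edg w v3 a b = e7, edg w x a b = e8,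
    edg v0 v1 a b = e9, edg v2 v3 a b = e10
  grind

end Separation

section Assembly

variable [Fintype V] {F : Type*} {G : SimpleGraph V} {f : V → V → F}
variable {g : F} {v0 v1 v2 v3 x y w : V}

/-- The vertices of a configuration other than `x` and `y`, `w` are spread out. -/
lemma Cfg.ne (hc : Cfg G f g v0 v1 v2 v3 x y w) (h : MinBad G) (hf : IsTight G f) :
    x ≠ v2 ∧ x ≠ v3 ∧ y ≠ v0 ∧ y ≠ v1 ∧ y ≠ v3 ∧ w ≠ v0 ∧ w ≠ v1 ∧ w ≠ v2 := by
  obtain ⟨hg, x0, x1, xy, y2, xw, w3, nx2, nx3, ny0, nw1⟩ := hc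
  obtain ⟨a01, a12, a23, a30, d02, d13, -⟩ := id hg
  have n02 := h.crit.not_adj_diag hf hg
  have n13 := h.crit.not_adj_diag hf hg.rot
  refine ⟨?_, ?_, ?_, ?_, ?_, ?_, ?_, ?_⟩
  · rintro rfl; exact n02 x0.symm
  · rintro rfl; exact n13 x1.symm
  · rintro rfl; exact n02 y2
  · rintro rfl; exact ny0 a01.symm
  · rintro rfl; exact ny0 a30
  · rintro rfl; exact nw1 a01
  · rintro rfl; exact n13 w3
  · rintro rfl; exact nx2 xw

lemma Cfg.cyc5_two (hc : Cfg G f g v0 v1 v2 v3 x y w) (h : MinBad G) (hf : IsTight G f)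
    (hyw : y ≠ w) : (∀ v, cyc5 x y v2 v3 w y v = two v2 x v) ∧
      (∀ v, cyc5 x y v2 v3 w v2 v = two v3 y v) ∧ ∀ v, cyc5 x y v2 v3 w v3 v = two w v2 v := by
  obtain ⟨x2, x3, y0, y1, y3, w0, w1, w2⟩ := hc.ne h hf
  have a23 := hc.face.2.2.1
  refine ⟨fun v => ?_, fun v => ?_, fun v => ?_⟩
  · rw [cyc5_rot, cyc5_at hc.y2.ne y3 hyw hc.xy.ne']
  · rw [cyc5_rot, cyc5_rot, cyc5_at a23.ne w2.symm x2.symm hc.y2.ne']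
  · rw [cyc5_rot, cyc5_rot, cyc5_rot, cyc5_at hc.w3.ne' x3.symm y3.symm a23.ne']

theorem Cfg.pentagon [Fintype F] (hc : Cfg G f g v0 v1 v2 v3 x y w) (h : MinBad G)
    (hf : IsTight G f) : y ≠ w ∧ ∃ s t c, Disk G f s x v1 v2 y ∧ s g = 0 ∧ s c = 0 ∧
      v0 ∉ supp (reg G f s) ∧ v3 ∉ supp (reg G f s) ∧ cob G f (ind t) = cyc3 x v0 v1 ∧
      cob G f (ind c) = cyc5 x y v2 v3 w ∧ #(tri (reg G f s)) ≤ 1 := by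
  obtain ⟨s, hA, hsg, hs0, hs3⟩ := hc.disk h hf
  obtain ⟨r, hB, hrg, hr1, hr2⟩ := hc.symm.disk h hf
  obtain ⟨x2, x3, y0, y1, y3, w0, w1, w2⟩ := hc.ne h hf
  have hc' := id hc
  obtain ⟨hg, x0, x1, xy, y2, xw, w3, nx2, nx3, ny0, nw1⟩ := hc'
  obtain ⟨a01, a12, a23, a30, d02, d13, -⟩ := id hg
  obtain ⟨t, ht⟩ := h.crit.triFace hf x0 a01 x1.symm
  have vA : ∀ v, cob G f s v0 v = 0 := hA.vanish (by simp [x0.ne', a01.ne, d02, y0.symm])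
  have vB : ∀ v, cob G f r v1 v = 0 := hB.vanish (by simp [x1.ne', a01.ne', d13, w1.symm])
  have g01 : cob G f (ind g) v0 v1 = 1 := (hg.at _).trans (two_left d13)
  have t01 : cob G f (ind t) v0 v1 = 1 := by
    rw [ht, cyc3_rot, cyc3_at a01.ne x0.ne', two_left x1.ne']
  have hgt : g ≠ t := face_ne (p := v0) (q := v3) ((hg.at _).trans (two_right d13)) (by
    rw [ht, cyc3_rot, cyc3_at a01.ne x0.ne', two_ne d13.symm x3.symm])
  have hst : s t = 0 := by rw [← face_val t01 (vA v1), face_val g01 (vA v1), hsg]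
  have hrt : r t = 0 := by
    rw [cob_symm] at t01
    rw [← face_val t01 (vB v0), face_val ((cob_symm _ _ _ _ _).trans g01) (vB v0), hrg]
  have dAB := Disk.disjoint hf hA hB hg hrg hs0 hs3 hr1 (fun hwy hw =>
    (h.crit.reg_of_inner hf.toIsDual hw (hA.vanish (by simp [xw.ne', w1, w2, hwy])) w3).1)
  have nA : ∃ S, S ∈ tri (reg G f s) := by
    by_contra hn
    push Not at hn
    obtain ⟨B, rfl⟩ := Disk.face h hf _ s _ _ _ _ rfl hA (eq_empty_of_forall_notMem hn)
    exact h.no_quad hf hc.symm ⟨hA.ab, hA.bc, hA.cd, hA.da, hA.ac, hA.bd, hA.cob_eq⟩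
  have nB : ∃ S, S ∈ tri (reg G f r) := by
    by_contra hn
    push Not at hn
    obtain ⟨B, rfl⟩ := Disk.face h hf _ r _ _ _ _ rfl hB (eq_empty_of_forall_notMem hn)
    exact h.no_quad hf hc ⟨hB.ab, hB.bc, hB.cd, hB.da, hB.ac, hB.bd, hB.cob_eq⟩
  obtain ⟨SA, hSA⟩ := nA
  obtain ⟨SB, hSB⟩ := nB
  have hT : {x, v0, v1} ∈ tri G := tri_mem x0 a01 x1.symm
  have mA := fun S (hS : S ∈ tri (reg G f s)) => tri_mono (reg_le s) hS
  have mB := tri_mono (reg_le r) hSB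
  have TA : ∀ S ∈ tri (reg G f s), {x, v0, v1} ≠ S := fun S hS =>
    ne_of_notMem (a := v0) (by simp) fun hm => hs0 (tri_supp hS hm)
  have TB : {x, v0, v1} ≠ SB :=
    ne_of_notMem (a := v1) (by simp) fun hm => hr1 (tri_supp hSB hm)
  have AB : ∀ S ∈ tri (reg G f s), S ≠ SB := fun S hS => h.crit.tri_disjoint hf hA.minCyc
    hA.ne_cyc3 hB.minCyc hB.ne_cyc3 dAB hS hSB
  have hyw : y ≠ w := by
    rintro rfl
    exact four_tri h.tri_le (tri_mem a23 w3.symm y2) hT (mA _ hSA) mB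
      (Ne.symm (ne_of_notMem (a := v0) (by simp) (by simp [d02, a30.ne', y0.symm])))
      (ne_of_notMem (a := v3) (by simp) fun hm => hs3 (tri_supp hSA hm))
      (ne_of_notMem (a := v2) (by simp) fun hm => hr2 (tri_supp hSB hm))
      (TA _ hSA) TB (AB _ hSA)
  have hcard : #(tri (reg G f s)) ≤ 1 := card_le_one.2 fun S hS S' hS' => by
    by_contra hne
    exact four_tri h.tri_le hT (mA _ hS) (mA _ hS') mB (TA _ hS) (TA _ hS') TB hne (AB _ hS)
      (AB _ hS')
  obtain ⟨q, hq⟩ : ∃ q, q = 1 + (s + r + ind g + ind t) := ⟨_, rfl⟩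
  have hqv : ∀ z, q z = 1 + (s z + r z + ind g z + ind t z) := fun z => by rw [hq]; rfl
  have hqc : cob G f q = cyc5 x y v2 v3 w := by
    rw [hq, cob_one_add, cob_add, cob_add, cob_add, hA.cob_eq, hB.cob_eq, hg.2.2.2.2.2.2, ht,
      cyc_sum]
  have hmin : MinCyc G (cob G f q) := by
    rw [hqc]; exact minCyc_cyc5 xy y2 a23 w3.symm xw.symm x2 x3 y3 hyw w2.symm
  have one_ind : ∀ a b : F, ind a b = 1 → b = a := fun a b hab => by
    by_contra hne; simp [ind, hne] at hab
  have dA : ∀ z, s z = 1 → q z = 1 → False := fun z h1 h2 => by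
    have e1 : r z = 0 := by
      by_contra hne; exact dAB z h1 (z2_ne_zero.1 hne)
    have e2 : ind g z = 0 := by
      by_contra hne; rw [one_ind _ _ (z2_ne_zero.1 hne), hsg] at h1; exact absurd h1 (by simp)
    have e3 : ind t z = 0 := by
      by_contra hne; rw [one_ind _ _ (z2_ne_zero.1 hne), hst] at h1; exact absurd h1 (by simp)
    rw [hqv, h1, e1, e2, e3] at h2
    exact absurd h2 (by decide)
  have dB : ∀ z, r z = 1 → q z = 1 → False := fun z h1 h2 => by
    have e1 : s z = 0 := by
      by_contra hne; exact dAB z (z2_ne_zero.1 hne) h1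
    have e2 : ind g z = 0 := by
      by_contra hne; rw [one_ind _ _ (z2_ne_zero.1 hne), hrg] at h1; exact absurd h1 (by simp)
    have e3 : ind t z = 0 := by
      by_contra hne; rw [one_ind _ _ (z2_ne_zero.1 hne), hrt] at h1; exact absurd h1 (by simp)
    rw [hqv, h1, e1, e2, e3] at h2
    exact absurd h2 (by decide)
  have hq0 : v0 ∉ supp (reg G f q) := fun hm => by
    have hv : ∀ v, cob G f q v0 v = 0 := fun v => by
      rw [hqc, cyc5_out x0.ne' y0.symm d02 a30.ne' w0.symm]
    have h1 := (h.crit.reg_of_inner hf.toIsDual hm hv a01).2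
    rw [face_val g01 (hv v1), hqv, hsg, hrg] at h1
    simp [ind, hgt] at h1
  have n5 : [x, y, v2, v3, w].Nodup := by
    simp [xy.ne, x2, x3, xw.ne, y2.ne, y3, hyw, a23.ne, w2.symm, w3.ne']
  have c1 : ∀ v, cyc5 x y v2 v3 w x v = two y w v := cyc5_at xy.ne x2 x3 xw.ne
  obtain ⟨c2, c3, c4⟩ := hc.cyc5_two h hf hyw
  have q3 : ∀ p q r, cyc5 x y v2 v3 w ≠ cyc3 p q r := by
    refine ne_cyc3 (K := {x, y, v2, v3}) ?_ ?_
    · rw [card_insert_of_notMem (by simp [xy.ne, x2, x3]),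
        card_insert_of_notMem (by simp [y2.ne, y3]), card_pair a23.ne]
    · simp only [mem_insert, mem_singleton]
      rintro u (rfl | rfl | rfl | rfl)
      exacts [⟨y, by rw [c1, two_left hyw]⟩, ⟨v2, by rw [c2, two_left x2.symm]⟩,
        ⟨v3, by rw [c3, two_left y3.symm]⟩, ⟨w, by rw [c4, two_left w2]⟩]
  rw [← hqc] at q3
  have hqt : tri (reg G f q) = ∅ := eq_empty_of_forall_notMem fun S hS =>
    four_tri h.tri_le hT (tri_mono (reg_le q) hS) (mA _ hSA) mB
      (ne_of_notMem (a := v0) (by simp) fun hm => hq0 (tri_supp hS hm)) (TA _ hSA) TB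
      (h.crit.tri_disjoint hf hA.minCyc hA.ne_cyc3 hmin q3 dA hSA hS).symm
      (h.crit.tri_disjoint hf hB.minCyc hB.ne_cyc3 hmin q3 dB hSB hS).symm (AB _ hSA)
  obtain ⟨c, rfl⟩ := h.crit.pentagon_face hf hmin hqc n5 hqt
  refine ⟨hyw, s, t, c, hA, hsg, ?_, hs0, hs3, ht, hqc, hcard⟩
  by_contra hne
  exact dA c (z2_ne_zero.1 hne) (by simp [ind])

end Assembly

section Corners

variable [Fintype V] {F : Type*} {G : SimpleGraph V} {f : V → V → F}

/-- At a corner of a region whose complement there consists of two faces meeting along `pq`, every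
edge other than `pq` lies in the region. -/
lemma Crit.reg_or_eq (h : Crit G) (hd : IsDual G f) {s : F → ZMod 2} {g1 g2 : F} {p a b q v : V}
    (hab : a ≠ b) (hqa : q ≠ a) (hqb : q ≠ b) (hs : ∀ v, cob G f s p v = two a b v)
    (h1 : ∀ v, cob G f (ind g1) p v = two a q v) (h2 : ∀ v, cob G f (ind g2) p v = two q b v)
    (hsq : ¬ (reg G f s).Adj p q) (hv : G.Adj p v) : (reg G f s).Adj p v ∨ v = q := by
  have e1 : cob G f (ind g1) p q = 1 := (h1 q).trans (two_right hqa.symm)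
  have e2 : cob G f (ind g2) p q = 1 := (h2 q).trans (two_left hqb)
  have hpq := adj_of_cob e1
  have hne : g1 ≠ g2 := face_ne ((h1 a).trans (two_left hqa.symm))
    ((h2 a).trans (two_ne hqa.symm hab))
  have hzero : ∀ v, cob G f (s + ind g1 + ind g2) p v = 0 := fun v => by
    rw [cob_add, cob_add]
    change cob G f s p v + cob G f (ind g1) p v + cob G f (ind g2) p v = 0
    rw [hs, h1, h2, two_swap a q, two_swap q b, add_right_comm]
    exact two_add_two a b q v
  have hnr : ∀ v, G.Adj p v → ¬ (reg G f s).Adj p v → s (f p v) = 0 ∧ s (f v p) = 0 :=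
    fun v hv hr => by
      constructor
      · by_contra hc; exact hr ⟨hv, .inl (z2_ne_zero.1 hc)⟩
      · by_contra hc; exact hr ⟨hv, .inr (z2_ne_zero.1 hc)⟩
  have hq1 : (s + ind g1 + ind g2) (f p q) = 1 := by
    change s (f p q) + ind g1 (f p q) + ind g2 (f p q) = 1
    rw [(hnr q hpq hsq).1]
    rcases side_of_cob_ind e1 with ⟨k1, k2⟩ | ⟨k1, k2⟩ <;>
      rcases side_of_cob_ind e2 with ⟨l1, l2⟩ | ⟨l1, l2⟩
    · exact absurd (k1.symm.trans l1) hne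
    · simp [ind, k1, l2, hne]
    · simp [ind, k2, l1, hne.symm]
    · exact absurd (k1.symm.trans l1) hne
  by_contra hc
  rw [not_or] at hc
  obtain ⟨s1, s2⟩ := hnr v hv hc.1
  have r1 := (h.rotate hd hzero hv hpq).trans hq1
  have r2 := (eq_of_cob hv (hzero v)).symm.trans r1
  change s (f p v) + ind g1 (f p v) + ind g2 (f p v) = 1 at r1
  change s (f v p) + ind g1 (f v p) + ind g2 (f v p) = 1 at r2
  rw [s1, zero_add] at r1
  rw [s2, zero_add] at r2
  have hcs : ∀ z, ind g1 z + ind g2 z = 1 → z = g1 ∨ z = g2 := fun z hz => by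
    by_contra hn
    rw [not_or] at hn
    simp [ind, hn.1, hn.2] at hz
  have hb := h.bridgeless hd hv
  have c1 : cob G f (ind g1) p v = 1 ∧ cob G f (ind g2) p v = 1 := by
    rw [cob_adj hv, cob_adj hv]
    rcases hcs _ r1 with k | k <;> rcases hcs _ r2 with l | l
    · exact absurd (k.trans l.symm) hb
    · simp [ind, k, l, hne, hne.symm]
    · simp [ind, k, l, hne, hne.symm]
    · exact absurd (k.trans l.symm) hb
  have c2 := two_ne_zero' (v := v) (by rw [← h1, c1.1]; simp)
  have c3 := two_ne_zero' (v := v) (by rw [← h2, c1.2]; simp)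
  rcases c2 with rfl | rfl
  · exact c3.elim hqa.symm hab
  · exact hc.2 rfl

end Corners

section Conclusion

variable [Fintype V] {F : Type*} {G : SimpleGraph V} {f : V → V → F}
variable {g : F} {v0 v1 v2 v3 x y w : V}

lemma Cfg.not_minBad [Fintype F] (hc : Cfg G f g v0 v1 v2 v3 x y w) (hf : IsTight G f)
    (h : MinBad G) : False := by
  obtain ⟨hyw, s, t, c, hA, hsg, hsc, hs0, hs3, ht, hcc, hcard⟩ := hc.pentagon h hf
  obtain ⟨x2, x3, y0, y1, y3, w0, w1, w2⟩ := hc.ne h hf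
  obtain ⟨c2, c3, c4⟩ := hc.cyc5_two h hf hyw
  rw [← hcc] at c2 c3 c4
  have hd := hf.toIsDual
  have hc' := id hc
  obtain ⟨hg, x0, x1, xy, y2, xw, w3, nx2, nx3, ny0, nw1⟩ := hc'
  obtain ⟨a01, a12, a23, a30, d02, d13, -⟩ := id hg
  have inner : ∀ u ∈ supp (reg G f s), u ≠ x → u ≠ v1 → u ≠ v2 → u ≠ y → ∀ v, G.Adj u v →
      (reg G f s).Adj u v := fun u hu h1 h2 h3 h4 v hv =>
    (h.crit.reg_of_inner hd hu (hA.vanish (by simp [h1, h2, h3, h4])) hv).1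
  have at1 : ∀ v, G.Adj v1 v → (reg G f s).Adj v1 v ∨ v = v0 := fun v hv =>
    h.crit.reg_or_eq hd (g1 := t) (g2 := g) x2 x0.ne' d02
      (fun v => by rw [hA.rot.at, two_swap])
      (fun v => by rw [ht, cyc3_rot, cyc3_rot, cyc3_at x1.ne' a01.ne'])
      (fun v => by rw [hg.rot.at, two_swap]) (fun hr => hs0 (supp_right hr)) hv
  have at2 : ∀ v, G.Adj v2 v → (reg G f s).Adj v2 v ∨ v = v3 := fun v hv =>
    h.crit.reg_or_eq hd (g1 := g) (g2 := c) y1.symm d13.symm y3.symm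
      (fun v => by rw [hA.rot.rot.at, two_swap]) (fun v => by rw [hg.rot.rot.at, two_swap])
      c3 (fun hr => hs3 (supp_right hr)) hv
  have aty : ∀ v, G.Adj y v → (reg G f s).Adj y v := fun v hv => by
    have hz : ∀ v, cob G f (s + ind c) y v = 0 := fun v => by
      rw [cob_add]
      change cob G f s y v + cob G f (ind c) y v = 0
      rw [hA.rot.rot.rot.at, c2, two_swap, z2_add_self]
    have e1 : cob G f s y x = 1 := hA.rot.rot.rot.edge
    have e2 : cob G f (ind c) y x = 1 := by rw [c2, two_right x2.symm]
    have e3 : (s + ind c) (f y x) = 1 := by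
      change s (f y x) + ind c (f y x) = 1
      rcases side_of_cob_ind e2 with ⟨k1, k2⟩ | ⟨k1, k2⟩
      · rw [k1, hsc]; simp [ind]
      · rw [cob_adj xy.symm, k1, hsc, add_zero] at e1
        rw [e1]; simp [ind, k2]
    have r1 := (h.crit.rotate hd hz hv xy.symm).trans e3
    have r2 := (eq_of_cob hv (hz v)).symm.trans r1
    change s (f y v) + ind c (f y v) = 1 at r1
    change s (f v y) + ind c (f v y) = 1 at r2
    refine ⟨hv, ?_⟩
    by_contra hn
    rw [not_or] at hn
    rw [z2_ne_one.1 hn.1, zero_add] at r1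
    rw [z2_ne_one.1 hn.2, zero_add] at r2
    refine h.crit.bridgeless hd hv ?_
    have hi : ∀ z, ind c z = 1 → z = c := fun z hz => by
      by_contra hne; simp [ind, hne] at hz
    rw [hi _ r1, hi _ r2]
  have hcom : ∀ p, (reg G f s).Adj x p → (reg G f s).Adj p v2 → p = v1 ∨ p = y := by
    intro p hxp hp2
    by_contra hn
    rw [not_or] at hn
    have hp3 : p ≠ v3 := by rintro rfl; exact hs3 (supp_right hxp)
    have hp : Cfg G f g v0 v1 v2 v3 x p w := ⟨hg, x0, x1, reg_le s hxp, reg_le s hp2, xw, w3, nx2,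
      nx3, fun hp0 => hs0 (supp_right (inner p (supp_right hxp) hxp.ne' hn.1 hp2.ne hn.2 _ hp0)),
      nw1⟩
    obtain ⟨hpw, -, -, c', -, -, -, -, -, -, hcc', -⟩ := hp.pentagon h hf
    obtain ⟨-, p3, p4⟩ := hp.cyc5_two h hf hpw
    rw [← hcc'] at p3 p4
    obtain rfl := h.crit.two_faces hd w2 c4 p4
    have := (c3 p).symm.trans ((p3 p).trans (two_right hp3.symm))
    exact (two_ne_zero' (by rw [this]; simp)).elim hp3 hn.2
  obtain ⟨ψ, hψ, hne⟩ := hA.exists_coloring_ne h hf hcard (fun hr => nx2 (reg_le s hr)) hcom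
  obtain ⟨χ, hχ⟩ := h.crit.exists_del v1 (supp_left a12)
  have hχx : χ x ≠ χ v0 := hχ x v0 ⟨x0, x1.ne, a01.ne⟩
  obtain ⟨σ, hσ⟩ := exists_perm χ (fun v => if v = x then ψ x else ψ v2) {x, v0} (by
    intro p hp q hq
    rw [mem_insert, mem_singleton] at hp hq
    rcases hp with rfl | rfl <;> rcases hq with rfl | rfl <;>
      simp [x0.ne', hχx, hχx.symm, hne, hne.symm])
  have σx : σ (χ x) = ψ x := by simpa using hσ x (by simp)
  have σ0 : σ (χ v0) = ψ v2 := by simpa [x0.ne'] using hσ v0 (by simp)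
  have out : ∀ u v, u ∈ supp (reg G f s) → u ≠ x → G.Adj u v → (reg G f s).Adj u v ∨
      (u = v1 ∧ v = v0) ∨ (u = v2 ∧ v = v3) := by
    intro u v hu hux huv
    by_cases h1 : u = v1
    · subst h1; exact (at1 v huv).imp_right fun h => .inl ⟨rfl, h⟩
    by_cases h2 : u = v2
    · subst h2; exact (at2 v huv).imp_right fun h => .inr ⟨rfl, h⟩
    by_cases h3 : u = y
    · subst h3; exact .inl (aty v huv)
    · exact .inl (inner u hu hux h1 h2 h3 v huv)
  have v1m : v1 ∈ supp (reg G f s) := supp_right (reg_adj hA.edge)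
  have mixed : ∀ u v, u ∈ supp (reg G f s) → u ≠ x → ¬ (v ∈ supp (reg G f s) ∧ v ≠ x) →
      G.Adj u v → ψ u ≠ σ (χ v) := by
    intro u v hu hux hv huv
    rcases out u v hu hux huv with hr | ⟨rfl, rfl⟩ | ⟨rfl, rfl⟩
    · have hvx : v = x := by
        by_contra hn; exact hv ⟨supp_right hr, hn⟩
      rw [hvx, σx]
      exact hψ _ _ (hvx ▸ hr)
    · rw [σ0]
      exact hψ _ _ (reg_adj hA.rot.edge)
    · rw [← σ0]
      exact fun he => hχ v0 v ⟨a30.symm, a01.ne, d13.symm⟩ (σ.injective he)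
  refine h.not_proper (fun u => if u ∈ supp (reg G f s) ∧ u ≠ x then ψ u else σ (χ u))
    fun u v huv => ?_
  by_cases hu : u ∈ supp (reg G f s) ∧ u ≠ x <;> by_cases hv : v ∈ supp (reg G f s) ∧ v ≠ x
  · simp only [if_pos hu, if_pos hv]
    rcases out u v hu.1 hu.2 huv with hr | ⟨rfl, rfl⟩ | ⟨rfl, rfl⟩
    exacts [hψ _ _ hr, absurd hv.1 hs0, absurd hv.1 hs3]
  · simp only [if_pos hu, if_neg hv]
    exact mixed u v hu.1 hu.2 hv huv
  · simp only [if_neg hu, if_pos hv]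
    exact (mixed v u hv.1 hv.2 hu huv.symm).symm
  · simp only [if_neg hu, if_neg hv]
    have n1 : ∀ z, ¬ (z ∈ supp (reg G f s) ∧ z ≠ x) → z ≠ v1 := by
      rintro z hz rfl; exact hz ⟨v1m, x1.ne'⟩
    exact fun he => hχ u v ⟨huv, n1 u hu, n1 v hv⟩ (σ.injective he)

theorem HasDual.exists_proper (n : ℕ) : ∀ G : SimpleGraph V, #(supp G) = n → HasDual G →
    #(tri G) ≤ 3 → ∃ φ, Proper G φ := by
  induction n using Nat.strong_induction_on with
  | _ n ih =>
  rintro G rfl hG ht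
  by_contra hn
  push Not at hn
  have h : MinBad G := ⟨hn, hG, ht, fun G' hlt => ih _ hlt G' rfl⟩
  obtain ⟨k, f, hf⟩ := hG.exists_tight
  obtain ⟨g, v0, v1, v2, v3, x, y, w, hc⟩ := h.exists_cfg hf
  exact hc.not_minBad hf h

end Conclusion

end ThreeTriangles

/-- Grünbaum–Aksenov: every planar graph with at most three triangles is 3-colorable. -/
theorem three_colorable_of_at_most_three_triangles [Fintype V] (G : SimpleGraph V)
    (hplanar : G.IsPlanar)
    (htri : {s : Finset V | G.IsNClique 3 s}.ncard ≤ 3) : G.Colorable 3 := by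
  classical
  have h : {s : Finset V | G.IsNClique 3 s} = (ThreeTriangles.tri G : Set (Finset V)) := by
    ext s; simp [ThreeTriangles.mem_tri]
  rw [h, Set.ncard_coe_finset] at htri
  obtain ⟨φ, hφ⟩ := ThreeTriangles.HasDual.exists_proper _ G rfl
    (ThreeTriangles.hasDual_of_isPlanar hplanar) htri
  exact ⟨SimpleGraph.Coloring.mk φ fun {u v} huv => hφ u v huv⟩
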